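/- A smooth closed (compact without boundary) Levi-flat hypersurface M in CP^n, n ≥ 2, cannot contain a compact leaf of its Levi foliation; i.e., no leaf of the Levi foliation of M is a compact complex hypersurface. -/

import Mathlib

/- STATEMENT 12: A smooth closed (compact without boundary) Levi-flat hypersurface M in
ℂℙⁿ, n ≥ 2, cannot contain a compact leaf of its Levi foliation.

Subsets of ℂℙⁿ are encoded by cones in ℂ^{n+1} ∖ {0}.  Leaves of the Levi foliation are
the chains of plaques (connected pieces of complex hypersurfaces contained in M); the
cone over a leaf represents a compact leaf of the Levi foliation in ℂℙⁿ exactly when it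
is closed in ℂ^{n+1} ∖ {0}; so "no compact leaf" says every leaf has a limit point
(other than the origin) outside itself. -/

open Complex Set

noncomputable section

/-- The Levi form (up to a positive factor) of the defining function `ρ` at `p`,
evaluated at `w`: `D²ρ(p)(w,w) + D²ρ(p)(Jw,Jw) = 4 ∑ ∂²ρ/∂zⱼ∂z̄ₖ wⱼ w̄ₖ`. -/
def leviForm {m : ℕ} (ρ : (Fin m → ℂ) → ℝ) (p w : Fin m → ℂ) : ℝ :=
  iteratedFDeriv ℝ 2 ρ p ![w, w] + iteratedFDeriv ℝ 2 ρ p ![Complex.I • w, Complex.I • w]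

/-- `w` belongs to the complex tangent space at `p` of the hypersurface `{ρ = 0}`. -/
def IsComplexTangent {m : ℕ} (ρ : (Fin m → ℂ) → ℝ) (p w : Fin m → ℂ) : Prop :=
  fderiv ℝ ρ p w = 0 ∧ fderiv ℝ ρ p (Complex.I • w) = 0

/-- `M` is a smooth (`C^∞`) Levi-flat real hypersurface: near each of its points it is
the zero set of a smooth defining function with nonvanishing gradient whose Levi form
vanishes identically on complex tangent vectors. -/
def IsSmoothLeviFlatHypersurface {m : ℕ} (M : Set (Fin m → ℂ)) : Prop :=
  ∀ p ∈ M, ∃ V : Set (Fin m → ℂ), IsOpen V ∧ p ∈ V ∧ ∃ ρ : (Fin m → ℂ) → ℝ,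
    (∀ k : ℕ, ContDiffOn ℝ k ρ V) ∧ (∀ q ∈ V, fderiv ℝ ρ q ≠ 0) ∧
    (∀ q ∈ V, q ∈ M ↔ ρ q = 0) ∧
    (∀ q ∈ V, ρ q = 0 → ∀ w, IsComplexTangent ρ q w → leviForm ρ q w = 0)

/-- `S` is a cone: it is invariant under multiplication by nonzero complex scalars.
Subsets of `ℂℙⁿ` are encoded by the cones over them in `ℂ^{n+1} ∖ {0}`. -/
def IsCone {m : ℕ} (S : Set (Fin m → ℂ)) : Prop :=
  ∀ c : ℂ, c ≠ 0 → ∀ z ∈ S, c • z ∈ S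

/-- The cone `S ⊆ ℂ^{n+1} ∖ {0}` represents a closed (= compact) subset of `ℂℙⁿ`:
it is closed in the punctured space `ℂ^{n+1} ∖ {0}`. -/
def IsClosedInPunctured {m : ℕ} (S : Set (Fin m → ℂ)) : Prop :=
  ∀ z ∈ closure S, z ≠ 0 → z ∈ S

/-- The cone over a closed subset of `ℂℙⁿ`. -/
def IsProjectiveClosedSet {m : ℕ} (S : Set (Fin m → ℂ)) : Prop :=
  S.Nonempty ∧ (∀ z ∈ S, z ≠ 0) ∧ IsCone S ∧ IsClosedInPunctured S

/-- Two points are related if they lie on a common plaque of the Levi foliation of `M`: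
a connected piece of a complex hypersurface `{f = 0}` entirely contained in `M`. -/
def LeviPlaqueRel {m : ℕ} (M : Set (Fin m → ℂ)) (p q : Fin m → ℂ) : Prop :=
  ∃ U : Set (Fin m → ℂ), IsOpen U ∧ ∃ f : (Fin m → ℂ) → ℂ,
    DifferentiableOn ℂ f U ∧ (∀ z ∈ U, fderiv ℂ f z ≠ 0) ∧
    {z ∈ U | f z = 0} ⊆ M ∧ p ∈ U ∧ f p = 0 ∧
    q ∈ connectedComponentIn {z ∈ U | f z = 0} p

/-- The leaf of the Levi foliation of `M` through `p`: the set of points reachable from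
`p` by chains of plaques. -/
def leviLeaf {m : ℕ} (M : Set (Fin m → ℂ)) (p : Fin m → ℂ) : Set (Fin m → ℂ) :=
  {q | Relation.ReflTransGen (LeviPlaqueRel M) p q}

/-- The lift of the direction `v` to the graph of the form `A`, in the vertical direction `e`. -/
def hatLift {V : Type*} [NormedAddCommGroup V] [NormedSpace ℂ V]
    (A : V → V →L[ℂ] ℂ) (e z v : V) : V := v + (A z v) • e

/-- A bounded, Lipschitz field of linear forms with a quadratic Taylor bound. -/
structure TameField {V : Type*} [NormedAddCommGroup V] [NormedSpace ℂ V]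
    (A : V → V →L[ℂ] ℂ) (e : V) (K : ℝ) : Prop where
  nonneg : 0 ≤ K
  norm_e : ‖e‖ ≤ K
  bound : ∀ z, ‖A z‖ ≤ K
  lip : ∀ z z', ‖A z' - A z‖ ≤ K * ‖z' - z‖
  diff : ∀ z, DifferentiableAt ℝ A z
  taylor : ∀ z z', ‖A z' - A z - fderiv ℝ A z (z' - z)‖ ≤ K * ‖z' - z‖ ^ 2

section Flow

variable {V : Type*} [NormedAddCommGroup V] [NormedSpace ℂ V]
  {A : V → V →L[ℂ] ℂ} {e : V} {K : ℝ}

lemma hatLift_add (z v w : V) : hatLift A e z (v + w) = hatLift A e z v + hatLift A e z w := by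
  simp only [hatLift, map_add, add_smul]; abel

lemma hatLift_neg (z v : V) : hatLift A e z (-v) = -hatLift A e z v := by
  simp only [hatLift, map_neg, neg_smul]; abel

lemma TameField.norm_hatLift_le (hA : TameField A e K) (z v : V) :
    ‖hatLift A e z v‖ ≤ (1 + K ^ 2) * ‖v‖ := by
  have h1 : ‖A z v‖ ≤ K * ‖v‖ := (A z).le_of_opNorm_le (hA.bound z) v
  have h2 : ‖(A z v) • e‖ ≤ K * ‖v‖ * K := by
    rw [norm_smul]
    exact mul_le_mul h1 hA.norm_e (norm_nonneg _) (mul_nonneg hA.nonneg (norm_nonneg _))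
  calc ‖hatLift A e z v‖ ≤ ‖v‖ + ‖(A z v) • e‖ := norm_add_le _ _
    _ ≤ _ := by nlinarith

lemma TameField.norm_hatLift_sub_le (hA : TameField A e K) (z z' v : V) :
    ‖hatLift A e z' v - hatLift A e z v‖ ≤ K ^ 2 * ‖v‖ * ‖z' - z‖ := by
  have h0 : hatLift A e z' v - hatLift A e z v = ((A z' - A z) v) • e := by
    simp only [hatLift, sub_apply, sub_smul]; abel
  have h1 : ‖(A z' - A z) v‖ ≤ K * ‖z' - z‖ * ‖v‖ :=
    (A z' - A z).le_of_opNorm_le (hA.lip z z') v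
  rw [h0, norm_smul]
  calc _ ≤ K * ‖z' - z‖ * ‖v‖ * K :=
        mul_le_mul h1 hA.norm_e (norm_nonneg _) (by have := hA.nonneg; positivity)
    _ = _ := by ring

lemma TameField.exists_flow [CompleteSpace V] (hA : TameField A e K) (q v : V) :
    ∃ X : ℝ → V, X 0 = q ∧
      ∀ t ∈ Icc (0:ℝ) 1, HasDerivWithinAt X (hatLift A e (X t) v) (Icc 0 1) t := by
  have hp : IsPicardLindelof (fun _ : ℝ => fun z => hatLift A e z v)
      (⟨0, by simp⟩ : Icc (0:ℝ) 1) q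
      (Real.toNNReal ((1 + K ^ 2) * ‖v‖)) 0 (Real.toNNReal ((1 + K ^ 2) * ‖v‖))
      (Real.toNNReal (K ^ 2 * ‖v‖)) := by
    refine IsPicardLindelof.of_time_independent ?_ ?_ ?_
    · intro x _
      rw [Real.coe_toNNReal _ (by positivity)]
      exact hA.norm_hatLift_le x v
    · refine LipschitzOnWith.of_dist_le_mul fun x _ y _ => ?_
      rw [Real.coe_toNNReal _ (by positivity), dist_eq_norm, dist_eq_norm]
      exact hA.norm_hatLift_sub_le y x v
    · simp
  obtain ⟨X, h0, h1⟩ := hp.exists_eq_forall_mem_Icc_hasDerivWithinAt (x := q) (by simp)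
  exact ⟨X, h0, h1⟩

lemma gronwallBound_one_le {δ K ε : ℝ} (hK : 0 < K) (hε : 0 ≤ ε) {t : ℝ} (ht : t ∈ Icc (0:ℝ) 1)
    (hδ : 0 ≤ δ) : gronwallBound δ K ε t ≤ (δ + ε) * Real.exp K := by
  rw [gronwallBound_of_K_ne_0 hK.ne']
  have h1 : Real.exp (K * t) ≤ Real.exp K := Real.exp_le_exp.2 (by nlinarith [ht.2])
  have h2 : Real.exp K - 1 ≤ K * Real.exp K := by
    have := Real.add_one_le_exp (-K)
    have h3 : Real.exp (-K) * Real.exp K = 1 := by rw [← Real.exp_add]; simp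
    nlinarith [Real.exp_pos K]
  have h3 : ε / K * (Real.exp (K * t) - 1) ≤ ε / K * (K * Real.exp K) :=
    mul_le_mul_of_nonneg_left (by linarith) (by positivity)
  have h4 : ε / K * (K * Real.exp K) = ε * Real.exp K := by field_simp
  have h5 := mul_le_mul_of_nonneg_left h1 hδ
  simp only
  linarith

lemma HasDerivWithinAt.Ici_of_Icc {X : ℝ → V} {X' : V} {t : ℝ} (ht : t ∈ Ico (0:ℝ) 1)
    (h : HasDerivWithinAt X X' (Icc 0 1) t) : HasDerivWithinAt X X' (Ici t) t := by
  have h1 : HasDerivWithinAt X X' (Icc t 1) t := h.mono (Icc_subset_Icc_left ht.1)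
  refine h1.mono_of_mem_nhdsWithin ?_
  exact Icc_mem_nhdsGE ht.2

lemma TameField.approx (hA : TameField A e K) {u X Y Y' : ℝ → V} {U ε : ℝ}
    (hε : 0 ≤ ε) (hu : ∀ t ∈ Icc (0:ℝ) 1, ‖u t‖ ≤ U)
    (hX : ∀ t ∈ Icc (0:ℝ) 1, HasDerivWithinAt X (hatLift A e (X t) (u t)) (Icc 0 1) t)
    (hY : ∀ t ∈ Icc (0:ℝ) 1, HasDerivWithinAt Y (Y' t) (Icc 0 1) t)
    (hY' : ∀ t ∈ Icc (0:ℝ) 1, ‖Y' t - hatLift A e (Y t) (u t)‖ ≤ ε) :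
    ∀ t ∈ Icc (0:ℝ) 1, ‖X t - Y t‖ ≤ (‖X 0 - Y 0‖ + ε) * Real.exp (K ^ 2 * U + 1) := by
  intro t ht
  have hU : 0 ≤ U := (norm_nonneg _).trans (hu 0 (by simp))
  have key := dist_le_of_approx_trajectories_ODE_of_mem (E := V)
    (v := fun t z => hatLift A e z (u t)) (s := fun _ => univ)
    (K := Real.toNNReal (K ^ 2 * U + 1)) (f := X) (g := Y) (a := 0) (b := 1)
    (f' := fun t => hatLift A e (X t) (u t)) (g' := Y') (εf := 0) (εg := ε) (δ := ‖X 0 - Y 0‖)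
    ?_ (fun s hs => (hX s hs).continuousWithinAt)
    (fun s hs => HasDerivWithinAt.Ici_of_Icc hs (hX s ⟨hs.1, hs.2.le⟩))
    (by simp) (by simp) (fun s hs => (hY s hs).continuousWithinAt)
    (fun s hs => HasDerivWithinAt.Ici_of_Icc hs (hY s ⟨hs.1, hs.2.le⟩))
    (fun s hs => by rw [dist_eq_norm]; exact hY' s ⟨hs.1, hs.2.le⟩) (by simp)
    (by rw [dist_eq_norm]) t ht
  · rw [dist_eq_norm] at key
    refine key.trans ?_
    rw [Real.coe_toNNReal _ (by positivity)]
    have := gronwallBound_one_le (δ := ‖X 0 - Y 0‖) (K := K ^ 2 * U + 1) (ε := 0 + ε) (t := t - 0)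
      (by positivity) (by simpa using hε) (by simpa using ht) (norm_nonneg _)
    simpa using this
  · intro s hs
    refine LipschitzOnWith.of_dist_le_mul fun x _ y _ => ?_
    rw [Real.coe_toNNReal _ (by positivity), dist_eq_norm, dist_eq_norm]
    refine (hA.norm_hatLift_sub_le y x (u s)).trans ?_
    have h1 := hu s ⟨hs.1, hs.2.le⟩
    have : K ^ 2 * ‖u s‖ ≤ K ^ 2 * U := by gcongr
    exact mul_le_mul_of_nonneg_right (by linarith) (norm_nonneg _)

variable [CompleteSpace V]

/-- The integral curve of the lifted constant field `v` starting at `q`. -/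
def TameField.flow (hA : TameField A e K) (q v : V) : ℝ → V := (hA.exists_flow q v).choose

lemma TameField.flow_zero (hA : TameField A e K) (q v : V) : hA.flow q v 0 = q :=
  (hA.exists_flow q v).choose_spec.1

lemma TameField.hasDerivWithinAt_flow (hA : TameField A e K) (q v : V) :
    ∀ t ∈ Icc (0:ℝ) 1,
      HasDerivWithinAt (hA.flow q v) (hatLift A e (hA.flow q v t) v) (Icc 0 1) t :=
  (hA.exists_flow q v).choose_spec.2

lemma TameField.norm_flow_sub_le (hA : TameField A e K) (q v : V) {t : ℝ} (ht : t ∈ Icc (0:ℝ) 1) :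
    ‖hA.flow q v t - q‖ ≤ (1 + K ^ 2) * ‖v‖ := by
  have := (convex_Icc (0:ℝ) 1).norm_image_sub_le_of_norm_hasDerivWithin_le
    (hA.hasDerivWithinAt_flow q v) (fun s _ => hA.norm_hatLift_le _ v)
    (left_mem_Icc.2 zero_le_one) ht
  rw [hA.flow_zero] at this
  refine this.trans ?_
  rw [sub_zero, Real.norm_of_nonneg ht.1]
  exact mul_le_of_le_one_right (by positivity) ht.2

/-- The time-one map. -/
def TameField.E (hA : TameField A e K) (q v : V) : V := hA.flow q v 1

lemma TameField.norm_E_sub_le (hA : TameField A e K) (q v : V) :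
    ‖hA.E q v - q‖ ≤ (1 + K ^ 2) * ‖v‖ := hA.norm_flow_sub_le q v (by simp)

/-- Any solution is the flow. -/
lemma TameField.eq_E (hA : TameField A e K) {q v : V} {Y : ℝ → V} (h0 : Y 0 = q)
    (hY : ∀ t ∈ Icc (0:ℝ) 1, HasDerivWithinAt Y (hatLift A e (Y t) v) (Icc 0 1) t) :
    Y 1 = hA.E q v := by
  have := hA.approx (u := fun _ => v) (U := ‖v‖) le_rfl (fun _ _ => le_rfl)
    (hA.hasDerivWithinAt_flow q v) hY (by simp) 1 (by simp)
  rw [hA.flow_zero, h0] at this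
  have h2 : ‖hA.flow q v 1 - Y 1‖ = 0 := le_antisymm (by simpa using this) (norm_nonneg _)
  exact (sub_eq_zero.1 (norm_eq_zero.1 h2)).symm

lemma TameField.E_E_neg (hA : TameField A e K) (q v : V) : hA.E (hA.E q v) (-v) = q := by
  have : (fun t => hA.flow q v (1 - t)) 1 = hA.E (hA.E q v) (-v) := by
    refine hA.eq_E (Y := fun t => hA.flow q v (1 - t)) (by simp only [sub_zero]; rfl) fun t ht => ?_
    have h1 := hA.hasDerivWithinAt_flow q v (1 - t) ⟨by linarith [ht.2], by linarith [ht.1]⟩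
    have h2 : HasDerivWithinAt (fun t : ℝ => 1 - t) (-1) (Icc 0 1) t :=
      (hasDerivWithinAt_id t _).const_sub 1
    have h3 := h1.scomp t h2 (fun s hs => ⟨by linarith [hs.2], by linarith [hs.1]⟩)
    rw [hatLift_neg, ← neg_one_smul ℝ (hatLift A e _ v)]
    exact h3
  rw [← this]
  simp only [sub_self, hA.flow_zero]

lemma TameField.flow_form (hA : TameField A e K) (q v : V) (l : V →L[ℂ] ℂ) (hl : l e = 1)
    {t : ℝ} (ht : t ∈ Icc (0:ℝ) 1) :
    hA.flow q v t = q + (t : ℂ) • v + (l (hA.flow q v t - q - (t : ℂ) • v)) • e := by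
  let P : V →L[ℝ] V := ((ContinuousLinearMap.id ℂ V) - l.smulRight e).restrictScalars ℝ
  have hP : ∀ z, P z = z - l z • e := fun z => by simp [P]
  have hd : ∀ s ∈ Icc (0:ℝ) 1,
      HasDerivWithinAt (fun s => P (hA.flow q v s - (s:ℂ) • v)) 0 (Icc 0 1) s := by
    intro s hs
    have h1 := hA.hasDerivWithinAt_flow q v s hs
    have h2 : HasDerivWithinAt (fun s : ℝ => (s:ℂ) • v) v (Icc 0 1) s := by
      simpa using (((Complex.ofRealCLM.hasDerivAt (x := s)).smul_const v).hasDerivWithinAt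
        (s := Icc 0 1))
    have h3 := P.hasFDerivAt.comp_hasDerivWithinAt s (h1.sub h2)
    have h4 : P (hatLift A e (hA.flow q v s) v - v) = 0 := by simp [hP, hatLift, hl]
    rw [h4] at h3
    exact h3
  have hc := (convex_Icc (0:ℝ) 1).norm_image_sub_le_of_norm_hasDerivWithin_le (C := 0) hd
    (by simp) (left_mem_Icc.2 zero_le_one) ht
  rw [hA.flow_zero] at hc
  simp only [zero_mul, norm_le_zero_iff, sub_eq_zero, hP, Complex.ofReal_zero, zero_smul,
    sub_zero] at hc
  have h4 : l (hA.flow q v t - q - (t : ℂ) • v) = l (hA.flow q v t - (t:ℂ) • v) - l q := by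
    simp only [map_sub]; ring
  rw [h4, sub_smul]
  have h5 := congrArg (fun z => z + (t:ℂ) • v + l (hA.flow q v t - (t:ℂ) • v) • e) hc
  calc hA.flow q v t = hA.flow q v t - (t:ℂ) • v - l (hA.flow q v t - (t:ℂ) • v) • e
        + (t:ℂ) • v + l (hA.flow q v t - (t:ℂ) • v) • e := by abel
    _ = _ := h5
    _ = _ := by abel

lemma TameField.norm_E_sub_E_le (hA : TameField A e K) (q q' v v' : V) :
    ‖hA.E q v - hA.E q' v'‖ ≤
      (‖q - q'‖ + (1 + K ^ 2) * ‖v' - v‖) * Real.exp (K ^ 2 * ‖v‖ + 1) := by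
  have := hA.approx (u := fun _ => v) (U := ‖v‖) (ε := (1 + K ^ 2) * ‖v' - v‖) (by positivity)
    (fun _ _ => le_rfl)
    (hA.hasDerivWithinAt_flow q v) (hA.hasDerivWithinAt_flow q' v') ?_ 1 (by simp)
  · rw [hA.flow_zero, hA.flow_zero] at this
    exact this
  · intro t _
    have hZ : ∀ Z, hatLift A e Z v' - hatLift A e Z v = hatLift A e Z (v' - v) := fun Z => by
      rw [sub_eq_iff_eq_add', ← hatLift_add, add_sub_cancel]
    rw [hZ]
    exact hA.norm_hatLift_le _ _

lemma TameField.continuous_E (hA : TameField A e K) : Continuous fun x : V × V => hA.E x.1 x.2 := by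
  rw [continuous_iff_continuousAt]
  rintro ⟨q, v⟩
  refine tendsto_iff_norm_sub_tendsto_zero.2 ?_
  have h : Filter.Tendsto (fun x : V × V => (‖q - x.1‖ + (1 + K ^ 2) * ‖x.2 - v‖) *
      Real.exp (K ^ 2 * ‖v‖ + 1)) (nhds (q, v)) (nhds 0) := by
    have : Continuous (fun x : V × V => (‖q - x.1‖ + (1 + K ^ 2) * ‖x.2 - v‖) *
      Real.exp (K ^ 2 * ‖v‖ + 1)) := by fun_prop
    simpa using this.tendsto (q, v)
  refine squeeze_zero (fun _ => norm_nonneg _) (fun x => ?_) h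
  rw [norm_sub_rev]
  exact hA.norm_E_sub_E_le q x.1 v x.2

/-- Under the Frobenius integrability condition along an integral curve, the time-one map is
complex differentiable with derivative the lifting map. -/
lemma TameField.hasFDerivAt_E (hA : TameField A e K) (q v : V)
    (hfrob : ∀ t ∈ Icc (0:ℝ) 1, ∀ w,
      fderiv ℝ A (hA.flow q v t) (hatLift A e (hA.flow q v t) v) w =
      fderiv ℝ A (hA.flow q v t) (hatLift A e (hA.flow q v t) w) v) :
    HasFDerivAt (hA.E q)
      (ContinuousLinearMap.id ℂ V + (A (hA.E q v)).smulRight e) v := by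
  set G := 1 + K ^ 2 with hG
  have hK := hA.nonneg
  have hG0 : 0 ≤ G := by positivity
  set B := K * (K * G ^ 2 * ‖v‖ + K * G) with hB
  have hB0 : 0 ≤ B := by positivity
  have key : ∀ w : V, ‖w‖ ≤ 1 → ‖hA.E q (v + w) - hA.E q v - hatLift A e (hA.E q v) w‖ ≤
      B * Real.exp (K ^ 2 * (‖v‖ + 1) + 1) * ‖w‖ ^ 2 := by
    intro w hw
    let X := hA.flow q v
    let A' : ℝ → V →L[ℂ] ℂ := fun t => fderiv ℝ A (X t) (hatLift A e (X t) v)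
    have hX := hA.hasDerivWithinAt_flow q v
    have hhat : ∀ t ∈ Icc (0:ℝ) 1, HasDerivWithinAt (fun t => hatLift A e (X t) w)
        ((A' t w) • e) (Icc 0 1) t := by
      intro t ht
      have h1 : HasDerivWithinAt (fun t => A (X t)) (A' t) (Icc 0 1) t :=
        (hA.diff (X t)).hasFDerivAt.comp_hasDerivWithinAt t (hX t ht)
      let ev : (V →L[ℂ] ℂ) →L[ℝ] ℂ := (ContinuousLinearMap.apply ℂ ℂ w).restrictScalars ℝ
      have h2 : HasDerivWithinAt (fun t => A (X t) w) (A' t w) (Icc 0 1) t :=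
        ev.hasFDerivAt.comp_hasDerivWithinAt t h1
      exact (h2.smul_const e).const_add w
    have hY : ∀ t ∈ Icc (0:ℝ) 1, HasDerivWithinAt (fun t => X t + (t:ℂ) • hatLift A e (X t) w)
        (hatLift A e (X t) v + ((t:ℂ) • ((A' t w) • e) + (1:ℂ) • hatLift A e (X t) w))
        (Icc 0 1) t := by
      intro t ht
      exact (hX t ht).add ((Complex.ofRealCLM.hasDerivAt (x := t)).hasDerivWithinAt.smul (hhat t ht))
    have hest : ∀ t ∈ Icc (0:ℝ) 1,
        ‖hatLift A e (X t) v + ((t:ℂ) • ((A' t w) • e) + (1:ℂ) • hatLift A e (X t) w) -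
          hatLift A e (X t + (t:ℂ) • hatLift A e (X t) w) (v + w)‖ ≤ B * ‖w‖ ^ 2 := by
      intro t ht
      set Z := X t with hZ
      set h := (t:ℂ) • hatLift A e Z w with hh
      have hnorm : ‖h‖ ≤ G * ‖w‖ := by
        rw [hh, norm_smul, Complex.norm_real, Real.norm_of_nonneg ht.1]
        exact (mul_le_of_le_one_left (norm_nonneg _) ht.2).trans (hA.norm_hatLift_le _ _)
      have hlin : fderiv ℝ A Z h v = (t:ℂ) * A' t w := by
        have e1 : h = t • hatLift A e Z w := by rw [hh, Complex.coe_smul]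
        rw [e1, map_smul]
        have := hfrob t ht w
        have e2 : A' t w = fderiv ℝ A Z (hatLift A e Z w) v := this
        rw [e2, ← Complex.real_smul]
        rfl
      have hid : hatLift A e Z v + ((t:ℂ) • ((A' t w) • e) + (1:ℂ) • hatLift A e Z w) -
          hatLift A e (Z + h) (v + w) =
          -(((A (Z + h) - A Z - fderiv ℝ A Z h) v + (A (Z + h) - A Z) w) • e) := by
        have e2 : (A (Z + h) - A Z - fderiv ℝ A Z h) v + (A (Z + h) - A Z) w =
            A (Z + h) v - A Z v - (t:ℂ) * A' t w + (A (Z + h) w - A Z w) := by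
          rw [sub_apply, sub_apply,
            sub_apply, hlin]
        rw [e2]
        simp only [hatLift, map_add, smul_smul]
        module
      rw [hid, norm_neg, norm_smul]
      have b1 : ‖(A (Z + h) - A Z - fderiv ℝ A Z h) v‖ ≤ K * (G * ‖w‖) ^ 2 * ‖v‖ := by
        refine ContinuousLinearMap.le_of_opNorm_le _ ?_ v
        have := hA.taylor Z (Z + h)
        rw [add_sub_cancel_left] at this
        refine this.trans ?_
        gcongr
      have b2 : ‖(A (Z + h) - A Z) w‖ ≤ K * (G * ‖w‖) * ‖w‖ := by
        refine ContinuousLinearMap.le_of_opNorm_le _ ?_ w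
        have := hA.lip Z (Z + h)
        rw [add_sub_cancel_left] at this
        refine this.trans ?_
        gcongr
      calc _ ≤ (K * (G * ‖w‖) ^ 2 * ‖v‖ + K * (G * ‖w‖) * ‖w‖) * K := by
            refine mul_le_mul ((norm_add_le _ _).trans (add_le_add b1 b2)) hA.norm_e
              (norm_nonneg _) (by positivity)
        _ = B * ‖w‖ ^ 2 := by rw [hB]; ring
    have hfin := hA.approx (u := fun _ => v + w) (U := ‖v‖ + 1) (ε := B * ‖w‖ ^ 2)
      (by positivity) (fun _ _ => (norm_add_le _ _).trans (by linarith))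
      (hA.hasDerivWithinAt_flow q (v + w)) hY hest 1 (by simp)
    simp only [hA.flow_zero, X, Complex.ofReal_zero, zero_smul, add_zero, sub_self, norm_zero,
      zero_add, Complex.ofReal_one, one_smul] at hfin
    have : hA.E q (v + w) - hA.E q v - hatLift A e (hA.E q v) w =
      hA.flow q (v + w) 1 - (hA.flow q v 1 + hatLift A e (hA.flow q v 1) w) := by
      simp only [TameField.E]; abel
    rw [this]
    refine hfin.trans (le_of_eq ?_)
    ring
  rw [hasFDerivAt_iff_isLittleO_nhds_zero]
  have hO : (fun w => hA.E q (v + w) - hA.E q v -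
      (ContinuousLinearMap.id ℂ V + (A (hA.E q v)).smulRight e) w) =O[nhds 0]
      fun w => ‖w‖ ^ 2 := by
    refine Asymptotics.IsBigO.of_bound (B * Real.exp (K ^ 2 * (‖v‖ + 1) + 1)) ?_
    filter_upwards [Metric.closedBall_mem_nhds (0:V) one_pos] with w hw
    have := key w (by simpa using hw)
    simpa [hatLift] using this
  exact hO.trans_isLittleO (Asymptotics.isLittleO_norm_pow_id one_lt_two)

end Flow

section Holomorphic

variable {V : Type*} [NormedAddCommGroup V] [NormedSpace ℂ V]

lemma norm_fderiv_le_of_norm_le {f : V → ℂ} {z : V} {r B : ℝ} (hr : 0 < r)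
    (hf : DifferentiableOn ℂ f (Metric.ball z r)) (hB : ∀ w ∈ Metric.ball z r, ‖f w‖ ≤ B) :
    ‖fderiv ℂ f z‖ ≤ 2 * B / r := by
  have hB0 : 0 ≤ B := (norm_nonneg _).trans (hB z (Metric.mem_ball_self hr))
  refine ContinuousLinearMap.opNorm_le_bound _ (by positivity) fun w => ?_
  rcases eq_or_ne w 0 with rfl | hw
  · simp
  have hw' : 0 < ‖w‖ := norm_pos_iff.2 hw
  have hmem : ∀ s : ℂ, ‖s‖ ≤ r / (2 * ‖w‖) → z + s • w ∈ Metric.ball z r := by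
    intro s hs
    rw [mem_ball_iff_norm, add_sub_cancel_left, norm_smul]
    calc ‖s‖ * ‖w‖ ≤ r / (2 * ‖w‖) * ‖w‖ := by gcongr
      _ = r / 2 := by field_simp
      _ < r := by linarith
  have hd : ∀ s : ℂ, ‖s‖ ≤ r / (2 * ‖w‖) →
      HasDerivAt (fun s : ℂ => f (z + s • w)) (fderiv ℂ f (z + s • w) w) s := by
    intro s hs
    have h1 := (hf.differentiableAt (Metric.isOpen_ball.mem_nhds (hmem s hs))).hasFDerivAt
    have h2 : HasDerivAt (fun s : ℂ => z + s • w) w s := by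
      simpa using ((hasDerivAt_id s).smul_const w).const_add z
    exact h1.comp_hasDerivAt s h2
  have hcl : DiffContOnCl ℂ (fun s : ℂ => f (z + s • w)) (Metric.ball 0 (r / (2 * ‖w‖))) := by
    refine DifferentiableOn.diffContOnCl fun s hs => ?_
    have hs' := Metric.closure_ball_subset_closedBall hs
    exact (hd s (by simpa using hs')).differentiableAt.differentiableWithinAt
  have key := Complex.norm_deriv_le_of_forall_mem_sphere_norm_le (by positivity) hcl (C := B)
    fun s hs => hB _ (hmem s (by simpa using (mem_sphere_iff_norm.1 hs).le))
  have h0 := (hd 0 (by simpa using by positivity)).deriv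
  rw [h0, zero_smul, add_zero] at key
  refine key.trans (le_of_eq ?_)
  field_simp

lemma DifferentiableOn.continuousAt_fderiv_complex {f : V → ℂ} {U : Set V} (hU : IsOpen U)
    (hf : DifferentiableOn ℂ f U) {z : V} (hz : z ∈ U) : ContinuousAt (fderiv ℂ f) z := by
  have hc := hf.continuousOn.continuousAt (hU.mem_nhds hz)
  have hb : ∀ᶠ w in nhds z, w ∈ U ∧ ‖f w‖ ≤ ‖f z‖ + 1 :=
    Filter.Eventually.and (hU.mem_nhds hz) (hc.norm.eventually_le_const (by linarith))
  obtain ⟨R, hR, hball⟩ := Metric.eventually_nhds_iff_ball.1 hb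
  set r := R / 4 with hr
  have hr0 : 0 < r := by positivity
  set B := ‖f z‖ + 1 with hBdef
  have hB : 0 ≤ B := by positivity
  have hfd : ∀ w ∈ Metric.ball z (3 * r), ‖fderiv ℂ f w‖ ≤ 2 * B / r := by
    intro w hw
    have hsub : Metric.ball w r ⊆ Metric.ball z R :=
      Metric.ball_subset_ball' (by have := Metric.mem_ball.1 hw; linarith)
    exact norm_fderiv_le_of_norm_le hr0 (hf.mono fun x hx => (hball x (hsub hx)).1)
      fun x hx => (hball x (hsub hx)).2
  have hlip : ∀ x ∈ Metric.ball z (3 * r), ∀ y ∈ Metric.ball z (3 * r),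
      ‖f y - f x‖ ≤ 2 * B / r * ‖y - x‖ := fun x hx y hy =>
    (convex_ball z (3 * r)).norm_image_sub_le_of_norm_fderiv_le
      (fun w hw => hf.differentiableAt (hU.mem_nhds
        (hball w (Metric.ball_subset_ball (by linarith) hw)).1)) hfd hx hy
  have hmain : ∀ w ∈ Metric.ball z r,
      ‖fderiv ℂ f w - fderiv ℂ f z‖ ≤ 2 * (2 * B / r * ‖w - z‖) / r := by
    intro w hw
    have hm1 : ∀ x ∈ Metric.ball z r, x + (w - z) ∈ Metric.ball z (3 * r) := by
      intro x hx
      rw [mem_ball_iff_norm] at *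
      calc ‖x + (w - z) - z‖ = ‖(x - z) + (w - z)‖ := by congr 1; abel
        _ ≤ _ := norm_add_le _ _
        _ < _ := by linarith
    have hm2 : ∀ x ∈ Metric.ball z r, x ∈ Metric.ball z (3 * r) := fun x hx =>
      Metric.ball_subset_ball (by linarith) hx
    have hda : ∀ x ∈ Metric.ball z (3 * r), DifferentiableAt ℂ f x := fun x hx =>
      hf.differentiableAt (hU.mem_nhds (hball x (Metric.ball_subset_ball (by linarith) hx)).1)
    have h1 : ∀ x ∈ Metric.ball z r, HasFDerivAt (fun x => f (x + (w - z)) - f x)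
        (fderiv ℂ f (x + (w - z)) - fderiv ℂ f x) x := by
      intro x hx
      exact ((hasFDerivAt_comp_add_right (w - z)).2 (hda _ (hm1 x hx)).hasFDerivAt).sub
        (hda _ (hm2 x hx)).hasFDerivAt
    have h2 := norm_fderiv_le_of_norm_le hr0
      (fun x hx => (h1 x hx).differentiableAt.differentiableWithinAt)
      (B := 2 * B / r * ‖w - z‖) fun x hx => by
        have := hlip x (hm2 x hx) _ (hm1 x hx)
        rwa [add_sub_cancel_left] at this
    rw [(h1 z (Metric.mem_ball_self hr0)).fderiv, add_sub_cancel] at h2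
    exact h2
  rw [ContinuousAt, tendsto_iff_norm_sub_tendsto_zero]
  have hlim : Filter.Tendsto (fun w => 2 * (2 * B / r * ‖w - z‖) / r) (nhds z) (nhds 0) := by
    have : Continuous (fun w => 2 * (2 * B / r * ‖w - z‖) / r) := by fun_prop
    simpa using this.tendsto z
  refine squeeze_zero' (Filter.Eventually.of_forall fun _ => norm_nonneg _) ?_ hlim
  filter_upwards [Metric.ball_mem_nhds z hr0] with w hw using hmain w hw

lemma DifferentiableOn.hasStrictFDerivAt_complex {f : V → ℂ} {U : Set V} (hU : IsOpen U)
    (hf : DifferentiableOn ℂ f U) {z : V} (hz : z ∈ U) :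
    HasStrictFDerivAt f (fderiv ℂ f z) z := by
  refine hasStrictFDerivAt_of_hasFDerivAt_of_continuousAt ?_
    (hf.continuousAt_fderiv_complex hU hz)
  filter_upwards [hU.mem_nhds hz] with w hw
  exact (hf.differentiableAt (hU.mem_nhds hw)).hasFDerivAt

end Holomorphic

/-- Near `p`, the set `M` is a level set of `ρ`, and the tame field `A` parametrizes the complex
tangent spaces of `ρ` as graphs over `ker l` in the direction `e`. -/
structure LeviField {V : Type*} [NormedAddCommGroup V] [NormedSpace ℂ V]
    (M : Set V) (p e : V) (l : V →L[ℂ] ℂ) (ρ : V → ℝ) (A : V → V →L[ℂ] ℂ) (K R : ℝ) : Prop where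
  tame : TameField A e K
  l_e : l e = 1
  R_pos : 0 < R
  strict : ∀ z ∈ Metric.ball p R, HasStrictFDerivAt ρ (fderiv ℝ ρ z) z
  fderiv_ne : ∀ z ∈ Metric.ball p R, fderiv ℝ ρ z ≠ 0
  mem_iff : ∀ z ∈ Metric.ball p R, z ∈ M ↔ ρ z = 0
  fderiv_hat : ∀ z ∈ Metric.ball p R, ∀ v, fderiv ℝ ρ z (hatLift A e z v) = 0
  eq_hat : ∀ z ∈ Metric.ball p R, ∀ w, fderiv ℝ ρ z w = 0 → fderiv ℝ ρ z (I • w) = 0 →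
    hatLift A e z w = w
  A_e : ∀ z ∈ Metric.ball p R, A z e = -1
  integrable : ∀ z ∈ Metric.ball p R, z ∈ M → ∀ v w,
    fderiv ℝ A z (hatLift A e z v) w = fderiv ℝ A z (hatLift A e z w) v

section Tame

variable {V : Type*} [NormedAddCommGroup V] [NormedSpace ℂ V]

lemma tameField_of_bounds {A : V → V →L[ℂ] ℂ} {e : V} {C₁ C₂ C₃ : ℝ} (hC1 : 0 ≤ C₁)
    (hC2 : 0 ≤ C₂) (hC3 : 0 ≤ C₃) (hA : Differentiable ℝ A) (h1 : ∀ z, ‖A z‖ ≤ C₁)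
    (h2 : ∀ z z', ‖A z' - A z‖ ≤ C₂ * ‖z' - z‖)
    (h3 : ∀ z z', ‖fderiv ℝ A z' - fderiv ℝ A z‖ ≤ C₃ * ‖z' - z‖) :
    TameField A e (‖e‖ + C₁ + C₂ + C₃) := by
  have he := norm_nonneg e
  refine ⟨by positivity, by linarith, fun z => (h1 z).trans (by linarith), fun z z' => ?_, hA, ?_⟩
  · exact (h2 z z').trans (mul_le_mul_of_nonneg_right (by linarith) (norm_nonneg _))
  · intro z z'
    have h5 := (convex_segment z z').norm_image_sub_le_of_norm_hasFDerivWithin_le' (𝕜 := ℝ)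
      (f := A) (f' := fun x => fderiv ℝ A x) (φ := fderiv ℝ A z) (C := C₃ * ‖z' - z‖)
      (fun x _ => (hA x).hasFDerivAt.hasFDerivWithinAt)
      (fun x hx => by
        refine (h3 z x).trans (mul_le_mul_of_nonneg_left ?_ hC3)
        rw [segment_eq_image_lineMap] at hx
        obtain ⟨t, ht, rfl⟩ := hx
        rw [AffineMap.lineMap_apply, vsub_eq_sub, vadd_eq_add, add_sub_cancel_right, norm_smul,
          Real.norm_of_nonneg ht.1]
        exact mul_le_of_le_one_left (norm_nonneg _) ht.2)
      (left_mem_segment ℝ z z') (right_mem_segment ℝ z z')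
    refine h5.trans ?_
    rw [pow_two, ← mul_assoc]
    exact mul_le_mul_of_nonneg_right
      (mul_le_mul_of_nonneg_right (by linarith) (norm_nonneg _)) (norm_nonneg _)

lemma exists_lipschitz_fderiv {E F : Type*} [NormedAddCommGroup E] [NormedSpace ℝ E]
    [NormedAddCommGroup F] [NormedSpace ℝ F] {f : E → F} (hf : ContDiff ℝ 2 f)
    (hs : HasCompactSupport f) :
    ∃ C, 0 ≤ C ∧ ∀ z z', ‖fderiv ℝ f z' - fderiv ℝ f z‖ ≤ C * ‖z' - z‖ := by
  have hf' : ContDiff ℝ 1 (fderiv ℝ f) := hf.fderiv_right (by norm_num)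
  obtain ⟨C, h⟩ := hf'.lipschitzWith_of_hasCompactSupport (hs.fderiv ℝ) (by simp)
  exact ⟨C, C.2, fun z z' => h.norm_sub_le z' z⟩

lemma exists_tameField {A : V → V →L[ℂ] ℂ} (hA : ContDiff ℝ 2 A) (hs : HasCompactSupport A)
    (e : V) : ∃ K, TameField A e K := by
  obtain ⟨C₁, h1⟩ := hs.exists_bound_of_continuous hA.continuous
  obtain ⟨C₂, h2⟩ := hA.lipschitzWith_of_hasCompactSupport hs (by simp)
  obtain ⟨C₃, hC₃, h3⟩ := exists_lipschitz_fderiv hA hs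
  exact ⟨_, tameField_of_bounds ((norm_nonneg _).trans (h1 0)) C₂.2 hC₃
    (hA.differentiable (by simp)) h1 (fun z z' => h2.norm_sub_le z' z) h3⟩

end Tame

/-- The complex linear form with real part `dρ`. -/
def complexForm {V : Type*} [NormedAddCommGroup V] [NormedSpace ℂ V] (ρ : V → ℝ) (z : V) :
    V →L[ℂ] ℂ := StrongDual.extendRCLikeₗᵢ (𝕜 := ℂ) (fderiv ℝ ρ z)

lemma complexForm_apply {V : Type*} [NormedAddCommGroup V] [NormedSpace ℂ V] (ρ : V → ℝ) (z w : V) :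
    complexForm ρ z w = fderiv ℝ ρ z w - I * fderiv ℝ ρ z (I • w) := rfl

lemma complexForm_apply_eq_zero_iff {V : Type*} [NormedAddCommGroup V] [NormedSpace ℂ V]
    {ρ : V → ℝ} {z w : V} :
    complexForm ρ z w = 0 ↔ fderiv ℝ ρ z w = 0 ∧ fderiv ℝ ρ z (I • w) = 0 := by
  rw [complexForm_apply, Complex.ext_iff]
  simp

lemma hasFDerivAt_complexForm {V : Type*} [NormedAddCommGroup V] [NormedSpace ℂ V] {ρ : V → ℝ}
    {z : V} (h : DifferentiableAt ℝ (fderiv ℝ ρ) z) :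
    ∃ D : V →L[ℝ] (V →L[ℂ] ℂ), HasFDerivAt (complexForm ρ) D z ∧ ∀ u w,
      D u w = fderiv ℝ (fderiv ℝ ρ) z u w - I * fderiv ℝ (fderiv ℝ ρ) z u (I • w) := by
  let ext : (V →L[ℝ] ℝ) →L[ℝ] (V →L[ℂ] ℂ) :=
    (StrongDual.extendRCLikeₗᵢ (𝕜 := ℂ) (F := V)).toContinuousLinearEquiv.toContinuousLinearMap
  exact ⟨ext.comp (fderiv ℝ (fderiv ℝ ρ) z), ext.hasFDerivAt.comp z h.hasFDerivAt,
    fun u w => rfl⟩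

/-- Levi-flatness makes the derivative of the complex form symmetric on complex tangent vectors. -/
lemma symm_of_leviForm {m : ℕ} {ρ : (Fin m → ℂ) → ℝ} {z : Fin m → ℂ}
    (hρ : ContDiffAt ℝ 2 ρ z)
    (hl : ∀ w, IsComplexTangent ρ z w → leviForm ρ z w = 0) {u w : Fin m → ℂ}
    (hu : IsComplexTangent ρ z u) (hw : IsComplexTangent ρ z w) :
    fderiv ℝ (fderiv ℝ ρ) z u (I • w) = fderiv ℝ (fderiv ℝ ρ) z w (I • u) := by
  have hs : ∀ x y, fderiv ℝ (fderiv ℝ ρ) z x y = fderiv ℝ (fderiv ℝ ρ) z y x := fun x y =>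
    (hρ.isSymmSndFDerivAt (by simp)).eq x y
  set D := fderiv ℝ (fderiv ℝ ρ) z with hD
  have hB : ∀ x, IsComplexTangent ρ z x → D x x + D (I • x) (I • x) = 0 := by
    intro x hx
    have := hl x hx
    simpa [leviForm, iteratedFDeriv_two_apply] using this
  have hI : ∀ x : Fin m → ℂ, I • I • x = -x := fun x => by
    rw [smul_smul, I_mul_I, neg_one_smul]
  have hw' : IsComplexTangent ρ z (I • w) := ⟨hw.2, by rw [hI, map_neg, hw.1, neg_zero]⟩
  have hsum : IsComplexTangent ρ z (u + I • w) :=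
    ⟨by rw [map_add, hu.1, hw'.1, add_zero], by rw [smul_add, map_add, hu.2, hw'.2, add_zero]⟩
  have h1 := hB _ hsum
  have h2 := hB _ hu
  have h3 := hB _ hw'
  simp only [smul_add, map_add, add_apply, hI, map_neg, neg_apply, neg_neg] at h1 h3
  have e1 := hs (I • w) u
  have e2 := hs (I • u) w
  linarith

lemma contDiffAt_complexForm {V : Type*} [NormedAddCommGroup V] [NormedSpace ℂ V] {ρ : V → ℝ}
    {z : V} (h : ContDiffAt ℝ 3 ρ z) : ContDiffAt ℝ 2 (complexForm ρ) z := by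
  let ext : (V →L[ℝ] ℝ) →L[ℝ] (V →L[ℂ] ℂ) :=
    (StrongDual.extendRCLikeₗᵢ (𝕜 := ℂ) (F := V)).toContinuousLinearEquiv.toContinuousLinearMap
  have h1 : ContDiffAt ℝ 2 (fderiv ℝ ρ) z := h.fderiv_right (by norm_num)
  exact ext.contDiff.contDiffAt.comp z h1

/-- The evaluation of the derivative of a field of forms. -/
lemma hasFDerivAt_form_apply {V : Type*} [NormedAddCommGroup V] [NormedSpace ℂ V]
    {A : V → V →L[ℂ] ℂ} {D : V →L[ℝ] (V →L[ℂ] ℂ)} {z : V} (h : HasFDerivAt A D z) (w : V) :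
    ∃ D' : V →L[ℝ] ℂ, HasFDerivAt (fun z => A z w) D' z ∧ ∀ u, D' u = D u w := by
  let ev : (V →L[ℂ] ℂ) →L[ℝ] ℂ := (ContinuousLinearMap.apply ℂ ℂ w).restrictScalars ℝ
  exact ⟨ev.comp D, ev.hasFDerivAt.comp z h, fun u => rfl⟩

lemma fderiv_symm_of_relation {V : Type*} [NormedAddCommGroup V] [NormedSpace ℂ V]
    {A α : V → V →L[ℂ] ℂ} {e z : V} {D : V →L[ℝ] (V →L[ℂ] ℂ)}
    (hA : DifferentiableAt ℝ A z) (hα : HasFDerivAt α D z)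
    (hrel : ∀ᶠ x in nhds z, ∀ w, A x w * α x e + α x w = 0) (he : ∀ᶠ x in nhds z, A x e = -1)
    (hne : α z e ≠ 0)
    (hsymm : ∀ v w, D (hatLift A e z v) (hatLift A e z w) = D (hatLift A e z w) (hatLift A e z v))
    (v w : V) : fderiv ℝ A z (hatLift A e z v) w = fderiv ℝ A z (hatLift A e z w) v := by
  have hDe : ∀ u, fderiv ℝ A z u e = 0 := by
    intro u
    obtain ⟨D', h1, h2⟩ := hasFDerivAt_form_apply hA.hasFDerivAt e
    have h3 : HasFDerivAt (fun x => A x e) (0 : V →L[ℝ] ℂ) z :=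
      (hasFDerivAt_const (-1 : ℂ) z).congr_of_eventuallyEq he
    rw [← h2, h1.unique h3]
    rfl
  have hmul : ∀ u w, fderiv ℝ A z u w * α z e + A z w * D u e + D u w = 0 := by
    intro u w
    obtain ⟨D1, h1, h1'⟩ := hasFDerivAt_form_apply hA.hasFDerivAt w
    obtain ⟨D2, h2, h2'⟩ := hasFDerivAt_form_apply hα e
    obtain ⟨D3, h3, h3'⟩ := hasFDerivAt_form_apply hα w
    have h4 := (h1.mul h2).add h3
    have h5 : HasFDerivAt (fun x => A x w * α x e + α x w) (0 : V →L[ℝ] ℂ) z :=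
      (hasFDerivAt_const (0 : ℂ) z).congr_of_eventuallyEq (hrel.mono fun x hx => hx w)
    have h6 := congrArg (fun L : V →L[ℝ] ℂ => L u) (h4.unique h5)
    simp only [add_apply, smul_apply, h1', h2', h3', smul_eq_mul, zero_apply] at h6
    linear_combination h6
  have hAhat : ∀ x, A z (hatLift A e z x) = 0 := by
    intro x
    simp [hatLift, he.self_of_nhds]
  have hhat : ∀ u x, fderiv ℝ A z u x = fderiv ℝ A z u (hatLift A e z x) := by
    intro u x
    simp [hatLift, hDe]
  have h7 := hmul (hatLift A e z v) (hatLift A e z w)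
  have h8 := hmul (hatLift A e z w) (hatLift A e z v)
  rw [hAhat] at h7 h8
  rw [hhat _ w, hhat _ v]
  refine mul_right_cancel₀ hne ?_
  linear_combination h7 - h8 - hsymm v w

lemma exists_leviField {m : ℕ} {M : Set (Fin m → ℂ)} (hM : IsSmoothLeviFlatHypersurface M)
    {p : Fin m → ℂ} (hp : p ∈ M) :
    ∃ (e : Fin m → ℂ) (l : (Fin m → ℂ) →L[ℂ] ℂ) (ρ : (Fin m → ℂ) → ℝ)
      (A : (Fin m → ℂ) → (Fin m → ℂ) →L[ℂ] ℂ) (K R : ℝ), LeviField M p e l ρ A K R := by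
  obtain ⟨N, hN, hpN, ρ, hsm, hne, hmem, hlev⟩ := hM p hp
  have hC : ∀ z ∈ N, ContDiffAt ℝ 3 ρ z := fun z hz => (hsm 3).contDiffAt (hN.mem_nhds hz)
  have hα : ∀ z ∈ N, ContDiffAt ℝ 2 (complexForm ρ) z := fun z hz =>
    contDiffAt_complexForm (hC z hz)
  obtain ⟨w, hw⟩ : ∃ w, complexForm ρ p w ≠ 0 := by
    by_contra! h
    exact hne p hpN (ContinuousLinearMap.ext fun w => (complexForm_apply_eq_zero_iff.1 (h w)).1)
  set e : Fin m → ℂ := (complexForm ρ p w)⁻¹ • w with he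
  have hpe : complexForm ρ p e = 1 := by
    rw [he, map_smul, smul_eq_mul, inv_mul_cancel₀ hw]
  have hge : ∀ z ∈ N, ContDiffAt ℝ 2 (fun z => complexForm ρ z e) z := fun z hz =>
    ((ContinuousLinearMap.apply ℂ ℂ e).restrictScalars ℝ).contDiff.contDiffAt.comp z (hα z hz)
  have hev : ∀ᶠ z in nhds p, z ∈ N ∧ complexForm ρ z e ≠ 0 :=
    Filter.Eventually.and (hN.mem_nhds hpN)
      ((hge p hpN).continuousAt.eventually_ne (by rw [hpe]; exact one_ne_zero))
  obtain ⟨R, hR, hball⟩ := Metric.eventually_nhds_iff_ball.1 hev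
  let χ : ContDiffBump p := ⟨R / 3, R / 2, by positivity, by linarith⟩
  let A : (Fin m → ℂ) → (Fin m → ℂ) →L[ℂ] ℂ := fun z =>
    (-((χ z : ℂ) * (complexForm ρ z e)⁻¹)) • complexForm ρ z
  have hAout : ∀ z, z ∉ Metric.closedBall p (R / 2) → A z = 0 := by
    intro z hz
    have : χ z = 0 := χ.zero_of_le_dist (by
      rw [Metric.mem_closedBall, not_le] at hz; exact hz.le)
    exact ContinuousLinearMap.ext fun w => by simp [A, this]
  have hAc : ContDiff ℝ 2 A := by
    refine contDiff_iff_contDiffAt.2 fun z => ?_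
    by_cases hz : z ∈ Metric.closedBall p (R / 2)
    · have h1 := hball z (Metric.closedBall_subset_ball (by linarith) hz)
      have h2 : ContDiffAt ℝ 2 (fun z => (χ z : ℂ)) z :=
        Complex.ofRealCLM.contDiff.contDiffAt.comp z χ.contDiffAt
      exact ((h2.mul ((hge z h1.1).inv h1.2)).neg).smul (hα z h1.1)
    · refine contDiffAt_const (c := 0).congr_of_eventuallyEq ?_
      filter_upwards [Metric.isClosed_closedBall.isOpen_compl.mem_nhds hz] with x hx
      exact hAout x hx
  have hAs : HasCompactSupport A :=
    HasCompactSupport.intro (isCompact_closedBall p (R / 2)) fun x hx => hAout x hx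
  obtain ⟨K, hK⟩ := exists_tameField hAc hAs e
  have hsub : Metric.ball p (R / 3) ⊆ Metric.ball p R := Metric.ball_subset_ball (by linarith)
  have hAin : ∀ z ∈ Metric.ball p (R / 3), ∀ w,
      A z w = -((complexForm ρ z e)⁻¹ * complexForm ρ z w) := by
    intro z hz w
    have : χ z = 1 := χ.one_of_mem_closedBall (Metric.ball_subset_closedBall hz)
    simp [A, this]
  have hAe : ∀ z ∈ Metric.ball p (R / 3), A z e = -1 := fun z hz => by
    rw [hAin z hz, inv_mul_cancel₀ (hball z (hsub hz)).2]
  have hrel : ∀ z ∈ Metric.ball p (R / 3), ∀ w,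
      A z w * complexForm ρ z e + complexForm ρ z w = 0 := fun z hz w => by
    rw [hAin z hz]
    field_simp [(hball z (hsub hz)).2]
    ring
  have hhat : ∀ z ∈ Metric.ball p (R / 3), ∀ w, complexForm ρ z (hatLift A e z w) = 0 := by
    intro z hz w
    rw [hatLift, map_add, map_smul, smul_eq_mul, add_comm]
    exact hrel z hz w
  refine ⟨e, complexForm ρ p, ρ, A, K, R / 3, hK, hpe, by positivity, fun z hz => ?_,
    fun z hz => hne z (hball z (hsub hz)).1, fun z hz => hmem z (hball z (hsub hz)).1,
    fun z hz v => (complexForm_apply_eq_zero_iff.1 (hhat z hz v)).1, fun z hz w h1 h2 => ?_, hAe,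
    fun z hz hzM v w => ?_⟩
  · exact (hC z (hball z (hsub hz)).1).hasStrictFDerivAt (by simp)
  · rw [hatLift, hAin z hz, complexForm_apply_eq_zero_iff.2 ⟨h1, h2⟩]
    simp
  · have hzN := (hball z (hsub hz)).1
    have h2 : ContDiffAt ℝ 2 (fderiv ℝ ρ) z := (hC z hzN).fderiv_right (by norm_num)
    obtain ⟨D, hD, hD'⟩ := hasFDerivAt_complexForm (ρ := ρ) (h2.differentiableAt (by simp))
    have hnb := Metric.isOpen_ball.mem_nhds hz
    refine fderiv_symm_of_relation (hK.diff z) hD (Filter.mem_of_superset hnb hrel)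
      (Filter.mem_of_superset hnb hAe) (hball z (hsub hz)).2 (fun x y => ?_) v w
    have hx := complexForm_apply_eq_zero_iff.1 (hhat z hz x)
    have hy := complexForm_apply_eq_zero_iff.1 (hhat z hz y)
    have hρ2 : ContDiffAt ℝ 2 ρ z := (hC z hzN).of_le (by norm_num)
    rw [hD', hD', symm_of_leviForm hρ2 (hlev z hzN ((hmem z hzN).1 hzM)) hx hy,
      (hρ2.isSymmSndFDerivAt (by simp)).eq]

lemma ker_le_of_constant_on_level {V : Type*} [NormedAddCommGroup V] [NormedSpace ℂ V]
    [CompleteSpace V] {f : V → ℂ} {f' : V →L[ℂ] ℂ} {ρ : V → ℝ} {ρ' : V →L[ℝ] ℝ} {z : V}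
    (hf : HasStrictFDerivAt f f' z) (hf' : f' ≠ 0) (hρ : HasStrictFDerivAt ρ ρ' z)
    (h : ∀ᶠ x in nhds z, f x = f z → ρ x = ρ z) {w : V} (hw : f' w = 0) : ρ' w = 0 := by
  have hext : IsLocalExtrOn ρ {x | f x = f z} z := by
    left
    refine eventually_nhdsWithin_iff.2 ?_
    filter_upwards [h] with x hx hxm
    exact (hx hxm).ge
  obtain ⟨Λ, Λ₀, hne, hΛ⟩ := hext.exists_linear_map_of_hasStrictFDerivAt
    (hf.restrictScalars ℝ) hρ
  have h1 := hΛ w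
  rw [ContinuousLinearMap.coe_restrictScalars', hw, map_zero, zero_add, smul_eq_mul] at h1
  refine (mul_eq_zero.1 h1).resolve_left fun h0 => hne ?_
  refine Prod.ext (LinearMap.ext fun c => ?_) h0
  obtain ⟨u, hu⟩ : ∃ u, f' u ≠ 0 := by
    by_contra! hc
    exact hf' (ContinuousLinearMap.ext hc)
  have h2 := hΛ ((c / f' u) • u)
  rw [h0, zero_smul, add_zero, ContinuousLinearMap.coe_restrictScalars', map_smul, smul_eq_mul,
    div_mul_cancel₀ _ hu] at h2
  exact h2

section Box

variable {V : Type*} [NormedAddCommGroup V] [NormedSpace ℂ V]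
  {M : Set V} {p e : V} {l : V →L[ℂ] ℂ} {ρ : V → ℝ} {A : V → V →L[ℂ] ℂ} {K R : ℝ}

/-- The projection to `ker l` along `e`. -/
def projAlong (l : V →L[ℂ] ℂ) (e : V) : V →L[ℂ] V :=
  ContinuousLinearMap.id ℂ V - l.smulRight e

lemma projAlong_apply (l : V →L[ℂ] ℂ) (e z : V) : projAlong l e z = z - l z • e := rfl

lemma LeviField.l_proj (h : LeviField M p e l ρ A K R) (z : V) : l (projAlong l e z) = 0 := by
  simp [projAlong_apply, h.l_e]

lemma LeviField.proj_eq_self {v : V} (hv : l v = 0) : projAlong l e v = v := by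
  simp [projAlong_apply, hv]

lemma LeviField.proj_e (h : LeviField M p e l ρ A K R) : projAlong l e e = 0 := by
  simp [projAlong_apply, h.l_e]

lemma LeviField.hat_proj (h : LeviField M p e l ρ A K R) {z : V} (hz : z ∈ Metric.ball p R)
    (v : V) : hatLift A e z (projAlong l e v) = hatLift A e z v := by
  simp [hatLift, projAlong_apply, h.A_e z hz, add_smul]

variable [CompleteSpace V]

lemma LeviField.flow_mem_ball (h : LeviField M p e l ρ A K R) {z v : V}
    (hzv : ‖z - p‖ + (1 + K ^ 2) * ‖v‖ < R) {t : ℝ} (ht : t ∈ Icc (0:ℝ) 1) :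
    h.tame.flow z v t ∈ Metric.ball p R := by
  rw [mem_ball_iff_norm]
  have := h.tame.norm_flow_sub_le z v ht
  calc ‖h.tame.flow z v t - p‖ = ‖(z - p) + (h.tame.flow z v t - z)‖ := by congr 1; abel
    _ ≤ _ := norm_add_le _ _
    _ < R := by linarith

lemma LeviField.flow_mem (h : LeviField M p e l ρ A K R) {z v : V} (hz : z ∈ M)
    (hzv : ‖z - p‖ + (1 + K ^ 2) * ‖v‖ < R) {t : ℝ} (ht : t ∈ Icc (0:ℝ) 1) :
    h.tame.flow z v t ∈ M := by
  have hball := fun s (hs : s ∈ Icc (0:ℝ) 1) => h.flow_mem_ball hzv hs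
  have hd : ∀ s ∈ Icc (0:ℝ) 1,
      HasDerivWithinAt (fun s => ρ (h.tame.flow z v s)) 0 (Icc 0 1) s := by
    intro s hs
    have h1 := (h.strict _ (hball s hs)).hasFDerivAt.comp_hasDerivWithinAt s
      (h.tame.hasDerivWithinAt_flow z v s hs)
    rw [h.fderiv_hat _ (hball s hs)] at h1
    exact h1
  have hc := (convex_Icc (0:ℝ) 1).norm_image_sub_le_of_norm_hasDerivWithin_le (C := 0) hd
    (by simp) (left_mem_Icc.2 zero_le_one) ht
  have hz0 : ρ z = 0 := by
    have h0 := hball 0 (by simp)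
    rw [h.tame.flow_zero] at h0
    exact (h.mem_iff z h0).1 hz
  rw [h.tame.flow_zero, zero_mul, norm_le_zero_iff, hz0, sub_zero] at hc
  exact (h.mem_iff _ (hball t ht)).2 hc

lemma LeviField.hasFDerivAt_E (h : LeviField M p e l ρ A K R) {z v : V} (hz : z ∈ M)
    (hzv : ‖z - p‖ + (1 + K ^ 2) * ‖v‖ < R) :
    HasFDerivAt (h.tame.E z)
      (ContinuousLinearMap.id ℂ V + (A (h.tame.E z v)).smulRight e) v :=
  h.tame.hasFDerivAt_E z v fun _ ht w =>
    h.integrable _ (h.flow_mem_ball hzv ht) (h.flow_mem hz hzv ht) v w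

lemma LeviField.E_mem (h : LeviField M p e l ρ A K R) {z v : V} (hz : z ∈ M)
    (hzv : ‖z - p‖ + (1 + K ^ 2) * ‖v‖ < R) : h.tame.E z v ∈ M :=
  h.flow_mem hz hzv (by simp)

/-- The height of a point: the coordinate of its transport to the transversal `p + ℂ e`. -/
def LeviField.height (h : LeviField M p e l ρ A K R) (z : V) : ℂ :=
  l (h.tame.E z (-projAlong l e (z - p)) - p)

lemma LeviField.continuous_height (h : LeviField M p e l ρ A K R) : Continuous h.height := by
  have h1 : Continuous fun z : V => h.tame.E z (-projAlong l e (z - p)) :=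
    h.tame.continuous_E.comp (f := fun z : V => (z, -projAlong l e (z - p))) (by fun_prop)
  exact l.continuous.comp (h1.sub continuous_const)

lemma LeviField.E_form (h : LeviField M p e l ρ A K R) {z v : V} (hv : l v = 0) :
    h.tame.E z v = z + v + l (h.tame.E z v - z) • e := by
  have := h.tame.flow_form z v l h.l_e (t := 1) (by simp)
  rw [Complex.ofReal_one, one_smul, map_sub _ _ v, hv, sub_zero] at this
  exact this

lemma LeviField.E_neg_proj (h : LeviField M p e l ρ A K R) (z : V) :
    h.tame.E z (-projAlong l e (z - p)) = p + h.height z • e := by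
  rw [h.E_form (by rw [map_neg, h.l_proj, neg_zero]), LeviField.height]
  have : l (h.tame.E z (-projAlong l e (z - p)) - p) =
      l (h.tame.E z (-projAlong l e (z - p)) - z) + l (z - p) := by
    rw [← map_add]; congr 1; abel
  rw [this, projAlong_apply, add_smul]
  abel

lemma LeviField.eq_E_height (h : LeviField M p e l ρ A K R) (z : V) :
    h.tame.E (p + h.height z • e) (projAlong l e (z - p)) = z := by
  rw [← h.E_neg_proj]
  simpa using h.tame.E_E_neg z (-projAlong l e (z - p))

lemma LeviField.proj_E (h : LeviField M p e l ρ A K R) {v : V} (hv : l v = 0) (τ : ℂ) :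
    projAlong l e (h.tame.E (p + τ • e) v - p) = v := by
  rw [h.E_form hv]
  have : p + τ • e + v + l (h.tame.E (p + τ • e) v - (p + τ • e)) • e - p =
    v + (τ + l (h.tame.E (p + τ • e) v - (p + τ • e))) • e := by rw [add_smul]; abel
  rw [this, map_add, map_smul, h.proj_e, smul_zero, add_zero, LeviField.proj_eq_self hv]

lemma LeviField.height_E (h : LeviField M p e l ρ A K R) {v : V} (hv : l v = 0) (τ : ℂ) :
    h.height (h.tame.E (p + τ • e) v) = τ := by
  rw [LeviField.height, h.proj_E hv, h.tame.E_E_neg]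
  simp [h.l_e]

lemma LeviField.eq_E_iff (h : LeviField M p e l ρ A K R) {z : V} {τ : ℂ} :
    z = h.tame.E (p + τ • e) (projAlong l e (z - p)) ↔ h.height z = τ := by
  constructor
  · intro hz
    rw [hz, h.height_E (h.l_proj _)]
  · rintro rfl
    exact (h.eq_E_height z).symm

/-- A curve tangent to the complex tangent spaces remains on the graph it starts on. -/
lemma LeviField.curve_eq (h : LeviField M p e l ρ A K R) {γ γ' : ℝ → V} {U : ℝ} {a : V}
    (ha : a ∈ M) (hγ : ∀ t ∈ Icc (0:ℝ) 1, HasDerivWithinAt γ (γ' t) (Icc 0 1) t)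
    (hball : ∀ t ∈ Icc (0:ℝ) 1, γ t ∈ Metric.ball p R)
    (hU : ∀ t ∈ Icc (0:ℝ) 1, ‖projAlong l e (γ' t)‖ ≤ U)
    (h1 : ∀ t ∈ Icc (0:ℝ) 1, fderiv ℝ ρ (γ t) (γ' t) = 0)
    (h2 : ∀ t ∈ Icc (0:ℝ) 1, fderiv ℝ ρ (γ t) (I • γ' t) = 0)
    (hb : ∀ t ∈ Icc (0:ℝ) 1, ‖a - p‖ + (1 + K ^ 2) * ‖projAlong l e (γ t - p)‖ < R)
    (h0 : γ 0 = h.tame.E a (projAlong l e (γ 0 - p))) :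
    γ 1 = h.tame.E a (projAlong l e (γ 1 - p)) := by
  have hX : ∀ t ∈ Icc (0:ℝ) 1,
      HasDerivWithinAt γ (hatLift A e (γ t) (projAlong l e (γ' t))) (Icc 0 1) t := by
    intro t ht
    rw [h.hat_proj (hball t ht), h.eq_hat _ (hball t ht) _ (h1 t ht) (h2 t ht)]
    exact hγ t ht
  have hY : ∀ t ∈ Icc (0:ℝ) 1,
      HasDerivWithinAt (fun t => h.tame.E a (projAlong l e (γ t - p)))
        (hatLift A e (h.tame.E a (projAlong l e (γ t - p))) (projAlong l e (γ' t)))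
        (Icc 0 1) t := by
    intro t ht
    have e1 : HasDerivWithinAt (fun t => projAlong l e (γ t - p)) (projAlong l e (γ' t))
        (Icc 0 1) t :=
      ((projAlong l e).restrictScalars ℝ).hasFDerivAt.comp_hasDerivWithinAt t
        ((hγ t ht).sub_const p)
    exact ((h.hasFDerivAt_E ha (hb t ht)).restrictScalars ℝ).comp_hasDerivWithinAt t e1
  have key := h.tame.approx le_rfl hU hX hY (by simp) 1 (by simp)
  rw [← h0, sub_self, norm_zero, zero_add, zero_mul, norm_le_zero_iff, sub_eq_zero] at key
  exact key

end Box

/-- A flow box for the Levi foliation of `M`: the plaques in the open set `W` are the level sets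
of `H` in `M`. -/
structure FlowBox {V : Type*} [NormedAddCommGroup V] [NormedSpace ℂ V]
    (M W : Set V) (H : V → ℂ) : Prop where
  isOpen : IsOpen W
  cont : Continuous H
  plaque : ∀ q ∈ W, q ∈ M → ∃ f : V → ℂ, DifferentiableOn ℂ f W ∧
    (∀ z ∈ W, fderiv ℂ f z ≠ 0) ∧ (∀ z ∈ W, f z = 0 ↔ z ∈ M ∧ H z = H q) ∧
    IsPreconnected {z ∈ W | f z = 0}
  unique : ∀ q ∈ W, ∀ U : Set V, IsOpen U → q ∈ U → ∀ f : V → ℂ, DifferentiableOn ℂ f U →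
    (∀ z ∈ U, fderiv ℂ f z ≠ 0) → {z ∈ U | f z = 0} ⊆ M → f q = 0 →
    ∀ᶠ z in nhds q, f z = 0 → H z = H q
  orbit : (∀ c : ℂ, c ≠ 0 → ∀ z ∈ M, c • z ∈ M) → ∀ q ∈ W, q ∈ M →
    ∀ᶠ c in nhds (1:ℂ), H (c • q) = H q
  trans : ∀ q ∈ W, q ∈ M → ∀ z ∈ W, z ∈ M → H q = H z → ∀ O ∈ nhds q,
    ∀ᶠ z' in nhds z, z' ∈ M → ∃ q' ∈ O, q' ∈ W ∧ q' ∈ M ∧ H q' = H z'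

section Box

variable {V : Type*} [NormedAddCommGroup V] [NormedSpace ℂ V] [CompleteSpace V]
  {M : Set V} {p e : V} {l : V →L[ℂ] ℂ} {ρ : V → ℝ} {A : V → V →L[ℂ] ℂ} {K R : ℝ}

/-- The flow box around the centre of a Levi field. -/
def LeviField.box (h : LeviField M p e l ρ A K R) : Set V :=
  {z | ‖z - p‖ < R / 4 ∧ (1 + K ^ 2) * ‖projAlong l e (z - p)‖ < R / 8 ∧
    ‖h.height z‖ * ‖e‖ < R / 16}

lemma LeviField.isOpen_box (h : LeviField M p e l ρ A K R) : IsOpen h.box := by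
  have h1 : IsOpen {z : V | ‖z - p‖ < R / 4} := isOpen_lt (by fun_prop) continuous_const
  have h2 : IsOpen {z : V | (1 + K ^ 2) * ‖projAlong l e (z - p)‖ < R / 8} :=
    isOpen_lt (by fun_prop) continuous_const
  have h3 : IsOpen {z : V | ‖h.height z‖ * ‖e‖ < R / 16} :=
    isOpen_lt (h.continuous_height.norm.mul continuous_const) continuous_const
  exact h1.inter (h2.inter h3)

lemma LeviField.box_subset (h : LeviField M p e l ρ A K R) : h.box ⊆ Metric.ball p R := by
  intro z hz
  rw [mem_ball_iff_norm]
  linarith [hz.1, h.R_pos]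


lemma LeviField.E_zero (h : LeviField M p e l ρ A K R) (q : V) : h.tame.E q 0 = q := by
  have := h.tame.norm_E_sub_le q 0
  rwa [norm_zero, mul_zero, norm_le_zero_iff, sub_eq_zero] at this

lemma LeviField.center_mem_box (h : LeviField M p e l ρ A K R) : p ∈ h.box := by
  have h0 : h.height p = 0 := by
    have := h.height_E (v := 0) (map_zero l) 0
    rwa [h.E_zero, zero_smul, add_zero] at this
  have := h.R_pos
  refine ⟨?_, ?_, ?_⟩
  · simp only [sub_self, norm_zero]; linarith
  · simp only [sub_self, map_zero, norm_zero, mul_zero]; linarith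
  · rw [h0, norm_zero, zero_mul]; linarith

lemma LeviField.base_mem_iff (h : LeviField M p e l ρ A K R) {z : V} (hz : z ∈ h.box)
    (hzM : z ∈ M) : p + h.height z • e ∈ M := by
  rw [← h.E_neg_proj]
  refine h.E_mem hzM ?_
  rw [norm_neg]
  linarith [hz.1, hz.2.1, h.R_pos]

lemma LeviField.base_bound (h : LeviField M p e l ρ A K R) {z w : V} (hz : z ∈ h.box)
    (hw : w ∈ h.box) :
    ‖p + h.height z • e - p‖ + (1 + K ^ 2) * ‖projAlong l e (w - p)‖ < R / 4 := by
  rw [add_sub_cancel_left, norm_smul]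
  linarith [hz.2.2, hw.2.1, h.R_pos]

lemma LeviField.E_base_mem_box (h : LeviField M p e l ρ A K R) {z : V} (hz : z ∈ h.box)
    {v : V} (hv : l v = 0) (hvr : (1 + K ^ 2) * ‖v‖ < R / 8) :
    h.tame.E (p + h.height z • e) v ∈ h.box := by
  refine ⟨?_, ?_, ?_⟩
  · have h1 := h.tame.norm_E_sub_le (p + h.height z • e) v
    have h2 := norm_add_le (h.tame.E (p + h.height z • e) v - (p + h.height z • e))
      (h.height z • e)
    rw [norm_smul] at h2
    have h3 : h.tame.E (p + h.height z • e) v - (p + h.height z • e) + h.height z • e =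
      h.tame.E (p + h.height z • e) v - p := by abel
    rw [h3] at h2
    linarith [hz.2.2, h.R_pos]
  · rwa [h.proj_E hv]
  · rw [h.height_E hv]; exact hz.2.2

lemma LeviField.E_base_mem (h : LeviField M p e l ρ A K R) {z : V} (hz : z ∈ h.box)
    (hzM : z ∈ M) {v : V} (hvr : (1 + K ^ 2) * ‖v‖ < R / 8) :
    h.tame.E (p + h.height z • e) v ∈ M := by
  refine h.E_mem (h.base_mem_iff hz hzM) ?_
  rw [add_sub_cancel_left, norm_smul]
  linarith [hz.2.2, h.R_pos]

/-- The height is constant along tangent curves in the flow box. -/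
lemma LeviField.height_curve (h : LeviField M p e l ρ A K R) {γ γ' : ℝ → V} {U : ℝ}
    (h0 : γ 0 ∈ M) (hγ : ∀ t ∈ Icc (0:ℝ) 1, HasDerivWithinAt γ (γ' t) (Icc 0 1) t)
    (hbox : ∀ t ∈ Icc (0:ℝ) 1, γ t ∈ h.box)
    (hU : ∀ t ∈ Icc (0:ℝ) 1, ‖projAlong l e (γ' t)‖ ≤ U)
    (h1 : ∀ t ∈ Icc (0:ℝ) 1, fderiv ℝ ρ (γ t) (γ' t) = 0)
    (h2 : ∀ t ∈ Icc (0:ℝ) 1, fderiv ℝ ρ (γ t) (I • γ' t) = 0) :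
    h.height (γ 1) = h.height (γ 0) := by
  have hb0 := hbox 0 (by simp)
  refine h.eq_E_iff.1 (h.curve_eq (h.base_mem_iff hb0 h0) hγ
    (fun t ht => h.box_subset (hbox t ht)) hU h1 h2 (fun t ht => ?_) (h.eq_E_iff.2 rfl))
  linarith [h.base_bound hb0 (hbox t ht), h.R_pos]

lemma LeviField.box_plaque (h : LeviField M p e l ρ A K R) {q : V} (hq : q ∈ h.box)
    (hqM : q ∈ M) : ∃ f : V → ℂ, DifferentiableOn ℂ f h.box ∧
    (∀ z ∈ h.box, fderiv ℂ f z ≠ 0) ∧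
    (∀ z ∈ h.box, f z = 0 ↔ z ∈ M ∧ h.height z = h.height q) ∧
    IsPreconnected {z ∈ h.box | f z = 0} := by
  set a := p + h.height q • e with ha
  have haM : a ∈ M := h.base_mem_iff hq hqM
  let f : V → ℂ := fun z => l (z - p) - l (h.tame.E a (projAlong l e (z - p)) - p)
  have hf0 : ∀ z, f z = 0 ↔ z = h.tame.E a (projAlong l e (z - p)) := by
    intro z
    constructor
    · intro hz
      have e1 : projAlong l e (z - p) =
        projAlong l e (h.tame.E a (projAlong l e (z - p)) - p) := (h.proj_E (h.l_proj _) _).symm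
      have e2 := sub_eq_zero.1 hz
      generalize h.tame.E a (projAlong l e (z - p)) = y at e1 e2 ⊢
      rw [projAlong_apply, projAlong_apply, e2] at e1
      exact sub_left_injective (sub_left_injective e1)
    · intro hz
      simp only [f]
      rw [← hz, sub_self]
  have hd : ∀ z ∈ h.box, HasFDerivAt f (l - l.comp ((ContinuousLinearMap.id ℂ V +
      (A (h.tame.E a (projAlong l e (z - p)))).smulRight e).comp (projAlong l e))) z := by
    intro z hz
    have e1 : HasFDerivAt (fun z => projAlong l e (z - p)) (projAlong l e) z :=
      (projAlong l e).hasFDerivAt.comp z ((hasFDerivAt_id z).sub_const p)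
    have e2 := (h.hasFDerivAt_E haM (z := a) (v := projAlong l e (z - p))
      (by linarith [h.base_bound hq hz, h.R_pos])).comp z e1
    have e3 := l.hasFDerivAt.comp z (e2.sub_const p)
    have e4 : HasFDerivAt (fun z => l (z - p)) l z :=
      l.hasFDerivAt.comp z ((hasFDerivAt_id z).sub_const p)
    exact e4.sub e3
  have hiff : ∀ z ∈ h.box, f z = 0 ↔ z ∈ M ∧ h.height z = h.height q := by
    intro z hz
    rw [hf0, ha, h.eq_E_iff]
    refine ⟨fun hzq => ⟨?_, hzq⟩, fun hz => hz.2⟩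
    rw [← h.eq_E_iff] at hzq
    rw [hzq]
    exact h.E_base_mem hq hqM hz.2.1
  refine ⟨f, fun z hz => (hd z hz).differentiableAt.differentiableWithinAt, fun z hz h0 => ?_,
    hiff, ?_⟩
  · have := congrArg (fun T => T e) h0
    simp [(hd z hz).fderiv, h.proj_e, h.l_e] at this
  · have himage : {z ∈ h.box | f z = 0} =
        h.tame.E a '' ({v | (1 + K ^ 2) * ‖v‖ < R / 8} ∩ {v | l v = 0}) := by
      ext z
      constructor
      · rintro ⟨hz, hfz⟩
        exact ⟨projAlong l e (z - p), ⟨hz.2.1, h.l_proj _⟩, ((hf0 z).1 hfz).symm⟩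
      · rintro ⟨v, ⟨hv, hlv⟩, rfl⟩
        refine ⟨h.E_base_mem_box hq hlv hv, ?_⟩
        rw [hf0, h.proj_E hlv]
    rw [himage]
    refine IsPreconnected.image (Convex.isPreconnected (Convex.inter ?_ ?_)) _
      (h.tame.continuous_E.comp (f := fun v : V => (a, v)) (by fun_prop)).continuousOn
    · have : {v : V | (1 + K ^ 2) * ‖v‖ < R / 8} = Metric.ball 0 (R / 8 / (1 + K ^ 2)) := by
        ext v
        rw [mem_ball_zero_iff, lt_div_iff₀ (by positivity), mem_ofPred_eq, mul_comm]
      rw [this]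
      exact convex_ball _ _
    · intro x hx y hy s t _ _ _
      simp only [mem_ofPred_eq] at hx hy ⊢
      rw [map_add, ← Complex.coe_smul, ← Complex.coe_smul, map_smul, map_smul, hx, hy]
      simp

lemma LeviField.box_trans (h : LeviField M p e l ρ A K R) {q z : V} (hq : q ∈ h.box)
    (hz : z ∈ h.box) (hqz : h.height q = h.height z)
    {O : Set V} (hO : O ∈ nhds q) : ∀ᶠ z' in nhds z, z' ∈ M → ∃ q' ∈ O, q' ∈ h.box ∧ q' ∈ M ∧
      h.height q' = h.height z' := by
  let g : V → V := fun z' => h.tame.E (p + h.height z' • e) (projAlong l e (q - p))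
  have hg : Continuous g := h.tame.continuous_E.comp
    (f := fun z' : V => (p + h.height z' • e, projAlong l e (q - p)))
    ((continuous_const.add (h.continuous_height.smul continuous_const)).prodMk continuous_const)
  have hgz : g z = q := by
    simp only [g]
    rw [← hqz, h.eq_E_height]
  have hg1 : ∀ᶠ z' in nhds z, g z' ∈ O := hg.continuousAt.eventually_mem (by rwa [hgz])
  filter_upwards [hg1, h.isOpen_box.mem_nhds hz] with z' h1 h2 hM'
  exact ⟨g z', h1, h.E_base_mem_box h2 (h.l_proj _) hq.2.1,
    h.E_base_mem h2 hM' hq.2.1, h.height_E (h.l_proj _) _⟩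

lemma LeviField.fderiv_smul_self (h : LeviField M p e l ρ A K R)
    (hcone : ∀ c : ℂ, c ≠ 0 → ∀ z ∈ M, c • z ∈ M) {z : V} (hz : z ∈ Metric.ball p R)
    (hzM : z ∈ M) (w : ℂ) : fderiv ℝ ρ z (w • z) = 0 := by
  have h1 : HasDerivAt (fun t : ℝ => exp (t * w) • z) (w • z) 0 := by
    have e1 : HasDerivAt (fun t : ℝ => exp (t * w)) (exp (((0:ℝ):ℂ) * w) * (1 * w)) 0 :=
      (((hasDerivAt_id (0:ℝ)).ofReal_comp).mul_const w).cexp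
    have e2 := e1.smul_const z
    simpa using e2
  have h2 : HasDerivAt (fun t : ℝ => ρ (exp (t * w) • z)) (fderiv ℝ ρ z (w • z)) 0 := by
    have e3 : HasFDerivAt ρ (fderiv ℝ ρ z) (exp (((0:ℝ):ℂ) * w) • z) := by
      simpa using (h.strict z hz).hasFDerivAt
    exact e3.comp_hasDerivAt (0:ℝ) h1
  have h3 : (fun t : ℝ => ρ (exp (t * w) • z)) =ᶠ[nhds 0] fun _ => 0 := by
    have : ∀ᶠ t : ℝ in nhds 0, exp (t * w) • z ∈ Metric.ball p R :=
      h1.continuousAt.eventually_mem (by simpa using Metric.isOpen_ball.mem_nhds hz)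
    filter_upwards [this] with t ht
    exact (h.mem_iff _ ht).1 (hcone _ (exp_ne_zero _) _ hzM)
  exact h2.unique ((hasDerivAt_const (0:ℝ) (0:ℝ)).congr_of_eventuallyEq h3)

lemma LeviField.box_orbit (h : LeviField M p e l ρ A K R)
    (hcone : ∀ c : ℂ, c ≠ 0 → ∀ z ∈ M, c • z ∈ M) {q : V} (hq : q ∈ h.box) (hqM : q ∈ M) :
    ∀ᶠ c in nhds (1:ℂ), h.height (c • q) = h.height q := by
  have hc : Continuous fun w : ℂ => exp w • q := by fun_prop
  have hnear : ∀ᶠ w in nhds (0:ℂ), exp w • q ∈ h.box :=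
    hc.continuousAt.eventually_mem (by simpa using h.isOpen_box.mem_nhds hq)
  obtain ⟨η, hη, hball⟩ := Metric.eventually_nhds_iff_ball.1 hnear
  have hlog : ∀ᶠ c in nhds (1:ℂ), log c ∈ Metric.ball (0:ℂ) η := by
    refine (continuousAt_clog (by simp)).eventually_mem ?_
    simpa using Metric.ball_mem_nhds (0:ℂ) hη
  filter_upwards [hlog, isOpen_ne.mem_nhds one_ne_zero] with c hcl hc0
  set w := log c with hw
  have hbox : ∀ t ∈ Icc (0:ℝ) 1, exp (t * w) • q ∈ h.box := by
    intro t ht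
    refine hball _ ?_
    rw [mem_ball_zero_iff] at hcl ⊢
    rw [norm_mul, Complex.norm_of_nonneg ht.1]
    exact (mul_le_of_le_one_left (norm_nonneg _) ht.2).trans_lt hcl
  have hder : ∀ t : ℝ, HasDerivAt (fun t : ℝ => exp (t * w) • q) (w • exp (t * w) • q) t := by
    intro t
    have e1 : HasDerivAt (fun t : ℝ => exp (t * w)) (exp ((t:ℂ) * w) * (1 * w)) t :=
      (((hasDerivAt_id t).ofReal_comp).mul_const w).cexp
    have e2 := e1.smul_const q
    rwa [one_mul, mul_comm, mul_smul] at e2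
  have hmem : ∀ t : ℝ, exp (t * w) • q ∈ M := fun t => hcone _ (exp_ne_zero _) _ hqM
  have := h.height_curve (γ := fun t : ℝ => exp (t * w) • q)
    (γ' := fun t : ℝ => w • exp (t * w) • q) (U := ‖projAlong l e‖ * (‖w‖ * (‖p‖ + R)))
    (hmem 0) (fun t _ => (hder t).hasDerivWithinAt) hbox (fun t ht => ?_) (fun t ht => ?_)
    (fun t ht => ?_)
  · simpa [hw, exp_log hc0] using this
  · refine ((projAlong l e).le_opNorm _).trans (mul_le_mul_of_nonneg_left ?_ (norm_nonneg _))
    rw [norm_smul]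
    refine mul_le_mul_of_nonneg_left ?_ (norm_nonneg _)
    have h1 := mem_ball_iff_norm.1 (h.box_subset (hbox t ht))
    have h2 := norm_sub_norm_le (exp (t * w) • q) p
    linarith
  · exact h.fderiv_smul_self hcone (h.box_subset (hbox t ht)) (hmem t) w
  · rw [smul_smul]
    exact h.fderiv_smul_self hcone (h.box_subset (hbox t ht)) (hmem t) _

end Box

section Unique

variable {V : Type*} [NormedAddCommGroup V] [NormedSpace ℂ V]
  {M : Set V} {p e : V} {l : V →L[ℂ] ℂ} {ρ : V → ℝ} {A : V → V →L[ℂ] ℂ} {K R : ℝ}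

/-- A functional `φ` with `φ e ≠ 0` may replace `l` as the coordinate along `e`. -/
def replaceCoord (l φ : V →L[ℂ] ℂ) (e : V) (hl : l e = 1) (hφ : φ e ≠ 0) : V ≃L[ℂ] V :=
  ContinuousLinearEquiv.equivOfInverse (projAlong l e + φ.smulRight e)
    (projAlong l e + ((φ e)⁻¹ • (l - φ.comp (projAlong l e))).smulRight e)
    (fun w => by
      simp [projAlong_apply, hl, hφ, mul_comm (φ e)⁻¹])
    (fun w => by
      simp [projAlong_apply, hl, hφ, mul_comm (φ e)⁻¹])

lemma replaceCoord_apply (l φ : V →L[ℂ] ℂ) (e : V) (hl : l e = 1) (hφ : φ e ≠ 0) (w : V) :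
    replaceCoord l φ e hl hφ w = projAlong l e w + φ w • e := rfl

variable [CompleteSpace V]

lemma LeviField.box_unique (h : LeviField M p e l ρ A K R) {q : V} (hq : q ∈ h.box)
    {U : Set V} (hU : IsOpen U) (hqU : q ∈ U) {f : V → ℂ} (hf : DifferentiableOn ℂ f U)
    (hf' : ∀ z ∈ U, fderiv ℂ f z ≠ 0) (hfM : {z ∈ U | f z = 0} ⊆ M) (hfq : f q = 0) :
    ∀ᶠ z in nhds q, f z = 0 → h.height z = h.height q := by
  have hstrict : ∀ z ∈ U, HasStrictFDerivAt f (fderiv ℂ f z) z := fun z hz =>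
    hf.hasStrictFDerivAt_complex hU hz
  have hker : ∀ z ∈ U ∩ h.box, f z = 0 → ∀ w, fderiv ℂ f z w = 0 → fderiv ℝ ρ z w = 0 := by
    intro z hz hfz w hw
    refine ker_le_of_constant_on_level (hstrict z hz.1) (hf' z hz.1)
      (h.strict z (h.box_subset hz.2)) ?_ hw
    filter_upwards [hU.mem_nhds hz.1, h.isOpen_box.mem_nhds hz.2] with x hxU hxB hx
    rw [(h.mem_iff x (h.box_subset hxB)).1 (hfM ⟨hxU, hx.trans hfz⟩),
      (h.mem_iff z (h.box_subset hz.2)).1 (hfM ⟨hz.1, hfz⟩)]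
  have hkerI : ∀ z ∈ U ∩ h.box, f z = 0 → ∀ w, fderiv ℂ f z w = 0 →
      fderiv ℝ ρ z (I • w) = 0 := fun z hz hfz w hw =>
    hker z hz hfz _ (by rw [map_smul, hw, smul_zero])
  have hfe : ∀ z ∈ U ∩ h.box, f z = 0 → fderiv ℂ f z e ≠ 0 := by
    intro z hz hfz h0
    have h1 := h.eq_hat z (h.box_subset hz.2) e (hker z hz hfz e h0) (hkerI z hz hfz e h0)
    rw [hatLift, h.A_e z (h.box_subset hz.2), neg_one_smul, add_neg_cancel] at h1
    have := h.l_e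
    rw [← h1, map_zero] at this
    exact zero_ne_one this
  let Φ : V → V := fun z => projAlong l e z + f z • e
  have hΦ : ∀ z (hz : z ∈ U ∩ h.box) (hfz : f z = 0), HasStrictFDerivAt Φ
      (replaceCoord l (fderiv ℂ f z) e h.l_e (hfe z hz hfz) : V →L[ℂ] V) z := by
    intro z hz hfz
    exact (projAlong l e).hasStrictFDerivAt.add ((hstrict z hz.1).smul_const e)
  have hlΦ : ∀ z, l (Φ z) = f z := fun z => by simp [Φ, h.l_proj, h.l_e]
  have hpΦ : ∀ z, projAlong l e (Φ z) = projAlong l e z := fun z => by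
    simp [Φ, h.proj_e, LeviField.proj_eq_self (h.l_proj z)]
  have hΦq := hΦ q ⟨hqU, hq⟩ hfq
  set Ψ := hΦq.toOpenPartialHomeomorph Φ with hΨ
  have hcoe : ∀ z, Ψ z = Φ z := fun z => rfl
  have hqs : q ∈ Ψ.source := hΦq.mem_toOpenPartialHomeomorph_source
  have hqt : Φ q ∈ Ψ.target := Ψ.map_source hqs
  have hsymq : Ψ.symm (Φ q) = q := Ψ.left_inv hqs
  have hnear : ∀ᶠ y in nhds (Φ q), y ∈ Ψ.target ∧ Ψ.symm y ∈ U ∩ h.box :=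
    Filter.Eventually.and (Ψ.open_target.mem_nhds hqt)
      ((Ψ.continuousAt_symm hqt).eventually_mem
        (by rw [hsymq]; exact (hU.inter h.isOpen_box).mem_nhds ⟨hqU, hq⟩))
  obtain ⟨η, hη, hball⟩ := Metric.eventually_nhds_iff_ball.1 hnear
  have hpc : Continuous fun z => Φ q + projAlong l e (z - q) := by fun_prop
  have hz1 : ∀ᶠ z in nhds q, Φ q + projAlong l e (z - q) ∈ Metric.ball (Φ q) η :=
    hpc.continuousAt.eventually_mem (by simpa using Metric.ball_mem_nhds (Φ q) hη)
  filter_upwards [hz1, Ψ.open_source.mem_nhds hqs] with z hz hzs hfz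
  have hΦz : Φ q + projAlong l e (z - q) = Φ z := by
    simp only [Φ, hfq, hfz, zero_smul, add_zero, map_sub]
    abel
  let c : ℝ → V := fun s => Φ q + s • projAlong l e (z - q)
  have hc : ∀ s ∈ Icc (0:ℝ) 1, c s ∈ Metric.ball (Φ q) η := by
    intro s hs
    rw [mem_ball_iff_norm, add_sub_cancel_left] at hz ⊢
    rw [norm_smul, Real.norm_of_nonneg hs.1]
    exact (mul_le_of_le_one_left (norm_nonneg _) hs.2).trans_lt hz
  have hlc : ∀ s, l (c s) = 0 := by
    intro s
    simp only [c]
    rw [← Complex.coe_smul, map_add, map_smul, hlΦ, hfq, h.l_proj, smul_zero, add_zero]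
  let γ : ℝ → V := fun s => Ψ.symm (c s)
  have hγm : ∀ s ∈ Icc (0:ℝ) 1, γ s ∈ U ∩ h.box := fun s hs => (hball _ (hc s hs)).2
  have hΦγ : ∀ s ∈ Icc (0:ℝ) 1, Φ (γ s) = c s := fun s hs =>
    Ψ.right_inv (hball _ (hc s hs)).1
  have hfγ : ∀ s ∈ Icc (0:ℝ) 1, f (γ s) = 0 := fun s hs => by
    rw [← hlΦ, hΦγ s hs, hlc]
  have hder : ∀ s ∈ Icc (0:ℝ) 1, ∃ w, HasDerivAt γ w s ∧ fderiv ℂ f (γ s) w = 0 ∧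
      projAlong l e w = projAlong l e (z - q) := by
    intro s hs
    have h1 := Ψ.hasFDerivAt_symm (hball _ (hc s hs)).1
      (hΦ _ (hγm s hs) (hfγ s hs)).hasFDerivAt
    have h2 : HasDerivAt c (projAlong l e (z - q)) s := by
      have := ((hasDerivAt_id s).smul_const (projAlong l e (z - q))).const_add (Φ q)
      rw [one_smul] at this
      exact this
    refine ⟨_, (h1.restrictScalars ℝ).comp_hasDerivAt s h2, ?_, ?_⟩
    all_goals
      set T := replaceCoord l (fderiv ℂ f (γ s)) e h.l_e (hfe _ (hγm s hs) (hfγ s hs)) with hT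
      change _ = _
      rw [ContinuousLinearMap.coe_restrictScalars']
      have h3 := T.apply_symm_apply (projAlong l e (z - q))
      rw [hT, replaceCoord_apply, ← hT] at h3
    · have := congrArg l h3
      simpa [h.l_proj, h.l_e] using this
    · have := congrArg (projAlong l e) h3
      simpa [h.proj_e, LeviField.proj_eq_self (h.l_proj _)] using this
  choose! γ' hγ' using hder
  have hγ0 : γ 0 = q := by simp [γ, c, hsymq]
  have hγ1 : γ 1 = z := by
    simp only [γ, c, one_smul, hΦz]
    exact Ψ.left_inv hzs
  have := h.height_curve (γ := γ) (γ' := γ') (by rw [hγ0]; exact hfM ⟨hqU, hfq⟩)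
    (fun t ht => (hγ' t ht).1.hasDerivWithinAt) (fun t ht => (hγm t ht).2)
    (U := ‖projAlong l e (z - q)‖) (fun t ht => by rw [(hγ' t ht).2.2])
    (fun t ht => hker _ (hγm t ht) (hfγ t ht) _ (hγ' t ht).2.1)
    (fun t ht => hkerI _ (hγm t ht) (hfγ t ht) _ (hγ' t ht).2.1)
  rwa [hγ0, hγ1] at this

lemma LeviField.flowBox (h : LeviField M p e l ρ A K R) : FlowBox M h.box h.height where
  isOpen := h.isOpen_box
  cont := h.continuous_height
  plaque _ hq hqM := h.box_plaque hq hqM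
  unique _ hq _ hU hqU _ hf hf' hfM hfq := h.box_unique hq hU hqU hf hf' hfM hfq
  orbit hcone _ hq hqM := h.box_orbit hcone hq hqM
  trans _ hq _ _ hz _ hqz _ hO := h.box_trans hq hz hqz hO

end Unique

lemma exists_flowBox {m : ℕ} {M : Set (Fin m → ℂ)} (hM : IsSmoothLeviFlatHypersurface M)
    {p : Fin m → ℂ} (hp : p ∈ M) : ∃ W H, p ∈ W ∧ FlowBox M W H := by
  obtain ⟨e, l, ρ, A, K, R, h⟩ := exists_leviField hM hp
  exact ⟨h.box, h.height, h.center_mem_box, h.flowBox⟩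

lemma countable_reflTransGen {α : Type*} {r : α → α → Prop} (h : ∀ a, {b | r a b}.Countable)
    (a : α) : {b | Relation.ReflTransGen r a b}.Countable := by
  let s : ℕ → Set α := fun n => Nat.rec {a} (fun _ t => ⋃ x ∈ t, {b | r x b}) n
  have hs : ∀ n, (s n).Countable := by
    intro n
    induction n with
    | zero => exact countable_singleton a
    | succ n ih => exact ih.biUnion fun x _ => h x
  refine (countable_iUnion hs).mono fun b hb => ?_
  simp only [mem_iUnion]
  induction hb with
  | refl => exact ⟨0, rfl⟩
  | tail _ hbc ih =>
    obtain ⟨n, hn⟩ := ih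
    exact ⟨n + 1, mem_biUnion hn hbc⟩

lemma countable_image_of_locally_const {X Y : Type*} [TopologicalSpace X]
    [SecondCountableTopology X] {S : Set X} {g : X → Y}
    (h : ∀ x ∈ S, ∀ᶠ y in nhdsWithin x S, g y = g x) : (g '' S).Countable := by
  obtain ⟨t, _, htc, hS⟩ := TopologicalSpace.countable_cover_nhdsWithin
    (f := fun x => {y | g y = g x}) h
  refine (htc.image g).mono ?_
  rintro _ ⟨x, hx, rfl⟩
  obtain ⟨y, hy, hxy⟩ := mem_iUnion₂.1 (hS hx)
  exact ⟨y, hy, hxy.symm⟩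

section Leaf

variable {m : ℕ} {M : Set (Fin m → ℂ)}

/-- Two points lie on a common plaque of a flow box. -/
def BoxRel (M : Set (Fin m → ℂ)) (x y : Fin m → ℂ) : Prop :=
  ∃ W H, FlowBox M W H ∧ x ∈ W ∧ y ∈ W ∧ x ∈ M ∧ y ∈ M ∧ H x = H y

lemma BoxRel.symm {x y : Fin m → ℂ} (h : BoxRel M x y) : BoxRel M y x := by
  obtain ⟨W, H, hF, hx, hy, hxM, hyM, hxy⟩ := h
  exact ⟨W, H, hF, hy, hx, hyM, hxM, hxy.symm⟩

lemma BoxRel.leviPlaqueRel {x y : Fin m → ℂ} (h : BoxRel M x y) : LeviPlaqueRel M x y := by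
  obtain ⟨W, H, hF, hx, hy, hxM, hyM, hxy⟩ := h
  obtain ⟨f, hf, hf', hiff, hpre⟩ := hF.plaque x hx hxM
  have hfx := (hiff x hx).2 ⟨hxM, rfl⟩
  have hfy := (hiff y hy).2 ⟨hyM, hxy.symm⟩
  exact ⟨W, hF.isOpen, f, hf, hf', fun z hz => ((hiff z hz.1).1 hz.2).1, hx, hfx,
    hpre.subset_connectedComponentIn (mem_sep hx hfx) subset_rfl (mem_sep hy hfy)⟩

/-- A property invariant along the plaques of flow boxes is invariant along all plaques. -/
lemma LeviPlaqueRel.induction (hM : IsSmoothLeviFlatHypersurface M) {P : (Fin m → ℂ) → Prop}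
    (hP : ∀ x y, BoxRel M x y → P x → P y) {x y : Fin m → ℂ} (h : LeviPlaqueRel M x y)
    (hx : P x) : P y := by
  obtain ⟨U, hU, f, hf, hf', hfM, hxU, hfx, hy⟩ := h
  refine isPreconnected_connectedComponentIn.induction₂' (fun a b => P a → P b) ?_
    (fun a b c _ _ _ h1 h2 h3 => h2 (h1 h3)) (mem_connectedComponentIn (mem_sep hxU hfx)) hy hx
  intro z hz
  have hzf := connectedComponentIn_subset _ _ hz
  obtain ⟨W, H, hzW, hF⟩ := exists_flowBox hM (hfM hzf)
  have h1 := hF.unique z hzW U hU hzf.1 f hf hf' hfM hzf.2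
  filter_upwards [mem_nhdsWithin_of_mem_nhds h1,
    mem_nhdsWithin_of_mem_nhds (hF.isOpen.mem_nhds hzW), self_mem_nhdsWithin] with z' hz' hzW' hc
  have hzf' := connectedComponentIn_subset _ _ hc
  have hb : BoxRel M z z' := ⟨W, H, hF, hzW, hzW', hfM hzf, hfM hzf', (hz' hzf'.2).symm⟩
  exact ⟨hP _ _ hb, hP _ _ hb.symm⟩

lemma leviLeaf_induction (hM : IsSmoothLeviFlatHypersurface M) {P : (Fin m → ℂ) → Prop}
    (hP : ∀ x y, BoxRel M x y → P x → P y) {x y : Fin m → ℂ} (h : y ∈ leviLeaf M x)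
    (hx : P x) : P y := by
  induction h with
  | refl => exact hx
  | tail _ hab ih => exact hab.induction hM hP ih

lemma BoxRel.mem_leviLeaf {p x y : Fin m → ℂ} (h : BoxRel M x y) (hx : x ∈ leviLeaf M p) :
    y ∈ leviLeaf M p :=
  Relation.ReflTransGen.tail hx h.leviPlaqueRel

lemma leviLeaf_subset (hM : IsSmoothLeviFlatHypersurface M) {p : Fin m → ℂ} (hp : p ∈ M) :
    leviLeaf M p ⊆ M := fun _ hx =>
  leviLeaf_induction hM (P := fun x => x ∈ M)
    (fun _ _ ⟨_, _, _, _, _, _, hy, _⟩ _ => hy) hx hp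

lemma isCone_leviLeaf (hM : IsSmoothLeviFlatHypersurface M) (hcone : IsCone M)
    {p : Fin m → ℂ} (hp : p ∈ M) : IsCone (leviLeaf M p) := by
  intro c hc q hq
  have hpre : IsPreconnected ({0}ᶜ : Set ℂ) :=
    (isConnected_compl_singleton_of_one_lt_rank (by simp) (0:ℂ)).isPreconnected
  have hqM := leviLeaf_subset hM hp hq
  have := hpre.induction₂' (fun a b => a • q ∈ leviLeaf M p → b • q ∈ leviLeaf M p) ?_
    (fun a b c _ _ _ h1 h2 h3 => h2 (h1 h3)) (x := 1) (y := c) (by simp) hc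
  · exact this (by rwa [one_smul])
  intro a ha
  obtain ⟨W, H, hW, hF⟩ := exists_flowBox hM (hcone a ha q hqM)
  have h1 := hF.orbit hcone _ hW (hcone a ha q hqM)
  have h2 : Filter.Tendsto (fun b : ℂ => b / a) (nhds a) (nhds 1) := by
    have : ContinuousAt (fun b : ℂ => b / a) a := by fun_prop
    simpa [ContinuousAt, div_self (show a ≠ 0 from ha)] using this
  have h3 : ∀ᶠ b in nhds a, b • q ∈ W := by
    have : Continuous fun b : ℂ => b • q := by fun_prop
    exact this.continuousAt.eventually_mem (hF.isOpen.mem_nhds hW)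
  filter_upwards [mem_nhdsWithin_of_mem_nhds (h2.eventually h1), mem_nhdsWithin_of_mem_nhds h3,
    self_mem_nhdsWithin] with b hb1 hb2 hb0
  have ha0 : a ≠ 0 := ha
  rw [smul_smul, div_mul_cancel₀ _ ha0] at hb1
  have hb : BoxRel M (a • q) (b • q) :=
    ⟨W, H, hF, hW, hb2, hcone a ha q hqM, hcone b hb0 q hqM, hb1.symm⟩
  exact ⟨hb.mem_leviLeaf, hb.symm.mem_leviLeaf⟩

/-- The level sets of two flow boxes agree locally. -/
lemma FlowBox.eventually_eq {W W' : Set (Fin m → ℂ)} {H H' : (Fin m → ℂ) → ℂ}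
    (hF : FlowBox M W H) (hF' : FlowBox M W' H') {q : Fin m → ℂ} (hq : q ∈ W) (hq' : q ∈ W')
    (hqM : q ∈ M) : ∀ᶠ x in nhds q, x ∈ M → H x = H q → H' x = H' q := by
  obtain ⟨f, hf, hf', hiff, -⟩ := hF.plaque q hq hqM
  have h1 := hF'.unique q hq' W hF.isOpen hq f hf hf' (fun z hz => ((hiff z hz.1).1 hz.2).1)
    ((hiff q hq).2 ⟨hqM, rfl⟩)
  filter_upwards [h1, hF.isOpen.mem_nhds hq] with x hx hxW hxM hxH
  exact hx ((hiff x hxW).2 ⟨hxM, hxH⟩)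

/-- A leaf meets every flow box in countably many plaques. -/
lemma countable_height_leviLeaf (hM : IsSmoothLeviFlatHypersurface M) {p : Fin m → ℂ}
    (hp : p ∈ M) {W₀ : Set (Fin m → ℂ)} {H₀ : (Fin m → ℂ) → ℂ} (hF₀ : FlowBox M W₀ H₀) :
    (H₀ '' (leviLeaf M p ∩ W₀)).Countable := by
  have hex := fun x : M => exists_flowBox hM x.2
  choose W H hxW hF using hex
  obtain ⟨T, hT⟩ : ∃ T : Set M, T.Countable ∧ M ⊆ ⋃ t ∈ T, W t := by
    obtain ⟨T, hTc, hTM⟩ := TopologicalSpace.countable_cover_nhds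
      (f := fun x : M => ((↑) : M → Fin m → ℂ) ⁻¹' W x)
      (fun x => continuous_subtype_val.continuousAt.preimage_mem_nhds
        ((hF x).isOpen.mem_nhds (hxW x)))
    refine ⟨T, hTc, fun x hx => ?_⟩
    have : (⟨x, hx⟩ : M) ∈ ⋃ t ∈ T, ((↑) : M → Fin m → ℂ) ⁻¹' W t := hTM ▸ mem_univ _
    simpa using this
  obtain ⟨hTc, hTM⟩ := hT
  let N : M × ℂ → M × ℂ → Prop := fun a b => b.1 ∈ T ∧
    ∃ x ∈ M, x ∈ W a.1 ∧ x ∈ W b.1 ∧ H a.1 x = a.2 ∧ H b.1 x = b.2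
  have hcount : ∀ (a : M × ℂ) (W' : Set (Fin m → ℂ)) (H' : (Fin m → ℂ) → ℂ),
      FlowBox M W' H' → (H' '' {x | x ∈ M ∧ x ∈ W a.1 ∧ x ∈ W' ∧ H a.1 x = a.2}).Countable := by
    intro a W' H' hF'
    refine countable_image_of_locally_const fun x hx => ?_
    filter_upwards [mem_nhdsWithin_of_mem_nhds
      ((hF a.1).eventually_eq hF' hx.2.1 hx.2.2.1 hx.1), self_mem_nhdsWithin] with y hy hyS
    exact hy hyS.1 (hyS.2.2.2.trans hx.2.2.2.symm)
  have hN : ∀ a, {b | N a b}.Countable := by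
    intro a
    refine (hTc.biUnion fun t _ => (hcount a (W t) (H t) (hF t)).image (Prod.mk t)).mono ?_
    rintro ⟨t, τ⟩ ⟨ht, x, hxM, hxa, hxt, h1, h2⟩
    exact mem_biUnion ht ⟨τ, ⟨x, ⟨hxM, hxa, hxt, h1⟩, h2⟩, rfl⟩
  let p' : M := ⟨p, hp⟩
  let C := {b | Relation.ReflTransGen N (p', H p' p) b}
  have hC : C.Countable := countable_reflTransGen hN _
  have hleaf : ∀ z ∈ leviLeaf M p, ∃ t, z ∈ W t ∧ (t, H t z) ∈ C := by
    intro z hz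
    refine (leviLeaf_induction hM (P := fun z => z ∈ M ∧ ∃ t, z ∈ W t ∧ (t, H t z) ∈ C) ?_ hz
      ⟨hp, p', hxW p', Relation.ReflTransGen.refl⟩).2
    have hloc : ∀ x ∈ M, ∀ t, x ∈ W t → (t, H t x) ∈ C → ∀ s ∈ T, x ∈ W s → (s, H s x) ∈ C :=
      fun x hxM t hxt hC s hs hxs => Relation.ReflTransGen.tail hC ⟨hs, x, hxM, hxt, hxs, rfl, rfl⟩
    rintro x y ⟨W', H', hF', hxW', hyW', hxM, hyM, hxy⟩ ⟨-, t, hxt, hC⟩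
    obtain ⟨f, -, -, hiff, hpre⟩ := hF'.plaque x hxW' hxM
    have hfx := (hiff x hxW').2 ⟨hxM, rfl⟩
    have hfy := (hiff y hyW').2 ⟨hyM, hxy.symm⟩
    refine ⟨hyM, ?_⟩
    refine hpre.induction₂' (fun a b => (∃ t, a ∈ W t ∧ (t, H t a) ∈ C) →
      ∃ t, b ∈ W t ∧ (t, H t b) ∈ C) ?_
      (fun a b c _ _ _ h1 h2 h3 => h2 (h1 h3)) ⟨hxW', hfx⟩ ⟨hyW', hfy⟩ ⟨t, hxt, hC⟩
    rintro a ⟨haW, hfa⟩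
    have haM := ((hiff a haW).1 hfa).1
    obtain ⟨s, hs, has⟩ := mem_iUnion₂.1 (hTM haM)
    filter_upwards [mem_nhdsWithin_of_mem_nhds (hF'.eventually_eq (hF s) haW has haM),
      mem_nhdsWithin_of_mem_nhds ((hF s).isOpen.mem_nhds has), self_mem_nhdsWithin]
      with b hb hbs hbS
    have hb1 := (hiff b hbS.1).1 hbS.2
    have hba : H s b = H s a := hb hb1.1 (hb1.2.trans ((hiff a haW).1 hfa).2.symm)
    constructor
    · rintro ⟨t, hat, htC⟩
      exact ⟨s, hbs, hba ▸ hloc a haM t hat htC s hs has⟩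
    · rintro ⟨t, hbt, htC⟩
      exact ⟨s, has, hba ▸ hloc b hb1.1 t hbt htC s hs hbs⟩
  refine (hC.biUnion fun a _ => hcount a W₀ H₀ hF₀).mono ?_
  rintro _ ⟨z, ⟨hzL, hz₀⟩, rfl⟩
  obtain ⟨t, hzt, htC⟩ := hleaf z hzL
  exact mem_biUnion htC ⟨z, ⟨leviLeaf_subset hM hp hzL, hzt, hz₀, rfl⟩, rfl⟩

/-- A leaf which is closed in the punctured space is locally a smooth complex hypersurface. -/
lemma exists_local_equation (hM : IsSmoothLeviFlatHypersurface M) (h0 : (0 : Fin m → ℂ) ∉ M)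
    {p : Fin m → ℂ} (hp : p ∈ M)
    (hcl : ∀ z, z ≠ 0 → z ∈ closure (leviLeaf M p) → z ∈ leviLeaf M p)
    {q : Fin m → ℂ} (hq : q ∈ leviLeaf M p) :
    ∃ W : Set (Fin m → ℂ), IsOpen W ∧ q ∈ W ∧ ∃ f : (Fin m → ℂ) → ℂ, DifferentiableOn ℂ f W ∧
      (∀ z ∈ W, fderiv ℂ f z ≠ 0) ∧ ∀ z ∈ W, z ∈ leviLeaf M p ↔ f z = 0 := by
  set L := leviLeaf M p with hL
  have hLM : L ⊆ M := leviLeaf_subset hM hp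
  have hpL : p ∈ L := Relation.ReflTransGen.refl
  let Good : (Fin m → ℂ) → Prop := fun q =>
    ∀ W H, FlowBox M W H → q ∈ W → ∀ᶠ x in nhds q, x ∈ L → H x = H q
  have hgood : ∀ q ∈ L, ∀ W H, FlowBox M W H → q ∈ W →
      (∀ᶠ x in nhds q, x ∈ L → H x = H q) → Good q := by
    intro q hq W H hF hqW h W' H' hF' hqW'
    filter_upwards [h, hF.eventually_eq hF' hqW hqW' (hLM hq)] with x hx hx' hxL
    exact hx' (hLM hxL) (hx hxL)
  have hprop : ∀ x y, BoxRel M x y → x ∈ L ∧ Good x → y ∈ L ∧ Good y := by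
    rintro x y hxy ⟨hxL, hx⟩
    have hyL : y ∈ L := hxy.mem_leviLeaf hxL
    obtain ⟨W, H, hF, hxW, hyW, hxM, hyM, hH⟩ := hxy
    refine ⟨hyL, hgood y hyL W H hF hyW ?_⟩
    filter_upwards [hF.trans x hxW hxM y hyW hyM hH _ (hx W H hF hxW),
      hF.isOpen.mem_nhds hyW] with z hz hzW hzL
    obtain ⟨x', hx', hxW', hxM', hH'⟩ := hz (hLM hzL)
    have : BoxRel M z x' := ⟨W, H, hF, hzW, hxW', hLM hzL, hxM', hH'.symm⟩
    rw [← hH', hx' (this.mem_leviLeaf hzL), hH]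
  have hsymm : ∀ x y, BoxRel M x y → (x ∈ L ∧ Good x ↔ y ∈ L ∧ Good y) := fun x y h =>
    ⟨hprop x y h, hprop y x h.symm⟩
  have hexists : ∃ x ∈ L, Good x := by
    obtain ⟨W, H, hpW, hF⟩ := exists_flowBox hM hp
    have hLeq : L = closure L ∩ {0}ᶜ := by
      ext z
      exact ⟨fun hz => ⟨subset_closure hz, fun h => h0 (h ▸ hLM hz)⟩, fun hz => hcl z hz.2 hz.1⟩
    have hLC : IsLocallyClosed (L ∩ W) := by
      rw [hLeq]
      exact (isClosed_closure.isLocallyClosed.inter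
        isOpen_compl_singleton.isLocallyClosed).inter hF.isOpen.isLocallyClosed
    have := hLC.locallyCompactSpace
    have : Nonempty ↥(L ∩ W) := ⟨⟨p, hpL, hpW⟩⟩
    have := (countable_height_leviLeaf hM hp hF).to_subtype
    obtain ⟨⟨σ, _⟩, ⟨x, hxL, hxW⟩, hx⟩ := nonempty_interior_of_iUnion_of_closed
      (X := ↥(L ∩ W)) (f := fun σ : ↥(H '' (L ∩ W)) => {x | H x = σ})
      (fun σ => isClosed_eq (hF.cont.comp continuous_subtype_val) continuous_const)
      (eq_univ_of_forall fun x => mem_iUnion.2 ⟨⟨H x, x, x.2, rfl⟩, rfl⟩)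
    have hx' := mem_interior_iff_mem_nhds.1 hx
    have hxσ : H x = σ := mem_of_mem_nhds (s := {y : ↥(L ∩ W) | H y = σ}) hx'
    obtain ⟨O, hO, hOs⟩ := (mem_nhds_subtype _ _ _).1 hx'
    refine ⟨x, hxL, hgood x hxL W H hF hxW ?_⟩
    filter_upwards [hO, hF.isOpen.mem_nhds hxW] with y hy hyW hyL
    have : H y = σ := hOs (a := ⟨y, hyL, hyW⟩) hy
    rw [this, hxσ]
  obtain ⟨x, hxL, hx⟩ := hexists
  have hpg : Good p := by
    by_contra hc
    exact leviLeaf_induction hM (P := fun x => ¬ (x ∈ L ∧ Good x))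
      (fun x y h hx hy => hx ((hsymm x y h).2 hy)) hxL (fun h => hc h.2) ⟨hxL, hx⟩
  have hqg : Good q := (leviLeaf_induction hM hprop hq ⟨hpL, hpg⟩).2
  obtain ⟨W, H, hqW, hF⟩ := exists_flowBox hM (hLM hq)
  obtain ⟨f, hf, hf', hiff, -⟩ := hF.plaque q hqW (hLM hq)
  obtain ⟨O, hO, hOo, hqO⟩ := eventually_nhds_iff.1 (hqg W H hF hqW)
  refine ⟨W ∩ O, hF.isOpen.inter hOo, ⟨hqW, hqO⟩, f, hf.mono inter_subset_left,
    fun z hz => hf' z hz.1, fun z hz => ?_⟩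
  rw [hiff z hz.1]
  refine ⟨fun hzL => ⟨hLM hzL, hO z hz.2 hzL⟩, fun h => ?_⟩
  have : BoxRel M q z := ⟨W, H, hF, hqW, hz.1, hLM hq, h.1, h.2.symm⟩
  exact this.mem_leviLeaf hq

end Leaf

section Order

open Filter Topology Asymptotics

lemma analyticOrderAt_le_of_isBigO {φ ψ : ℂ → ℂ} {t : ℂ} (hφ : AnalyticAt ℂ φ t)
    (hψ : AnalyticAt ℂ ψ t) (h : φ =O[𝓝 t] ψ) : analyticOrderAt ψ t ≤ analyticOrderAt φ t := by
  refine ENat.forall_natCast_le_iff_le.1 fun n hn => ?_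
  by_contra! hlt
  obtain ⟨k, hk⟩ := ENat.ne_top_iff_exists.1 (ne_top_of_lt hlt)
  rw [← hk, Nat.cast_lt] at hlt
  obtain ⟨a, ha, ha0, hφa⟩ := hφ.analyticOrderAt_eq_natCast.1 hk.symm
  obtain ⟨b, hb, hψb⟩ := (natCast_le_analyticOrderAt hψ).1 hn
  obtain ⟨C, hC⟩ := h.bound
  have h1 : ∀ᶠ s in 𝓝[≠] t, ‖a s‖ ≤ C * (‖s - t‖ ^ (n - k) * ‖b s‖) := by
    filter_upwards [mem_nhdsWithin_of_mem_nhds hφa, mem_nhdsWithin_of_mem_nhds hψb,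
      mem_nhdsWithin_of_mem_nhds hC, self_mem_nhdsWithin] with s h1 h2 h3 h4
    have hst : 0 < ‖s - t‖ := norm_pos_iff.2 (sub_ne_zero.2 h4)
    rw [h1, h2, norm_smul, norm_smul, norm_pow, norm_pow,
      ← Nat.add_sub_of_le hlt.le, pow_add] at h3
    refine le_of_mul_le_mul_left ?_ (pow_pos hst k)
    linarith
  have h2 : Tendsto (fun s => C * (‖s - t‖ ^ (n - k) * ‖b s‖)) (𝓝[≠] t) (𝓝 0) := by
    have hc : ContinuousAt (fun s => C * (‖s - t‖ ^ (n - k) * ‖b s‖)) t := by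
      have := hb.continuousAt
      fun_prop
    have := hc.tendsto
    rw [sub_self, norm_zero, zero_pow (Nat.sub_ne_zero_of_lt hlt), zero_mul, mul_zero] at this
    exact this.mono_left nhdsWithin_le_nhds
  have h3 : Tendsto (fun s => ‖a s‖) (𝓝[≠] t) (𝓝 ‖a t‖) :=
    ha.continuousAt.norm.tendsto.mono_left nhdsWithin_le_nhds
  exact ha0 (norm_le_zero_iff.1 (le_of_tendsto_of_tendsto h3 h2 h1))

lemma analyticOrderAt_eq_of_isTheta {φ ψ : ℂ → ℂ} {t : ℂ} (hφ : AnalyticAt ℂ φ t)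
    (hψ : AnalyticAt ℂ ψ t) (h : φ =Θ[𝓝 t] ψ) : analyticOrderAt φ t = analyticOrderAt ψ t :=
  le_antisymm (analyticOrderAt_le_of_isBigO hψ hφ h.2) (analyticOrderAt_le_of_isBigO hφ hψ h.1)

end Order

section LocEq

open Filter Topology Asymptotics

variable {V : Type*} [NormedAddCommGroup V] [NormedSpace ℂ V]

lemma isBigO_of_zeros_subset [CompleteSpace V] {f g : V → ℂ} {f' g' : V →L[ℂ] ℂ} {q : V}
    (hf : HasStrictFDerivAt f f' q) (hg : HasStrictFDerivAt g g' q) (hg' : g' ≠ 0)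
    (hgq : g q = 0) (h : ∀ᶠ x in 𝓝 q, g x = 0 → f x = 0) : f =O[𝓝 q] g := by
  obtain ⟨e, he⟩ : ∃ e, g' e ≠ 0 := by
    by_contra! hc
    exact hg' (ContinuousLinearMap.ext hc)
  set l : V →L[ℂ] ℂ := (g' e)⁻¹ • g' with hl
  have hle : l e = 1 := by simp [hl, he]
  have hlp : ∀ x, l (projAlong l e x) = 0 := fun x => by simp [projAlong_apply, hle]
  let Φ : V → V := fun z => projAlong l e z + g z • e
  have hΦ : HasStrictFDerivAt Φ (replaceCoord l g' e hle he : V →L[ℂ] V) q :=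
    (projAlong l e).hasStrictFDerivAt.add (hg.smul_const e)
  set Ψ := hΦ.toOpenPartialHomeomorph Φ with hΨ
  have hqs : q ∈ Ψ.source := hΦ.mem_toOpenPartialHomeomorph_source
  have hqt : Φ q ∈ Ψ.target := Ψ.map_source hqs
  have hsymq : Ψ.symm (Φ q) = q := Ψ.left_inv hqs
  have hΦc : ContinuousAt Φ q := hΦ.continuousAt
  obtain ⟨K, s, hs, hK⟩ := hΦ.to_localInverse.exists_lipschitzOnWith
  obtain ⟨K', s', hs', hK'⟩ := hf.exists_lipschitzOnWith
  have hp : ContinuousAt (fun x => projAlong l e x) q := by fun_prop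
  have hpq : projAlong l e q = Φ q := by simp [Φ, hgq]
  have hsym : ContinuousAt (fun x => Ψ.symm (projAlong l e x)) q := by
    refine ContinuousAt.comp (f := fun x => projAlong l e x) (g := Ψ.symm) ?_ hp
    rw [hpq]
    exact Ψ.continuousAt_symm hqt
  have hsymq' : Ψ.symm (projAlong l e q) = q := by rw [hpq, hsymq]
  have hsym0 : ∀ᶠ x in 𝓝 q, g (Ψ.symm (projAlong l e x)) = 0 →
      f (Ψ.symm (projAlong l e x)) = 0 := by
    have := hsym.tendsto
    rw [hsymq'] at this
    exact this.eventually h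
  refine IsBigO.of_bound (K' * (K * ‖e‖)) ?_
  filter_upwards [hs', Ψ.open_source.mem_nhds hqs, hΦc.eventually_mem hs,
    hp.eventually_mem (by rw [hpq]; exact hs),
    hp.eventually_mem (by rw [hpq]; exact Ψ.open_target.mem_nhds hqt),
    hsym.eventually_mem (by rw [hsymq']; exact hs'),
    hsym0] with x h1 h2 h3 h4 h5 h6 h7
  set y := Ψ.symm (projAlong l e x) with hy
  have hΦy : Φ y = projAlong l e x := Ψ.right_inv h5
  have hgy : g y = 0 := by
    have := congrArg l hΦy
    simpa [Φ, hlp, hle] using this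
  have hxy : ‖x - y‖ ≤ K * (‖g x‖ * ‖e‖) := by
    have h8 := hK.norm_sub_le h3 h4
    have h9 : Φ x - projAlong l e x = g x • e := by simp [Φ]
    rw [h9, norm_smul] at h8
    have h10 : hΦ.localInverse Φ _ q (Φ x) = x := Ψ.left_inv h2
    rw [h10] at h8
    exact h8
  calc ‖f x‖ = ‖f x - f y‖ := by rw [h7 hgy, sub_zero]
    _ ≤ K' * ‖x - y‖ := hK'.norm_sub_le h1 h6
    _ ≤ K' * (K * (‖g x‖ * ‖e‖)) := mul_le_mul_of_nonneg_left hxy K'.2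
    _ = _ := by ring

/-- `f` is a reduced local equation of `L` on the open set `W`. -/
structure LocEq (L W : Set V) (f : V → ℂ) : Prop where
  isOpen : IsOpen W
  diff : DifferentiableOn ℂ f W
  fderiv_ne : ∀ z ∈ W, z ∈ L → fderiv ℂ f z ≠ 0
  mem_iff : ∀ z ∈ W, z ∈ L ↔ f z = 0

lemma LocEq.isBigO [CompleteSpace V] {L W W' : Set V} {f f' : V → ℂ} (h : LocEq L W f)
    (h' : LocEq L W' f') {q : V} (hq : q ∈ W) (hq' : q ∈ W') : f =O[𝓝 q] f' := by
  by_cases hL : q ∈ L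
  · refine isBigO_of_zeros_subset (h.diff.hasStrictFDerivAt_complex h.isOpen hq)
      (h'.diff.hasStrictFDerivAt_complex h'.isOpen hq') (h'.fderiv_ne q hq' hL)
      ((h'.mem_iff q hq').1 hL) ?_
    filter_upwards [h.isOpen.mem_nhds hq, h'.isOpen.mem_nhds hq'] with x hx hx' hf
    exact (h.mem_iff x hx).1 ((h'.mem_iff x hx').2 hf)
  · have h1 : f' q ≠ 0 := fun h0 => hL ((h'.mem_iff q hq').2 h0)
    have hc : ContinuousAt f q := (h.diff.differentiableAt (h.isOpen.mem_nhds hq)).continuousAt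
    have hc' : ContinuousAt f' q :=
      (h'.diff.differentiableAt (h'.isOpen.mem_nhds hq')).continuousAt
    have e1 : f =O[𝓝 q] fun _ => (1:ℂ) := hc.tendsto.isBigO_one ℂ
    refine e1.trans (IsBigO.of_bound (‖f' q‖ / 2)⁻¹ ?_)
    have hpos : 0 < ‖f' q‖ := norm_pos_iff.2 h1
    filter_upwards [hc'.norm.eventually_const_lt (show ‖f' q‖ / 2 < ‖f' q‖ by linarith)]
      with x hx
    rw [norm_one, inv_mul_eq_div, one_le_div (by positivity)]
    exact hx.le

/-- The restriction of a local equation to a line is analytic. -/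
lemma LocEq.analyticAt {L W : Set V} {f : V → ℂ} (h : LocEq L W f) {z b : V} {t : ℂ}
    (ht : z + t • b ∈ W) : AnalyticAt ℂ (fun s : ℂ => f (z + s • b)) t := by
  have hc : Continuous fun s : ℂ => z + s • b := by fun_prop
  have ho : IsOpen {s : ℂ | z + s • b ∈ W} := h.isOpen.preimage hc
  refine DifferentiableOn.analyticAt (s := {s : ℂ | z + s • b ∈ W}) ?_ (ho.mem_nhds ht)
  exact h.diff.comp (by fun_prop) fun s hs => hs

lemma LocEq.analyticOrderAt_eq [CompleteSpace V] {L W W' : Set V} {f f' : V → ℂ}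
    (h : LocEq L W f) (h' : LocEq L W' f') {z b : V} {t : ℂ} (ht : z + t • b ∈ W)
    (ht' : z + t • b ∈ W') : analyticOrderAt (fun s : ℂ => f (z + s • b)) t =
      analyticOrderAt (fun s : ℂ => f' (z + s • b)) t := by
  have hc : Tendsto (fun s : ℂ => z + s • b) (𝓝 t) (𝓝 (z + t • b)) :=
    Continuous.tendsto (by fun_prop) t
  exact analyticOrderAt_eq_of_isTheta (h.analyticAt ht) (h'.analyticAt ht')
    ⟨(h.isBigO h' ht ht').comp_tendsto hc, (h'.isBigO h ht' ht).comp_tendsto hc⟩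

lemma LocEq.smul {L W : Set V} {f : V → ℂ} (h : LocEq L W f)
    (hL : ∀ c : ℂ, c ≠ 0 → ∀ z ∈ L, c • z ∈ L) {c : ℂ} (hc : c ≠ 0) :
    LocEq L {z | c⁻¹ • z ∈ W} fun z => f (c⁻¹ • z) := by
  have hmem : ∀ z, c⁻¹ • z ∈ L ↔ z ∈ L := fun z =>
    ⟨fun hz => by simpa [smul_smul, hc] using hL c hc _ hz, hL _ (inv_ne_zero hc) z⟩
  refine ⟨h.isOpen.preimage (by fun_prop), h.diff.comp (by fun_prop) fun s hs => hs, ?_,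
    fun z hz => by rw [← hmem, h.mem_iff _ hz]⟩
  intro z hz hzL h0
  refine h.fderiv_ne _ hz ((hmem z).2 hzL) ?_
  have h1 := (h.diff.differentiableAt (h.isOpen.mem_nhds hz)).hasFDerivAt.comp z
    ((hasFDerivAt_id (𝕜 := ℂ) z).const_smul c⁻¹)
  have h2 := h1.fderiv
  ext w
  have h3 := congrArg (fun T => T (c • w)) (h2.symm.trans h0)
  simpa [hc] using h3

end LocEq

section ArgumentPrinciple

open Filter Topology

lemma continuousOn_logDeriv_sphere {c : ℂ} {r : ℝ} {g : ℂ → ℂ} {U : Set ℂ}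
    (hU : IsOpen U) (hcU : Metric.closedBall c r ⊆ U) (hg : DifferentiableOn ℂ g U)
    (h0 : ∀ s ∈ Metric.sphere c r, g s ≠ 0) :
    ContinuousOn (fun s => deriv g s / g s) (Metric.sphere c r) := by
  have hs : Metric.sphere c r ⊆ U := Metric.sphere_subset_closedBall.trans hcU
  exact ((hg.deriv hU).continuousOn.mono hs).div (hg.continuousOn.mono hs) h0

/-- The argument principle on a disc. -/
lemma circleIntegral_logDeriv_eq {c : ℂ} {r : ℝ} (hr : 0 < r) {U : Set ℂ} (hU : IsOpen U)
    (hcU : Metric.closedBall c r ⊆ U) (Z : Finset ℂ) : ∀ g : ℂ → ℂ, DifferentiableOn ℂ g U →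
    (∀ s ∈ Metric.closedBall c r, g s = 0 ↔ s ∈ Z) → (∀ s ∈ Z, s ∈ Metric.ball c r) →
    (∀ s ∈ Z, analyticOrderAt g s ≠ ⊤) →
    (∮ s in C(c, r), deriv g s / g s) =
      2 * Real.pi * I * ((∑ s ∈ Z, analyticOrderNatAt g s : ℕ) : ℂ) := by
  induction Z using Finset.induction_on with
  | empty =>
    intro g hg h0 _ _
    have hne : ∀ s ∈ Metric.closedBall c r, g s ≠ 0 := fun s hs h => by simpa using (h0 s hs).1 h
    rw [Finset.sum_empty, Nat.cast_zero, mul_zero]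
    refine circleIntegral_eq_zero_of_differentiable_on_off_countable hr.le countable_empty ?_ ?_
    · exact ((hg.deriv hU).continuousOn.mono hcU).div (hg.continuousOn.mono hcU) hne
    · rintro s ⟨hs, -⟩
      have hsU := hcU (Metric.ball_subset_closedBall hs)
      exact ((hg.deriv hU).differentiableAt (hU.mem_nhds hsU)).div
        (hg.differentiableAt (hU.mem_nhds hsU)) (hne s (Metric.ball_subset_closedBall hs))
  | insert u Z huZ ih =>
    intro g hg h0 hZ htop
    have huB := hZ u (Finset.mem_insert_self u Z)
    have huU : u ∈ U := hcU (Metric.ball_subset_closedBall huB)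
    have hgan : ∀ s ∈ U, AnalyticAt ℂ g s := fun s hs => hg.analyticAt (hU.mem_nhds hs)
    have hgu : g u = 0 := (h0 u (Metric.ball_subset_closedBall huB)).2 (Finset.mem_insert_self u Z)
    set n := analyticOrderNatAt g u with hn
    have hn' : analyticOrderAt g u = n :=
      (Nat.cast_analyticOrderNatAt (htop u (Finset.mem_insert_self u Z))).symm
    have hn0 : n ≠ 0 := by
      intro h
      rw [h, Nat.cast_zero] at hn'
      exact ((hgan u huU).analyticOrderAt_eq_zero.1 hn') hgu
    obtain ⟨a, ha, hau, hga⟩ := (hgan u huU).analyticOrderAt_eq_natCast.1 hn'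
    let h : ℂ → ℂ := Function.update (fun s => g s / (s - u) ^ n) u (a u)
    have hhu : h u = a u := Function.update_self _ _ _
    have hhs : ∀ s, s ≠ u → h s = g s / (s - u) ^ n := fun s hs => Function.update_of_ne hs _ _
    have hgh : ∀ s, g s = (s - u) ^ n * h s := by
      intro s
      by_cases hs : s = u
      · rw [hs, hgu, sub_self, zero_pow hn0, zero_mul]
      · rw [hhs s hs, mul_div_cancel₀ _ (pow_ne_zero _ (sub_ne_zero.2 hs))]
    have hha : h =ᶠ[𝓝 u] a := by
      filter_upwards [hga] with s hs
      by_cases hsu : s = u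
      · rw [hsu, hhu]
      · rw [hhs s hsu, hs, smul_eq_mul,
          mul_div_cancel_left₀ _ (pow_ne_zero _ (sub_ne_zero.2 hsu))]
    have hhd : DifferentiableOn ℂ h U := by
      intro s hs
      refine DifferentiableAt.differentiableWithinAt ?_
      by_cases hsu : s = u
      · rw [hsu]
        exact ha.differentiableAt.congr_of_eventuallyEq hha
      · have e1 : h =ᶠ[𝓝 s] fun s => g s / (s - u) ^ n := by
          filter_upwards [isOpen_ne.mem_nhds hsu] with x hx using hhs x hx
        refine DifferentiableAt.congr_of_eventuallyEq ?_ e1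
        exact (hg.differentiableAt (hU.mem_nhds hs)).div (by fun_prop)
          (pow_ne_zero _ (sub_ne_zero.2 hsu))
    have hhan : ∀ s ∈ U, AnalyticAt ℂ h s := fun s hs => hhd.analyticAt (hU.mem_nhds hs)
    have hh0 : ∀ s ∈ Metric.closedBall c r, h s = 0 ↔ s ∈ Z := by
      intro s hs
      by_cases hsu : s = u
      · rw [hsu, hhu]
        exact iff_of_false hau huZ
      · have e2 : h s = 0 ↔ g s = 0 := by
          rw [hgh s, mul_eq_zero, or_iff_right (pow_ne_zero _ (sub_ne_zero.2 hsu))]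
        rw [e2, h0 s hs, Finset.mem_insert, or_iff_right hsu]
    have hord : ∀ v ∈ Z, analyticOrderAt g v = analyticOrderAt h v := by
      intro v hv
      have hvU := hcU (Metric.ball_subset_closedBall (hZ v (Finset.mem_insert_of_mem hv)))
      have hvu : v ≠ u := fun h => huZ (h ▸ hv)
      have e3 : AnalyticAt ℂ (fun s : ℂ => (s - u) ^ n) v := by fun_prop
      have e4 : g = (fun s : ℂ => (s - u) ^ n) * h := funext hgh
      rw [e4, analyticOrderAt_mul e3 (hhan v hvU),
        e3.analyticOrderAt_eq_zero.2 (pow_ne_zero _ (sub_ne_zero.2 hvu)), zero_add]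
    have hih := ih h hhd hh0 (fun s hs => hZ s (Finset.mem_insert_of_mem hs))
      (fun s hs => by rw [← hord s hs]; exact htop s (Finset.mem_insert_of_mem hs))
    have hsph : ∀ s ∈ Metric.sphere c r, h s ≠ 0 := by
      intro s hs h1
      have h2 := hZ s (Finset.mem_insert_of_mem
        ((hh0 s (Metric.sphere_subset_closedBall hs)).1 h1))
      exact absurd (Metric.mem_sphere.1 hs) (Metric.mem_ball.1 h2).ne
    have hsu : ∀ s ∈ Metric.sphere c r, s - u ≠ 0 := by
      intro s hs h1
      rw [sub_eq_zero.1 h1] at hs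
      exact absurd (Metric.mem_sphere.1 hs) (Metric.mem_ball.1 huB).ne
    have hlog : EqOn (fun s => deriv g s / g s)
        (fun s => (n:ℂ) * (s - u)⁻¹ + deriv h s / h s) (Metric.sphere c r) := by
      intro s hs
      have hsU := hcU (Metric.sphere_subset_closedBall hs)
      have h1 : HasDerivAt g (n * (s - u) ^ (n - 1) * h s + (s - u) ^ n * deriv h s) s := by
        have e5 := (((hasDerivAt_id s).sub_const u).pow n).mul
          (hhd.differentiableAt (hU.mem_nhds hsU)).hasDerivAt
        simp only [id, mul_one] at e5
        exact e5.congr_of_eventuallyEq (Eventually.of_forall hgh)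
      simp only
      rw [h1.deriv, hgh s]
      have h2 := hsu s hs
      have h3 := hsph s hs
      have h4 : (s - u) ^ n = (s - u) ^ (n - 1) * (s - u) := by
        rw [← pow_succ, Nat.sub_one_add_one hn0]
      rw [h4]
      field_simp
    have hi1 : CircleIntegrable (fun s => (n:ℂ) * (s - u)⁻¹) c r := by
      refine ContinuousOn.circleIntegrable hr.le ?_
      exact continuousOn_const.mul ((continuousOn_id.sub continuousOn_const).inv₀ hsu)
    have hi2 : CircleIntegrable (fun s => deriv h s / h s) c r :=
      (continuousOn_logDeriv_sphere hU hcU hhd hsph).circleIntegrable hr.le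
    have hsum : ∑ s ∈ Z, analyticOrderNatAt g s = ∑ s ∈ Z, analyticOrderNatAt h s :=
      Finset.sum_congr rfl fun s hs => by simp only [analyticOrderNatAt, hord s hs]
    rw [circleIntegral.integral_congr hr.le hlog, circleIntegral.integral_add hi1 hi2, hih,
      circleIntegral.integral_const_mul, circleIntegral.integral_sub_inv_of_mem_ball huB,
      Finset.sum_insert huZ, Nat.cast_add, hsum, ← hn]
    ring

lemma continuousAt_circleIntegral_line {V : Type*} [NormedAddCommGroup V] [NormedSpace ℂ V]
    {φ : V → ℂ} {O : Set V} (hO : IsOpen O) (hφ : ContinuousOn φ O) {b z₀ : V} {c : ℂ} {r : ℝ}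
    (hr : 0 ≤ r) (h : ∀ s ∈ Metric.sphere c r, z₀ + s • b ∈ O) :
    ContinuousAt (fun z => ∮ s in C(c, r), φ (z + s • b)) z₀ := by
  have hU : ∀ᶠ z in 𝓝 z₀, ∀ s ∈ Metric.sphere c r, z + s • b ∈ O := by
    refine (isCompact_sphere c r).eventually_forall_of_forall_eventually fun s hs => ?_
    have hc : Continuous fun x : V × ℂ => x.1 + x.2 • b := by fun_prop
    exact hc.continuousAt.eventually_mem (hO.mem_nhds (h s hs))
  obtain ⟨N, hN, hNo, hzN⟩ := eventually_nhds_iff.1 hU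
  rw [← continuousWithinAt_iff_continuousAt (hNo.mem_nhds hzN)]
  refine ContinuousOn.continuousWithinAt ?_ hzN
  rw [continuousOn_iff_continuous_domRestrict]
  refine intervalIntegral.continuous_parametric_intervalIntegral_of_continuous'
    (f := fun (z : N) θ => deriv (circleMap c r) θ • φ (z + circleMap c r θ • b)) ?_ 0 (2 * Real.pi)
  have h1 : Continuous fun x : N × ℝ => φ (x.1 + circleMap c r x.2 • b) := by
    refine hφ.comp_continuous ?_ fun x => hN _ x.1.2 _ (circleMap_mem_sphere c hr _)
    have := continuous_circleMap c r
    fun_prop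
  have h2 : Continuous fun x : N × ℝ => deriv (circleMap c r) x.2 := by
    simp only [deriv_circleMap]
    have := continuous_circleMap 0 r
    fun_prop
  exact h2.smul h1

end ArgumentPrinciple

section MultisetContinuity

open Filter Topology

variable {X : Type*} [TopologicalSpace X]

/-- Continuity at a point of a multiset-valued map. -/
def MultisetContinuousAt (D : X → Multiset ℂ) (x₀ : X) : Prop :=
  ∀ ε > 0, ∀ᶠ x in 𝓝 x₀, Multiset.Rel (fun t t' => dist t t' < ε) (D x) (D x₀)

lemma MultisetContinuousAt.eventually_card_eq {D : X → Multiset ℂ} {x₀ : X}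
    (h : MultisetContinuousAt D x₀) :
    ∀ᶠ x in 𝓝 x₀, Multiset.card (D x) = Multiset.card (D x₀) := by
  filter_upwards [h 1 one_pos] with x hx using Multiset.card_eq_card_of_rel hx

lemma exists_forall_rel_prod_dist_lt (k : X → ℂ → ℂ) (x₀ : X) (A : Set (X × ℂ))
    (s₀ : Multiset ℂ) :
    (∀ t ∈ s₀, ContinuousWithinAt (fun y : X × ℂ => k y.1 y.2) A (x₀, t)) → ∀ ε > 0, ∃ δ > 0,
    ∀ᶠ x in 𝓝 x₀, ∀ s : Multiset ℂ, (∀ t ∈ s, (x, t) ∈ A) →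
      Multiset.Rel (fun t t' => dist t t' < δ) s s₀ →
      dist (s.map (k x)).prod (s₀.map (k x₀)).prod < ε := by
  induction s₀ using Multiset.induction_on with
  | empty =>
    intro _ ε hε
    refine ⟨1, one_pos, Eventually.of_forall fun x s _ hs => ?_⟩
    rw [Multiset.rel_zero_right] at hs
    simpa [hs] using hε
  | cons t s₀ ih =>
    intro hk ε hε
    have hmul : ContinuousAt (fun y : ℂ × ℂ => y.1 * y.2) (k x₀ t, (s₀.map (k x₀)).prod) :=
      continuous_mul.continuousAt
    obtain ⟨ε', hε', hmul'⟩ := Metric.continuousAt_iff.1 hmul ε hε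
    obtain ⟨δ₁, hδ₁, h1⟩ := ih (fun u hu => hk u (Multiset.mem_cons_of_mem hu)) ε' hε'
    have hkt := (hk t (Multiset.mem_cons_self t s₀)).eventually (Metric.ball_mem_nhds _ hε')
    rw [eventually_nhdsWithin_iff, nhds_prod_eq] at hkt
    obtain ⟨pa, hpa, pb, hpb, hab⟩ := eventually_prod_iff.1 hkt
    obtain ⟨δ₂, hδ₂, h2⟩ := Metric.eventually_nhds_iff.1 hpb
    refine ⟨min δ₁ δ₂, lt_min hδ₁ hδ₂, ?_⟩
    filter_upwards [h1, hpa] with x hx hxa s hsA hs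
    obtain ⟨t', s', ht', hs', rfl⟩ := Multiset.rel_cons_right.1 hs
    have e1 := hx s' (fun u hu => hsA u (Multiset.mem_cons_of_mem hu)) (hs'.mono fun a _ b _ hd => hd.trans_le (min_le_left _ _))
    have e2 : dist (k x t') (k x₀ t) < ε' := hab hxa (h2 (ht'.trans_le (min_le_right _ _)))
      (hsA t' (Multiset.mem_cons_self t' s'))
    rw [Multiset.map_cons, Multiset.prod_cons, Multiset.map_cons, Multiset.prod_cons]
    exact @hmul' (k x t', (s'.map (k x)).prod) (max_lt e2 e1)

lemma MultisetContinuousAt.prod_map {D : X → Multiset ℂ} {x₀ : X}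
    (h : MultisetContinuousAt D x₀) {k : X → ℂ → ℂ}
    (hk : ∀ t ∈ D x₀,
      ContinuousWithinAt (fun y : X × ℂ => k y.1 y.2) {y | y.2 ∈ D y.1} (x₀, t)) :
    ContinuousAt (fun x => ((D x).map (k x)).prod) x₀ := by
  refine Metric.tendsto_nhds.2 fun ε hε => ?_
  obtain ⟨δ, hδ, h1⟩ := exists_forall_rel_prod_dist_lt k x₀ _ (D x₀) hk ε hε
  filter_upwards [h1, h δ hδ] with x hx hx' using hx _ (fun _ ht => ht) hx'

end MultisetContinuity

section LineDivisor

open Filter Topology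

variable {V : Type*} [NormedAddCommGroup V] [NormedSpace ℂ V]

/-- The cone over a compact smooth complex hypersurface of projective space. -/
structure SmoothCone (L : Set V) : Prop where
  smul_mem : ∀ c : ℂ, c ≠ 0 → ∀ z ∈ L, c • z ∈ L
  ne_zero : ∀ z ∈ L, z ≠ 0
  closed : ∀ z, z ≠ 0 → z ∈ closure L → z ∈ L
  locEq : ∀ q ∈ L, ∃ W f, q ∈ W ∧ LocEq L W f

lemma SmoothCone.smul_mem_iff {L : Set V} (h : SmoothCone L) {c : ℂ} (hc : c ≠ 0) {z : V} :
    c • z ∈ L ↔ z ∈ L := by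
  refine ⟨fun hz => ?_, h.smul_mem c hc z⟩
  simpa [smul_smul, hc] using h.smul_mem c⁻¹ (inv_ne_zero hc) _ hz

lemma SmoothCone.exists_locEq {L : Set V} (h : SmoothCone L) {q : V} (hq : q ≠ 0) :
    ∃ W f, q ∈ W ∧ LocEq L W f := by
  by_cases hL : q ∈ L
  · exact h.locEq q hL
  · refine ⟨(closure L)ᶜ, fun _ => 1, fun hc => hL (h.closed q hq hc),
      isClosed_closure.isOpen_compl, differentiableOn_const _, ?_, ?_⟩
    · exact fun z hz hzL => absurd (subset_closure hzL) hz
    · exact fun z hz => iff_of_false (fun hzL => hz (subset_closure hzL)) one_ne_zero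

open Classical in
/-- The intersection multiplicity of `L` with the line `z + ℂ b` at `z + t b`. -/
def lineMult (L : Set V) (b z : V) (t : ℂ) : ℕ :=
  if h : ∃ f : V → ℂ, ∃ W, z + t • b ∈ W ∧ LocEq L W f then
    analyticOrderNatAt (fun s : ℂ => h.choose (z + s • b)) t else 0

lemma lineMult_eq [CompleteSpace V] {L W : Set V} {f : V → ℂ} (h : LocEq L W f) {b z : V} {t : ℂ}
    (ht : z + t • b ∈ W) :
    lineMult L b z t = analyticOrderNatAt (fun s : ℂ => f (z + s • b)) t := by
  have hex : ∃ f : V → ℂ, ∃ W, z + t • b ∈ W ∧ LocEq L W f := ⟨f, W, ht, h⟩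
  rw [lineMult, dif_pos hex]
  obtain ⟨W', ht', h'⟩ := hex.choose_spec
  rw [analyticOrderNatAt, analyticOrderNatAt, h'.analyticOrderAt_eq h ht' ht]

lemma SmoothCone.exists_norm_le {L : Set V} (h : SmoothCone L) {b : V} (hb : b ∉ L)
    (hb0 : b ≠ 0) : ∃ C > 0, ∀ z : V, ∀ t : ℂ, z + t • b ∈ L → ‖t‖ ≤ C * ‖z‖ := by
  have h1 : (closure L)ᶜ ∈ 𝓝 b :=
    isClosed_closure.isOpen_compl.mem_nhds fun hc => hb (h.closed b hb0 hc)
  obtain ⟨η, hη, hball⟩ := Metric.mem_nhds_iff.1 h1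
  refine ⟨η⁻¹, inv_pos.2 hη, fun z t ht => ?_⟩
  by_cases ht0 : t = 0
  · rw [ht0, norm_zero]; positivity
  have h2 : t⁻¹ • z + b ∈ L := by
    have := h.smul_mem t⁻¹ (inv_ne_zero ht0) _ ht
    rwa [smul_add, smul_smul, inv_mul_cancel₀ ht0, one_smul] at this
  have h3 : η ≤ ‖t⁻¹ • z‖ := by
    by_contra! hlt
    refine hball (show t⁻¹ • z + b ∈ Metric.ball b η from ?_) (subset_closure h2)
    rwa [Metric.mem_ball, dist_eq_norm, add_sub_cancel_right]
  rw [norm_smul, norm_inv, inv_mul_eq_div, le_div_iff₀ (norm_pos_iff.2 ht0)] at h3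
  rw [inv_mul_eq_div, le_div_iff₀ hη]
  linarith

lemma LocEq.eventually_line {L W : Set V} {f : V → ℂ} (h : LocEq L W f) {b z : V} {t : ℂ}
    (ht : z + t • b ∈ W) : ∀ᶠ s in 𝓝 t, z + s • b ∈ L ↔ f (z + s • b) = 0 := by
  have hc : Continuous fun s : ℂ => z + s • b := by fun_prop
  filter_upwards [hc.continuousAt.eventually_mem (h.isOpen.mem_nhds ht)] with s hs
    using h.mem_iff _ hs

lemma SmoothCone.eventually_or {L : Set V} (h : SmoothCone L) {b z : V}
    (hz : ∀ t : ℂ, z + t • b ≠ 0) (t : ℂ) :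
    (∀ᶠ s in 𝓝 t, z + s • b ∈ L) ∨ ∀ᶠ s in 𝓝[≠] t, z + s • b ∉ L := by
  obtain ⟨W, f, htW, hf⟩ := h.exists_locEq (hz t)
  rcases (hf.analyticAt htW).eventually_eq_zero_or_eventually_ne_zero with h1 | h1
  · left
    filter_upwards [h1, hf.eventually_line htW] with s h1 h2 using h2.2 h1
  · right
    filter_upwards [h1, mem_nhdsWithin_of_mem_nhds (hf.eventually_line htW)] with s h1 h2 h3
      using h1 (h2.1 h3)

lemma SmoothCone.not_eventually_mem {L : Set V} (h : SmoothCone L) {b z : V} (hb : b ∉ L)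
    (hb0 : b ≠ 0) (hz : ∀ t : ℂ, z + t • b ≠ 0) (t : ℂ) : ¬ ∀ᶠ s in 𝓝 t, z + s • b ∈ L := by
  intro ht
  set A : Set ℂ := interior {s | z + s • b ∈ L} with hA
  have hAc : IsClosed A := by
    refine isClosed_of_closure_subset fun u hu => ?_
    rcases h.eventually_or hz u with h1 | h1
    · exact mem_interior_iff_mem_nhds.2 h1
    · by_contra huA
      have h2 : ∀ᶠ s in 𝓝 u, s ∉ A := by
        rw [eventually_nhdsWithin_iff] at h1
        filter_upwards [h1] with s hs hsA
        by_cases hsu : s = u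
        · exact huA (hsu ▸ hsA)
        · exact hs hsu (interior_subset (s := {s | z + s • b ∈ L}) hsA)
      exact (mem_closure_iff_frequently.1 hu) h2
  have hAu : A = univ :=
    IsClopen.eq_univ ⟨hAc, isOpen_interior⟩ ⟨t, mem_interior_iff_mem_nhds.2 ht⟩
  obtain ⟨C, -, hC⟩ := h.exists_norm_le hb hb0
  have h3 : ((C * ‖z‖ + 1 : ℝ) : ℂ) ∈ A := hAu ▸ mem_univ _
  have h4 := hC z _ (interior_subset (s := {s | z + s • b ∈ L}) h3)
  rw [Complex.norm_real] at h4
  have := le_abs_self (C * ‖z‖ + 1)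
  rw [Real.norm_eq_abs] at h4
  linarith

lemma SmoothCone.finite_line {L : Set V} (h : SmoothCone L) {b z : V} (hb : b ∉ L)
    (hb0 : b ≠ 0) (hz : ∀ t : ℂ, z + t • b ≠ 0) : {t : ℂ | z + t • b ∈ L}.Finite := by
  by_contra hinf
  obtain ⟨C, -, hC⟩ := h.exists_norm_le hb hb0
  obtain ⟨t, -, ht⟩ := Set.Infinite.exists_accPt_of_subset_isCompact hinf
    (isCompact_closedBall (0:ℂ) (C * ‖z‖)) fun t ht => by simpa using hC z t ht
  rcases h.eventually_or hz t with h1 | h1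
  · exact h.not_eventually_mem hb hb0 hz t h1
  · exact (accPt_iff_frequently_nhdsNE.1 ht) h1

lemma SmoothCone.analyticOrderAt_ne_top {L W : Set V} {f : V → ℂ} (h : SmoothCone L)
    (hf : LocEq L W f) {b z : V} (hb : b ∉ L) (hb0 : b ≠ 0) (hz : ∀ t : ℂ, z + t • b ≠ 0) {t : ℂ}
    (ht : z + t • b ∈ W) : analyticOrderAt (fun s : ℂ => f (z + s • b)) t ≠ ⊤ := by
  intro htop
  rw [analyticOrderAt_eq_top] at htop
  refine h.not_eventually_mem hb hb0 hz t ?_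
  filter_upwards [htop, hf.eventually_line ht] with s h1 h2 using h2.2 h1

lemma SmoothCone.lineMult_ne_zero_iff [CompleteSpace V] {L : Set V} (h : SmoothCone L) {b z : V}
    (hb : b ∉ L) (hb0 : b ≠ 0) (hz : ∀ t : ℂ, z + t • b ≠ 0) (t : ℂ) :
    lineMult L b z t ≠ 0 ↔ z + t • b ∈ L := by
  obtain ⟨W, f, htW, hf⟩ := h.exists_locEq (hz t)
  have h1 := Nat.cast_analyticOrderNatAt (h.analyticOrderAt_ne_top hf hb hb0 hz htW)
  rw [lineMult_eq hf htW, hf.mem_iff _ htW, ← (hf.analyticAt htW).analyticOrderAt_ne_zero, ← h1]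
  exact Nat.cast_ne_zero.symm

lemma SmoothCone.lineMult_smul [CompleteSpace V] {L : Set V} (h : SmoothCone L) {b z : V}
    (hz : ∀ t : ℂ, z + t • b ≠ 0) {c : ℂ} (hc : c ≠ 0) (t : ℂ) :
    lineMult L b (c • z) (c * t) = lineMult L b z t := by
  obtain ⟨W, f, htW, hf⟩ := h.exists_locEq (hz t)
  have e1 : ∀ s : ℂ, c⁻¹ • (c • z + s • b) = z + (c⁻¹ * s) • b := fun s => by
    rw [smul_add, smul_smul, inv_mul_cancel₀ hc, one_smul, smul_smul]
  have e2 : c⁻¹ * (c * t) = t := by rw [← mul_assoc, inv_mul_cancel₀ hc, one_mul]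
  have hm : c⁻¹ • (c • z + (c * t) • b) ∈ W := by rwa [e1, e2]
  rw [lineMult_eq (hf.smul h.smul_mem hc) hm, lineMult_eq hf htW]
  simp only [e1]
  have e3 : AnalyticAt ℂ (fun s : ℂ => c⁻¹ * s) (c * t) := by fun_prop
  have e4 := analyticOrderAt_comp_of_deriv_ne_zero (f := fun s : ℂ => f (z + s • b)) e3
    (by simp [hc])
  rw [e2] at e4
  rw [analyticOrderNatAt, analyticOrderNatAt, ← e4]
  rfl

open Classical in
/-- The intersection of `L` with the line `z + ℂ b`, counted with multiplicities. -/
def lineDivisor (L : Set V) (b z : V) : Multiset ℂ :=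
  if h : {t : ℂ | z + t • b ∈ L}.Finite then
    ∑ t ∈ h.toFinset, Multiset.replicate (lineMult L b z t) t else 0

lemma SmoothCone.count_lineDivisor [CompleteSpace V] {L : Set V} (h : SmoothCone L) {b z : V}
    (hb : b ∉ L) (hb0 : b ≠ 0) (hz : ∀ t : ℂ, z + t • b ≠ 0) (t : ℂ) :
    (lineDivisor L b z).count t = lineMult L b z t := by
  have hfin := h.finite_line hb hb0 hz
  rw [lineDivisor, dif_pos hfin, Multiset.count_sum']
  simp only [Multiset.count_replicate]
  rw [Finset.sum_ite_eq' hfin.toFinset t, ite_eq_left_iff, hfin.mem_toFinset]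
  intro ht
  exact (not_not.1 fun h0 => ht ((h.lineMult_ne_zero_iff hb hb0 hz t).1 (Ne.symm h0).symm)).symm

lemma SmoothCone.mem_lineDivisor [CompleteSpace V] {L : Set V} (h : SmoothCone L) {b z : V}
    (hb : b ∉ L) (hb0 : b ≠ 0) (hz : ∀ t : ℂ, z + t • b ≠ 0) (t : ℂ) :
    t ∈ lineDivisor L b z ↔ z + t • b ∈ L := by
  rw [← h.lineMult_ne_zero_iff hb hb0 hz, ← h.count_lineDivisor hb hb0 hz,
    Multiset.count_ne_zero]

lemma smul_line_ne_zero {b z : V} (hz : ∀ t : ℂ, z + t • b ≠ 0) {c : ℂ} (hc : c ≠ 0) (t : ℂ) :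
    c • z + t • b ≠ 0 := by
  have : c • z + t • b = c • (z + (c⁻¹ * t) • b) := by
    rw [smul_add, smul_smul, ← mul_assoc, mul_inv_cancel₀ hc, one_mul]
  rw [this]
  exact smul_ne_zero hc (hz _)

lemma SmoothCone.lineDivisor_smul [CompleteSpace V] {L : Set V} (h : SmoothCone L) {b z : V}
    (hb : b ∉ L) (hb0 : b ≠ 0) (hz : ∀ t : ℂ, z + t • b ≠ 0) {c : ℂ} (hc : c ≠ 0) :
    lineDivisor L b (c • z) = (lineDivisor L b z).map (c * ·) := by
  ext t
  have e : t = c * (c⁻¹ * t) := by rw [← mul_assoc, mul_inv_cancel₀ hc, one_mul]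
  rw [e, Multiset.count_map_eq_count' _ _ (mul_right_injective₀ hc),
    h.count_lineDivisor hb hb0 (smul_line_ne_zero hz hc), h.count_lineDivisor hb hb0 hz,
    h.lineMult_smul hz hc]

end LineDivisor

section LineDivisorContinuity

open Filter Topology

open Classical in
lemma rel_dist_of_card_filter_eq {s s₀ : Multiset ℂ} {δ : ℝ}
    (hsep : ∀ t ∈ s₀, ∀ u ∈ s₀, t ≠ u → 2 * δ < dist t u)
    (hs : ∀ x ∈ s, ∃ t ∈ s₀, x ∈ Metric.ball t δ) (hδ : 0 < δ)
    (hcard : ∀ t ∈ s₀, Multiset.card (s.filter (· ∈ Metric.ball t δ)) =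
      Multiset.card (s₀.filter (· ∈ Metric.ball t δ))) :
    Multiset.Rel (fun t t' => dist t t' < δ) s s₀ := by
  choose! σ hσ hxσ using hs
  have hmap : s.map σ = s₀ := by
    ext t
    by_cases ht : t ∈ s₀
    · have e1 : s.filter (fun x => t = σ x) = s.filter (· ∈ Metric.ball t δ) := by
        refine Multiset.filter_congr fun x hx => ⟨fun h => h ▸ hxσ x hx, fun h => ?_⟩
        by_contra hne
        have h1 := hsep t ht (σ x) (hσ x hx) hne
        have h2 := dist_triangle_left t (σ x) x
        have h3 := Metric.mem_ball.1 h
        have h4 := Metric.mem_ball.1 (hxσ x hx)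
        linarith
      have e2 : s₀.filter (fun x => t = x) = s₀.filter (· ∈ Metric.ball t δ) := by
        refine Multiset.filter_congr fun x hx =>
          ⟨fun h => h ▸ Metric.mem_ball_self hδ, fun h => ?_⟩
        by_contra hne
        have h1 := hsep t ht x hx hne
        have h3 := Metric.mem_ball'.1 h
        linarith
      rw [Multiset.count_map, e1, hcard t ht, ← e2, Multiset.count_eq_card_filter_eq]
    · rw [Multiset.count_eq_zero_of_notMem ht, Multiset.count_eq_zero]
      intro hm
      obtain ⟨x, hx, rfl⟩ := Multiset.mem_map.1 hm
      exact ht (hσ x hx)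
  rw [← hmap, Multiset.rel_map_right]
  exact Multiset.rel_refl_of_refl_on fun x hx => Metric.mem_ball.1 (hxσ x hx)

variable {V : Type*} [NormedAddCommGroup V] [NormedSpace ℂ V]

lemma forall_add_smul_ne_zero_iff {b z : V} :
    (∀ t : ℂ, z + t • b ≠ 0) ↔ z ∉ Submodule.span ℂ {b} := by
  rw [Submodule.mem_span_singleton, not_exists]
  refine ⟨fun h t ht => h (-t) (by rw [← ht]; simp), fun h t ht => h (-t) ?_⟩
  rw [neg_smul, eq_comm, ← add_eq_zero_iff_eq_neg, ht]

lemma isOpen_forall_add_smul_ne_zero (b : V) : IsOpen {z : V | ∀ t : ℂ, z + t • b ≠ 0} := by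
  have e : {z : V | ∀ t : ℂ, z + t • b ≠ 0} = ((Submodule.span ℂ {b} : Submodule ℂ V) : Set V)ᶜ :=
    Set.ext fun z => forall_add_smul_ne_zero_iff
  rw [e]
  exact (Submodule.closed_of_finiteDimensional _).isOpen_compl

lemma SmoothCone.isOpen_compl {L : Set V} (h : SmoothCone L) : IsOpen {z : V | z ≠ 0 ∧ z ∉ L} := by
  have e : {z : V | z ≠ 0 ∧ z ∉ L} = {0}ᶜ ∩ (closure L)ᶜ :=
    Set.ext fun z => ⟨fun hz => ⟨hz.1, fun hc => hz.2 (h.closed z hz.1 hc)⟩,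
      fun hz => ⟨hz.1, fun hc => hz.2 (subset_closure hc)⟩⟩
  rw [e]
  exact isOpen_compl_singleton.inter isClosed_closure.isOpen_compl

lemma eventually_forall_line {b z₀ : V} {K : Set ℂ} (hK : IsCompact K) {O : Set V} (hO : IsOpen O)
    (h : ∀ s ∈ K, z₀ + s • b ∈ O) : ∀ᶠ z in 𝓝 z₀, ∀ s ∈ K, z + s • b ∈ O := by
  refine hK.eventually_forall_of_forall_eventually fun s hs => ?_
  have hc : Continuous fun x : V × ℂ => x.1 + x.2 • b := by fun_prop
  exact hc.continuousAt.eventually_mem (hO.mem_nhds (h s hs))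

open Classical in
lemma SmoothCone.circleIntegral_eq [CompleteSpace V] {L W : Set V} {f : V → ℂ} (h : SmoothCone L)
    (hf : LocEq L W f) {b z : V} (hb : b ∉ L) (hb0 : b ≠ 0) (hz : ∀ t : ℂ, z + t • b ≠ 0) {c : ℂ}
    {r : ℝ} (hr : 0 < r) (hW : ∀ s ∈ Metric.closedBall c r, z + s • b ∈ W)
    (hL : ∀ s ∈ Metric.sphere c r, z + s • b ∉ L) :
    (∮ s in C(c, r), fderiv ℂ f (z + s • b) b / f (z + s • b)) = 2 * Real.pi * I *
      (Multiset.card ((lineDivisor L b z).filter (· ∈ Metric.ball c r)) : ℂ) := by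
  have hc : Continuous fun s : ℂ => z + s • b := by fun_prop
  have hmem : ∀ s, s ∈ ((lineDivisor L b z).filter (· ∈ Metric.ball c r)).toFinset ↔
      z + s • b ∈ L ∧ s ∈ Metric.ball c r := fun s => by
    rw [Multiset.mem_toFinset, Multiset.mem_filter, h.mem_lineDivisor hb hb0 hz]
  have e1 := circleIntegral_logDeriv_eq hr (hf.isOpen.preimage hc) hW
    ((lineDivisor L b z).filter (· ∈ Metric.ball c r)).toFinset (fun s => f (z + s • b))
    (hf.diff.comp (by fun_prop) fun s hs => hs)
    (fun s hs => by
      rw [← hf.mem_iff _ (hW s hs), hmem, iff_self_and]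
      intro hsL
      rcases (Metric.mem_closedBall.1 hs).lt_or_eq with h1 | h1
      · exact Metric.mem_ball.2 h1
      · exact absurd hsL (hL s (Metric.mem_sphere.2 h1)))
    (fun s hs => ((hmem s).1 hs).2)
    (fun s hs => h.analyticOrderAt_ne_top hf hb hb0 hz
      (hW s (Metric.ball_subset_closedBall ((hmem s).1 hs).2)))
  have e2 : ∑ s ∈ ((lineDivisor L b z).filter (· ∈ Metric.ball c r)).toFinset,
      analyticOrderNatAt (fun s : ℂ => f (z + s • b)) s =
      Multiset.card ((lineDivisor L b z).filter (· ∈ Metric.ball c r)) := by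
    rw [← Multiset.toFinset_sum_count_eq]
    refine Finset.sum_congr rfl fun s hs => ?_
    have hsB := ((hmem s).1 hs).2
    rw [Multiset.count_filter_of_pos hsB, h.count_lineDivisor hb hb0 hz,
      lineMult_eq hf (hW s (Metric.ball_subset_closedBall hsB))]
  rw [← e2, ← e1]
  refine circleIntegral.integral_congr hr.le fun s hs => ?_
  have hsW := hW s (Metric.sphere_subset_closedBall hs)
  have h1 : HasDerivAt (fun s : ℂ => z + s • b) b s := by
    simpa using ((hasDerivAt_id s).smul_const b).const_add z
  have h2 := (hf.diff.differentiableAt (hf.isOpen.mem_nhds hsW)).hasFDerivAt.comp_hasDerivAt s h1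
  rw [← h2.deriv]
  rfl

open Classical in
lemma SmoothCone.eventually_card_filter_eq [CompleteSpace V] {L W : Set V} {f : V → ℂ}
    (h : SmoothCone L) (hf : LocEq L W f) {b z₀ : V} (hb : b ∉ L) (hb0 : b ≠ 0)
    (hz : ∀ t : ℂ, z₀ + t • b ≠ 0) {c : ℂ} {r : ℝ} (hr : 0 < r)
    (hW : ∀ s ∈ Metric.closedBall c r, z₀ + s • b ∈ W)
    (hL : ∀ s ∈ Metric.sphere c r, z₀ + s • b ∉ L) :
    ∀ᶠ z in 𝓝 z₀, Multiset.card ((lineDivisor L b z).filter (· ∈ Metric.ball c r)) =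
      Multiset.card ((lineDivisor L b z₀).filter (· ∈ Metric.ball c r)) := by
  set N : V → ℕ := fun z => Multiset.card ((lineDivisor L b z).filter (· ∈ Metric.ball c r))
  have hI : ∀ᶠ z in 𝓝 z₀, (∮ s in C(c, r), fderiv ℂ f (z + s • b) b / f (z + s • b)) =
      2 * Real.pi * I * (N z : ℂ) := by
    filter_upwards [(isOpen_forall_add_smul_ne_zero b).mem_nhds hz,
      eventually_forall_line (isCompact_closedBall c r) hf.isOpen hW,
      eventually_forall_line (isCompact_sphere c r) h.isOpen_compl fun s hs => ⟨hz s, hL s hs⟩]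
      with z h1 h2 h3
    exact h.circleIntegral_eq hf hb hb0 h1 hr h2 fun s hs => (h3 s hs).2
  have hO : IsOpen (W ∩ f ⁻¹' {0}ᶜ) :=
    hf.diff.continuousOn.isOpen_inter_preimage hf.isOpen isOpen_compl_singleton
  have hφ : ContinuousOn (fun x => fderiv ℂ f x b / f x) (W ∩ f ⁻¹' {0}ᶜ) := by
    intro x hx
    refine ContinuousAt.continuousWithinAt (ContinuousAt.div ?_ ?_ hx.2)
    · exact (hf.diff.continuousAt_fderiv_complex hf.isOpen hx.1).clm_apply continuousAt_const
    · exact (hf.diff.differentiableAt (hf.isOpen.mem_nhds hx.1)).continuousAt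
  have hcont := continuousAt_circleIntegral_line hO hφ (b := b) (z₀ := z₀) hr.le fun s hs => by
    have hsW := hW s (Metric.sphere_subset_closedBall hs)
    exact ⟨hsW, fun h0 => hL s hs ((hf.mem_iff _ hsW).2 h0)⟩
  have hN : Tendsto (fun z => (2 * Real.pi * I)⁻¹ * (2 * Real.pi * I * (N z : ℂ))) (𝓝 z₀)
      (𝓝 ((2 * Real.pi * I)⁻¹ * (2 * Real.pi * I * (N z₀ : ℂ)))) := by
    refine Tendsto.const_mul _ ?_
    have := hcont.tendsto.congr' hI
    rwa [hI.self_of_nhds] at this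
  have hpi : (2 * Real.pi * I : ℂ) ≠ 0 := two_pi_I_ne_zero
  simp only [inv_mul_cancel_left₀ hpi] at hN
  filter_upwards [Metric.tendsto_nhds.1 hN 1 one_pos] with z hz1
  have e : ((N z : ℂ) - (N z₀ : ℂ)) = (((N z : ℤ) - (N z₀ : ℤ) : ℤ) : ℂ) := by push_cast; rfl
  rw [dist_eq_norm, e, Complex.norm_intCast,
    ← Int.cast_abs, ← Int.cast_one, Int.cast_lt, Int.abs_lt_one_iff] at hz1
  exact_mod_cast sub_eq_zero.1 hz1

lemma SmoothCone.multisetContinuousAt [CompleteSpace V] {L : Set V} (h : SmoothCone L) {b z₀ : V}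
    (hb : b ∉ L) (hb0 : b ≠ 0) (hz : ∀ t : ℂ, z₀ + t • b ≠ 0) :
    MultisetContinuousAt (lineDivisor L b) z₀ := by
  classical
  intro ε hε
  set D₀ := lineDivisor L b z₀ with hD₀
  have hmem₀ : ∀ t, t ∈ D₀ ↔ z₀ + t • b ∈ L := h.mem_lineDivisor hb hb0 hz
  have hline : Continuous fun s : ℂ => z₀ + s • b := by fun_prop
  have hpos : ∀ᶠ δ : ℝ in 𝓝[>] 0, 0 < δ := self_mem_nhdsWithin
  have hlt : ∀ {a : ℝ}, 0 < a → ∀ᶠ δ : ℝ in 𝓝[>] 0, δ < a := fun ha =>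
    mem_nhdsWithin_of_mem_nhds (Iio_mem_nhds ha)
  have hδW : ∀ᶠ δ : ℝ in 𝓝[>] 0, ∀ t ∈ D₀.toFinset, ∃ W f, LocEq L W f ∧
      ∀ s ∈ Metric.closedBall t δ, z₀ + s • b ∈ W := by
    refine (Filter.eventually_all_finset _).2 fun t _ => ?_
    obtain ⟨W, f, htW, hf⟩ := h.exists_locEq (hz t)
    obtain ⟨a, ha, hball⟩ := Metric.mem_nhds_iff.1
      (hline.continuousAt.preimage_mem_nhds (hf.isOpen.mem_nhds htW))
    filter_upwards [hlt ha] with δ hδ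
    exact ⟨W, f, hf, fun s hs => hball (Metric.closedBall_subset_ball hδ hs)⟩
  have hδsep : ∀ᶠ δ : ℝ in 𝓝[>] 0, ∀ t ∈ D₀.toFinset, ∀ u ∈ D₀.toFinset, t ≠ u →
      2 * δ < dist t u := by
    refine (Filter.eventually_all_finset _).2 fun t _ => (Filter.eventually_all_finset _).2
      fun u _ => ?_
    by_cases htu : t = u
    · exact Eventually.of_forall fun _ hne => absurd htu hne
    · filter_upwards [hlt (half_pos (dist_pos.2 htu))] with δ hδ _
      linarith
  obtain ⟨δ, hδ0, hδε, hδW, hδsep⟩ := (hpos.and ((hlt hε).and (hδW.and hδsep))).exists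
  simp only [Multiset.mem_toFinset] at hδW hδsep
  have hcard : ∀ᶠ z in 𝓝 z₀, ∀ t ∈ D₀.toFinset,
      Multiset.card ((lineDivisor L b z).filter (· ∈ Metric.ball t δ)) =
      Multiset.card (D₀.filter (· ∈ Metric.ball t δ)) := by
    refine (Filter.eventually_all_finset _).2 fun t ht => ?_
    rw [Multiset.mem_toFinset] at ht
    obtain ⟨W, f, hf, hW⟩ := hδW t ht
    refine h.eventually_card_filter_eq hf hb hb0 hz hδ0 hW fun s hs hsL => ?_
    rw [Metric.mem_sphere'] at hs
    have hne : t ≠ s := fun h => by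
      rw [h, dist_self] at hs
      exact hδ0.ne hs
    have := hδsep t ht s ((hmem₀ s).2 hsL) hne
    linarith
  obtain ⟨C, hC0, hC⟩ := h.exists_norm_le hb hb0
  set K : Set ℂ := Metric.closedBall 0 (C * (‖z₀‖ + 1)) \ ⋃ t ∈ {t | t ∈ D₀}, Metric.ball t δ
    with hK
  have hKc : IsCompact K := (isCompact_closedBall _ _).diff
    (isOpen_biUnion fun t _ => Metric.isOpen_ball)
  have havoid : ∀ᶠ z in 𝓝 z₀, ∀ s ∈ K, z + s • b ∈ {z : V | z ≠ 0 ∧ z ∉ L} := by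
    refine eventually_forall_line hKc h.isOpen_compl fun s hs => ⟨hz s, fun hsL => hs.2 ?_⟩
    exact mem_biUnion ((hmem₀ s).2 hsL) (Metric.mem_ball_self hδ0)
  have hnorm : ∀ᶠ z in 𝓝 z₀, ‖z‖ < ‖z₀‖ + 1 :=
    continuous_norm.continuousAt.eventually_lt_const (by linarith)
  filter_upwards [hcard, havoid, hnorm, (isOpen_forall_add_smul_ne_zero b).mem_nhds hz]
    with z h1 h2 h3 h4
  simp only [Multiset.mem_toFinset] at h1
  refine (rel_dist_of_card_filter_eq hδsep (fun x hx => ?_) hδ0 h1).mono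
    fun a _ b _ hd => hd.trans hδε
  have hxL := (h.mem_lineDivisor hb hb0 h4 x).1 hx
  by_contra hcon
  push Not at hcon
  refine (h2 x ⟨?_, fun hm => ?_⟩).2 hxL
  · rw [mem_closedBall_zero_iff]
    exact (hC z x hxL).trans (mul_le_mul_of_nonneg_left h3.le hC0.le)
  · obtain ⟨t, ht, htx⟩ := mem_iUnion₂.1 hm
    exact hcon t ht htx

end LineDivisorContinuity

section Winding

open Filter Topology

lemma eq_zero_of_continuous_extension {g : ℂ → ℂ} (hg : Continuous g) (h0 : ∀ x, g x ≠ 0) {k : ℕ}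
    (hk : ∀ x : ℂ, ‖x‖ = 1 → g x = x ^ k * g 1) : k = 0 := by
  have hsc : IsSimplyConnected (univ : Set ℂ) := by
    have := (convex_univ (𝕜 := ℝ) (E := ℂ)).contractibleSpace univ_nonempty
    exact SimplyConnectedSpace.ofContractible _
  obtain ⟨l, hl, hgl⟩ := exists_continuousOn_eqOn_exp_comp (X := ℂ) (U := univ) (g := g)
    hsc isOpen_univ hg.continuousOn
    (by rintro ⟨x, -, hx⟩; exact h0 x hx)
  have hexp : ∀ x, exp (l x) = g x := fun x => hgl (mem_univ x)
  have hlc : Continuous l := continuousOn_univ.1 hl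
  let u : ℝ → ℂ := fun θ => l (exp (θ * I)) - k * (θ * I) - l 1
  have hu : ∀ θ, ∃ n : ℤ, u θ = n * (2 * Real.pi * I) := by
    intro θ
    rw [← exp_eq_one_iff]
    have h1 := hk (exp (θ * I)) (norm_exp_ofReal_mul_I θ)
    simp only [u]
    rw [exp_sub, exp_sub, hexp, hexp, h1, exp_nat_mul]
    have h2 := exp_ne_zero (θ * I)
    have h3 := h0 1
    field_simp
  have huc : Continuous u := by
    have : Continuous fun θ : ℝ => exp (θ * I) := by fun_prop
    have := hlc.comp this
    simp only [Function.comp_def] at this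
    fun_prop
  let v : ℝ → ℝ := fun θ => (u θ).im
  have hvc : Continuous v := Complex.continuous_im.comp huc
  have hv0 : v 0 = 0 := by simp [v, u]
  have hv1 : v (2 * Real.pi) = -(k * (2 * Real.pi)) := by simp [v, u]
  by_contra hk0
  have hk1 : (1:ℝ) ≤ k := by exact_mod_cast Nat.one_le_iff_ne_zero.2 hk0
  have hpi := Real.pi_pos
  obtain ⟨θ, -, hθ⟩ := intermediate_value_Icc' (by positivity : (0:ℝ) ≤ 2 * Real.pi)
    hvc.continuousOn (show -Real.pi ∈ Icc (v (2 * Real.pi)) (v 0) by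
      rw [hv0, hv1]
      constructor <;> nlinarith)
  obtain ⟨n, hn⟩ := hu θ
  have h4 : v θ = n * (2 * Real.pi) := by simp [v, hn]
  rw [hθ] at h4
  have h5 : ((2 * n + 1 : ℤ) : ℝ) = 0 := by
    push_cast
    have : (2 * (n:ℝ) + 1) * Real.pi = 0 := by linarith
    exact (mul_eq_zero.1 this).resolve_right hpi.ne'
  have h6 : 2 * n + 1 = 0 := by exact_mod_cast h5
  omega

end Winding

section HomogeneousSections

lemma prod_map_pow_eq_pow_sum {α : Type*} (s : Multiset α) (x : ℂ) (e : α → ℕ) :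
    (s.map fun t => x ^ e t).prod = x ^ (s.map e).sum := by
  induction s using Multiset.induction_on with
  | empty => simp
  | cons t s ih => simp [ih, pow_add]

open Filter Topology

variable {V : Type*} [NormedAddCommGroup V] [NormedSpace ℂ V] [CompleteSpace V]

/-- The product of the intersection parameters of `L` with the line `z + ℂ b`: a section of a
line bundle on projective space, defined away from `b`, which vanishes exactly on `L`. -/
def lineProd (L : Set V) (b z : V) : ℂ := (lineDivisor L b z).prod

lemma SmoothCone.continuousAt_lineProd {L : Set V} (h : SmoothCone L) {b z : V} (hb : b ∉ L)
    (hb0 : b ≠ 0) (hz : ∀ t : ℂ, z + t • b ≠ 0) : ContinuousAt (lineProd L b) z := by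
  have := (h.multisetContinuousAt hb hb0 hz).prod_map (k := fun _ t => t)
    fun t _ => continuous_snd.continuousWithinAt
  simpa only [Multiset.map_id', ← lineProd.eq_def] using this

lemma SmoothCone.lineProd_eq_zero_iff {L : Set V} (h : SmoothCone L) {b z : V} (hb : b ∉ L)
    (hb0 : b ≠ 0) (hz : ∀ t : ℂ, z + t • b ≠ 0) : lineProd L b z = 0 ↔ z ∈ L := by
  rw [lineProd, Multiset.prod_eq_zero_iff, h.mem_lineDivisor hb hb0 hz, zero_smul, add_zero]

lemma SmoothCone.lineProd_smul {L : Set V} (h : SmoothCone L) {b z : V} (hb : b ∉ L)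
    (hb0 : b ≠ 0) (hz : ∀ t : ℂ, z + t • b ≠ 0) {c : ℂ} (hc : c ≠ 0) :
    lineProd L b (c • z) = c ^ Multiset.card (lineDivisor L b z) * lineProd L b z := by
  rw [lineProd, h.lineDivisor_smul hb hb0 hz hc, Multiset.prod_map_mul, Multiset.map_const',
    Multiset.prod_replicate, Multiset.map_id', lineProd]

/-- There is no nowhere vanishing section over `L` which is homogeneous of positive degree. -/
lemma SmoothCone.no_homogeneous_section {L : Set V} (h : SmoothCone L) {b p a : V} (hb : b ∉ L)
    (hb0 : b ≠ 0) (hp : p ∈ L)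
    (hind : ∀ x y t : ℂ, x • p + y • a + t • b = 0 → x = 0 ∧ y = 0)
    {Ψ : V → ℂ} (hΨc : ContinuousOn Ψ L) (hΨ0 : ∀ q ∈ L, Ψ q ≠ 0) {e : V → ℕ}
    (he : ∀ q ∈ L, e q ≠ 0) (hΨ : ∀ q ∈ L, ∀ c : ℂ, ‖c‖ = 1 → Ψ (c • q) = c ^ e q * Ψ q) :
    False := by
  let Φ : V → ℂ := fun z => ((lineDivisor L b z).map fun t => Ψ (z + t • b)).prod
  let γ : ℂ → V := fun x => x • p + ((1 - ‖x‖ : ℝ) : ℂ) • a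
  have hγ : ∀ x, ∀ t : ℂ, γ x + t • b ≠ 0 := by
    intro x t h0
    obtain ⟨hx, hx'⟩ := hind _ _ _ h0
    rw [hx, norm_zero] at hx'
    norm_num at hx'
  have hγc : Continuous γ := by
    have : Continuous fun x : ℂ => ((1 - ‖x‖ : ℝ) : ℂ) := by fun_prop
    fun_prop
  have hγ1 : ∀ x : ℂ, ‖x‖ = 1 → γ x = x • p := fun x hx => by simp [γ, hx]
  have hz1 : ∀ t : ℂ, p + t • b ≠ 0 := fun t => by simpa [γ] using hγ 1 t
  have hΦc : ∀ z, (∀ t : ℂ, z + t • b ≠ 0) → ContinuousAt Φ z := by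
    intro z hz
    refine (h.multisetContinuousAt hb hb0 hz).prod_map (k := fun z t => Ψ (z + t • b)) ?_
    intro t ht
    have ht' := (h.mem_lineDivisor hb hb0 hz t).1 ht
    have hline : Continuous fun y : V × ℂ => y.1 + y.2 • b := by fun_prop
    have h1 : ContinuousWithinAt (fun y : V × ℂ => Ψ (y.1 + y.2 • b))
        {y | y.1 + y.2 • b ∈ L} (z, t) :=
      ContinuousWithinAt.comp (t := L) (f := fun y : V × ℂ => y.1 + y.2 • b) (hΨc _ ht')
        hline.continuousWithinAt fun y hy => hy
    refine h1.mono_of_mem_nhdsWithin ?_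
    have h2 : {y : V × ℂ | ∀ t : ℂ, y.1 + t • b ≠ 0} ∈ 𝓝 (z, t) :=
      ((isOpen_forall_add_smul_ne_zero b).preimage continuous_fst).mem_nhds hz
    filter_upwards [mem_nhdsWithin_of_mem_nhds h2, self_mem_nhdsWithin] with y hy hy'
    exact (h.mem_lineDivisor hb hb0 hy _).1 hy'
  have hΦ0 : ∀ z, (∀ t : ℂ, z + t • b ≠ 0) → Φ z ≠ 0 := by
    intro z hz h0
    obtain ⟨t, ht, ht0⟩ := Multiset.mem_map.1 (Multiset.prod_eq_zero_iff.1 h0)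
    exact hΨ0 _ ((h.mem_lineDivisor hb hb0 hz t).1 ht) ht0
  set k : ℕ := ((lineDivisor L b p).map fun t => e (p + t • b)).sum with hk
  have hΦs : ∀ x : ℂ, ‖x‖ = 1 → Φ (x • p) = x ^ k * Φ p := by
    intro x hx
    have hx0 : x ≠ 0 := norm_ne_zero_iff.1 (by rw [hx]; exact one_ne_zero)
    simp only [Φ]
    rw [h.lineDivisor_smul hb hb0 hz1 hx0, Multiset.map_map, hk,
      ← prod_map_pow_eq_pow_sum, ← Multiset.prod_map_mul]
    refine congrArg Multiset.prod (Multiset.map_congr rfl fun t ht => ?_)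
    rw [← hΨ _ ((h.mem_lineDivisor hb hb0 hz1 t).1 ht) x hx, Function.comp_apply, smul_add,
      smul_smul]
  have hk0 := eq_zero_of_continuous_extension (g := fun x => Φ (γ x)) (k := k)
    (continuous_iff_continuousAt.2 fun x => (hΦc _ (hγ x)).comp hγc.continuousAt)
    (fun x => hΦ0 _ (hγ x)) fun x hx => by
      rw [hγ1 x hx, hγ1 1 (by simp), one_smul, hΦs x hx]
  have hmem : (0:ℂ) ∈ lineDivisor L b p :=
    (h.mem_lineDivisor hb hb0 hz1 0).2 (by simpa using hp)
  have h3 := Multiset.sum_eq_zero_iff.1 (hk.symm.trans hk0) _ (Multiset.mem_map_of_mem _ hmem)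
  exact he _ (by simpa using hp) h3

end HomogeneousSections

section UnitNormal

open Filter Topology

variable {m : ℕ}

/-- The gradient of a real linear form on `ℂᵐ`. -/
def realGrad (l : (Fin m → ℂ) →L[ℝ] ℝ) : Fin m → ℂ :=
  fun j => (l (Pi.single j 1) : ℂ) + (l (Pi.single j I) : ℂ) * I

lemma real_linear_single (l : (Fin m → ℂ) →L[ℝ] ℝ) (j : Fin m) (w : ℂ) :
    l (Pi.single j w) = w.re * l (Pi.single j 1) + w.im * l (Pi.single j I) := by
  have e : (Pi.single j w : Fin m → ℂ) =
      w.re • (Pi.single j 1 : Fin m → ℂ) + w.im • (Pi.single j I : Fin m → ℂ) := by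
    rw [← Pi.single_smul, ← Pi.single_smul, ← Pi.single_add]
    congr 1
    simp [Complex.re_add_im]
  rw [e, map_add, map_smul, map_smul, smul_eq_mul, smul_eq_mul]

lemma real_linear_apply (l : (Fin m → ℂ) →L[ℝ] ℝ) (v : Fin m → ℂ) :
    l v = ∑ j, ((v j).re * l (Pi.single j 1) + (v j).im * l (Pi.single j I)) := by
  conv_lhs => rw [← Finset.univ_sum_single v, map_sum]
  exact Finset.sum_congr rfl fun j _ => real_linear_single l j (v j)

lemma realGrad_ne_zero {l : (Fin m → ℂ) →L[ℝ] ℝ} (hl : l ≠ 0) : realGrad l ≠ 0 := by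
  intro h
  refine hl (ContinuousLinearMap.ext fun v => ?_)
  rw [real_linear_apply]
  refine Finset.sum_eq_zero fun j _ => ?_
  have h1 := congrFun h j
  have h2 := congrArg Complex.re h1
  have h3 := congrArg Complex.im h1
  simp only [realGrad, add_re, ofReal_re, mul_re, ofReal_im, I_re, I_im, mul_zero, mul_one,
    sub_zero, add_zero, add_im, mul_im, zero_add, Pi.zero_apply, zero_re, zero_im] at h2 h3
  rw [h2, h3, mul_zero, mul_zero, add_zero]

lemma apply_realGrad_pos {l : (Fin m → ℂ) →L[ℝ] ℝ} (hl : l ≠ 0) : 0 < l (realGrad l) := by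
  have h1 : l (realGrad l) = ∑ j, (l (Pi.single j 1) ^ 2 + l (Pi.single j I) ^ 2) := by
    rw [real_linear_apply]
    refine Finset.sum_congr rfl fun j _ => ?_
    simp only [realGrad, add_re, ofReal_re, mul_re, ofReal_im, I_re, I_im, mul_zero, mul_one,
      sub_zero, add_zero, add_im, mul_im, zero_add]
    ring
  rw [h1]
  refine Finset.sum_pos' (fun j _ => by positivity) ?_
  by_contra! hc
  refine realGrad_ne_zero hl (funext fun j => ?_)
  have h2 := hc j (Finset.mem_univ j)
  have h3 : l (Pi.single j 1) = 0 := by nlinarith [sq_nonneg (l (Pi.single j I))]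
  have h4 : l (Pi.single j I) = 0 := by nlinarith [sq_nonneg (l (Pi.single j 1))]
  simp [realGrad, h3, h4]

lemma realGrad_smul (l : (Fin m → ℂ) →L[ℝ] ℝ) (a : ℝ) : realGrad (a • l) = a • realGrad l := by
  ext j
  simp only [realGrad, smul_apply, smul_eq_mul, ofReal_mul, Pi.smul_apply,
    Complex.real_smul]
  ring

lemma realGrad_rotate {l l' : (Fin m → ℂ) →L[ℝ] ℝ} {c : ℂ} (hc : ‖c‖ = 1)
    (h : ∀ v, l' (c • v) = l v) : realGrad l' = c • realGrad l := by
  have hn : normSq c = 1 := by rw [normSq_eq_norm_sq, hc, one_pow]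
  have hc0 : c ≠ 0 := norm_ne_zero_iff.1 (by rw [hc]; exact one_ne_zero)
  have h1 : ∀ (j : Fin m) (w : ℂ), l' (Pi.single j w) = l (Pi.single j (c⁻¹ * w)) := by
    intro j w
    rw [← h, ← Pi.single_smul, smul_eq_mul, mul_inv_cancel_left₀ hc0]
  ext j
  simp only [realGrad, h1, Pi.smul_apply, smul_eq_mul]
  rw [real_linear_single l j (c⁻¹ * 1), real_linear_single l j (c⁻¹ * I)]
  apply Complex.ext <;> simp [Complex.inv_re, Complex.inv_im, hn] <;> ring

/-- The unit normal to the kernel of a real linear form. -/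
def unitNormal (l : (Fin m → ℂ) →L[ℝ] ℝ) : Fin m → ℂ := ‖realGrad l‖⁻¹ • realGrad l

lemma norm_unitNormal {l : (Fin m → ℂ) →L[ℝ] ℝ} (hl : l ≠ 0) : ‖unitNormal l‖ = 1 := by
  rw [unitNormal, norm_smul, norm_inv, norm_norm,
    inv_mul_cancel₀ (norm_ne_zero_iff.2 (realGrad_ne_zero hl))]

lemma apply_unitNormal_pos {l : (Fin m → ℂ) →L[ℝ] ℝ} (hl : l ≠ 0) : 0 < l (unitNormal l) := by
  rw [unitNormal, map_smul, smul_eq_mul]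
  exact mul_pos (inv_pos.2 (norm_pos_iff.2 (realGrad_ne_zero hl))) (apply_realGrad_pos hl)

lemma unitNormal_smul (l : (Fin m → ℂ) →L[ℝ] ℝ) {a : ℝ} (ha : a ≠ 0) :
    unitNormal (a • l) = unitNormal l ∨ unitNormal (a • l) = -unitNormal l := by
  have h1 : unitNormal (a • l) = (|a|⁻¹ * a) • unitNormal l := by
    rw [unitNormal, unitNormal, realGrad_smul, norm_smul, Real.norm_eq_abs, smul_smul, smul_smul,
      mul_inv]
    congr 1
    ring
  rcases ha.lt_or_gt with h | h
  · right
    rw [h1, abs_of_neg h, inv_neg, neg_mul, inv_mul_cancel₀ ha, neg_smul, one_smul]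
  · left
    rw [h1, abs_of_pos h, inv_mul_cancel₀ ha, one_smul]

lemma unitNormal_rotate {l l' : (Fin m → ℂ) →L[ℝ] ℝ} {c : ℂ} (hc : ‖c‖ = 1)
    (h : ∀ v, l' (c • v) = l v) : unitNormal l' = c • unitNormal l := by
  rw [unitNormal, unitNormal, realGrad_rotate hc h, norm_smul, hc, one_mul, smul_comm]

lemma continuousAt_unitNormal {X : Type*} [TopologicalSpace X] {T : X → (Fin m → ℂ) →L[ℝ] ℝ}
    {x : X} (hT : ContinuousAt T x) (h0 : T x ≠ 0) :
    ContinuousAt (fun y => unitNormal (T y)) x := by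
  have h1 : ∀ v, ContinuousAt (fun y => T y v) x := fun v => hT.clm_apply continuousAt_const
  have h2 : ContinuousAt (fun y => realGrad (T y)) x := by
    refine continuousAt_pi.2 fun j => ?_
    have h3 := continuous_ofReal.continuousAt.comp (h1 (Pi.single j 1))
    have h4 := continuous_ofReal.continuousAt.comp (h1 (Pi.single j I))
    exact h3.add (h4.mul continuousAt_const)
  exact (h2.norm.inv₀ (norm_ne_zero_iff.2 (realGrad_ne_zero h0))).smul h2

/-- `ρ` is a defining function of `M` on the open set `U`. -/
structure DefFn (M U : Set (Fin m → ℂ)) (ρ : (Fin m → ℂ) → ℝ) : Prop where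
  isOpen : IsOpen U
  contDiff : ContDiffOn ℝ 1 ρ U
  fderiv_ne : ∀ z ∈ U, fderiv ℝ ρ z ≠ 0
  mem_iff : ∀ z ∈ U, z ∈ M ↔ ρ z = 0

lemma DefFn.hasStrictFDerivAt {M U : Set (Fin m → ℂ)} {ρ : (Fin m → ℂ) → ℝ} (h : DefFn M U ρ)
    {z : Fin m → ℂ} (hz : z ∈ U) : HasStrictFDerivAt ρ (fderiv ℝ ρ z) z :=
  (h.contDiff.contDiffAt (h.isOpen.mem_nhds hz)).hasStrictFDerivAt one_ne_zero

lemma DefFn.continuousAt_normal {M U : Set (Fin m → ℂ)} {ρ : (Fin m → ℂ) → ℝ} (h : DefFn M U ρ)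
    {z : Fin m → ℂ} (hz : z ∈ U) : ContinuousAt (fun x => unitNormal (fderiv ℝ ρ x)) z :=
  continuousAt_unitNormal
    ((h.contDiff.continuousOn_fderiv_of_isOpen h.isOpen le_rfl).continuousAt
      (h.isOpen.mem_nhds hz)) (h.fderiv_ne z hz)

lemma DefFn.unitNormal_eq_or {M U U' : Set (Fin m → ℂ)} {ρ ρ' : (Fin m → ℂ) → ℝ}
    (h : DefFn M U ρ) (h' : DefFn M U' ρ') {z : Fin m → ℂ} (hz : z ∈ U) (hz' : z ∈ U')
    (hM : z ∈ M) : unitNormal (fderiv ℝ ρ' z) = unitNormal (fderiv ℝ ρ z) ∨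
      unitNormal (fderiv ℝ ρ' z) = -unitNormal (fderiv ℝ ρ z) := by
  have hext : IsLocalExtrOn ρ' {x | ρ x = ρ z} z := by
    left
    refine eventually_nhdsWithin_iff.2 ?_
    filter_upwards [h.isOpen.mem_nhds hz, h'.isOpen.mem_nhds hz'] with x hx hx' hxz
    have h1 : ρ x = 0 := (show ρ x = ρ z from hxz).trans ((h.mem_iff z hz).1 hM)
    rw [(h'.mem_iff z hz').1 hM, (h'.mem_iff x hx').1 ((h.mem_iff x hx).2 h1)]
  obtain ⟨a, b, hab, hl⟩ := hext.exists_multipliers_of_hasStrictFDerivAt_1d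
    (h.hasStrictFDerivAt hz) (h'.hasStrictFDerivAt hz')
  have hb : b ≠ 0 := by
    rintro rfl
    rw [zero_smul, add_zero] at hl
    refine hab (Prod.ext ((smul_eq_zero.1 hl).resolve_right (h.fderiv_ne z hz)) rfl)
  have ha : a ≠ 0 := by
    rintro rfl
    rw [zero_smul, zero_add] at hl
    exact hb ((smul_eq_zero.1 hl).resolve_right (h'.fderiv_ne z hz'))
  have e : fderiv ℝ ρ' z = (-(b⁻¹ * a)) • fderiv ℝ ρ z := by
    ext v
    have h1 : a * fderiv ℝ ρ z v + b * fderiv ℝ ρ' z v = 0 := congrArg (fun T => T v) hl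
    rw [smul_apply, smul_eq_mul]
    field_simp
    linarith
  rw [e]
  exact unitNormal_smul _ (neg_ne_zero.2 (mul_ne_zero (inv_ne_zero hb) ha))

lemma DefFn.smul {M U : Set (Fin m → ℂ)} {ρ : (Fin m → ℂ) → ℝ} (h : DefFn M U ρ)
    (hM : IsCone M) {c : ℂ} (hc : c ≠ 0) :
    DefFn M {z | c⁻¹ • z ∈ U} (fun z => ρ (c⁻¹ • z)) ∧ ∀ z ∈ U, ∀ v,
      fderiv ℝ (fun z => ρ (c⁻¹ • z)) (c • z) (c • v) = fderiv ℝ ρ z v := by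
  have hder : ∀ z, c⁻¹ • z ∈ U → ∀ v, fderiv ℝ (fun z => ρ (c⁻¹ • z)) z v =
      fderiv ℝ ρ (c⁻¹ • z) (c⁻¹ • v) := by
    intro z hz v
    have h1 := (h.hasStrictFDerivAt hz).hasFDerivAt.comp z
      ((hasFDerivAt_id (𝕜 := ℝ) z).const_smul c⁻¹)
    have h2 : fderiv ℝ (fun z => ρ (c⁻¹ • z)) z = _ := h1.fderiv
    rw [h2]
    rfl
  refine ⟨⟨h.isOpen.preimage (by fun_prop), h.contDiff.comp ?_ fun z hz => hz, ?_, ?_⟩, ?_⟩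
  · exact (contDiff_id.const_smul c⁻¹).contDiffOn
  · intro z hz h0
    refine h.fderiv_ne _ hz (ContinuousLinearMap.ext fun v => ?_)
    have h1 := hder z hz (c • v)
    rw [h0, smul_smul, inv_mul_cancel₀ hc, one_smul] at h1
    exact h1.symm
  · intro z hz
    rw [← h.mem_iff _ hz]
    refine ⟨fun hzM => hM _ (inv_ne_zero hc) z hzM, fun hzM => ?_⟩
    simpa [smul_smul, hc] using hM c hc _ hzM
  · intro z hz v
    have e : ∀ v : Fin m → ℂ, c⁻¹ • c • v = v := fun v => by
      rw [smul_smul, inv_mul_cancel₀ hc, one_smul]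
    rw [hder _ (by rwa [mem_ofPred_eq, e] : c • z ∈ {z | c⁻¹ • z ∈ U}), e, e]

open Classical in
/-- A unit normal to the hypersurface `M` at `z`, defined up to sign. -/
def hyperNormal (M : Set (Fin m → ℂ)) (z : Fin m → ℂ) : Fin m → ℂ :=
  if h : ∃ ρ : (Fin m → ℂ) → ℝ, ∃ U, z ∈ U ∧ DefFn M U ρ then
    unitNormal (fderiv ℝ h.choose z) else 0

lemma DefFn.hyperNormal_eq_or {M U : Set (Fin m → ℂ)} {ρ : (Fin m → ℂ) → ℝ} (h : DefFn M U ρ)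
    {z : Fin m → ℂ} (hz : z ∈ U) (hM : z ∈ M) : hyperNormal M z = unitNormal (fderiv ℝ ρ z) ∨
      hyperNormal M z = -unitNormal (fderiv ℝ ρ z) := by
  have hex : ∃ ρ : (Fin m → ℂ) → ℝ, ∃ U, z ∈ U ∧ DefFn M U ρ := ⟨ρ, U, hz, h⟩
  rw [hyperNormal, dif_pos hex]
  obtain ⟨U', hz', h'⟩ := hex.choose_spec
  exact h.unitNormal_eq_or h' hz hz' hM

lemma DefFn.hyperNormal_smul {M U : Set (Fin m → ℂ)} {ρ : (Fin m → ℂ) → ℝ} (h : DefFn M U ρ)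
    (hM : IsCone M) {z : Fin m → ℂ} (hz : z ∈ U) (hzM : z ∈ M) {c : ℂ} (hc : ‖c‖ = 1) :
    hyperNormal M (c • z) = c • hyperNormal M z ∨
      hyperNormal M (c • z) = -(c • hyperNormal M z) := by
  have hc0 : c ≠ 0 := norm_ne_zero_iff.1 (by rw [hc]; exact one_ne_zero)
  obtain ⟨h1, h2⟩ := h.smul hM hc0
  have hcz : c • z ∈ {z | c⁻¹ • z ∈ U} := by
    rwa [mem_ofPred_eq, smul_smul, inv_mul_cancel₀ hc0, one_smul]
  have h3 := h1.hyperNormal_eq_or hcz (hM c hc0 z hzM)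
  rw [unitNormal_rotate hc (h2 z hz)] at h3
  rcases h.hyperNormal_eq_or hz hzM with h4 | h4 <;> rw [h4]
  · exact h3
  · rw [smul_neg, neg_neg]
    exact h3.symm

/-- Points slightly displaced along the normal leave the hypersurface. -/
lemma DefFn.eventually_notMem {M U : Set (Fin m → ℂ)} {ρ : (Fin m → ℂ) → ℝ} (h : DefFn M U ρ)
    {z₀ : Fin m → ℂ} (hz : z₀ ∈ U) {O : Set (Fin m → ℂ)} (hO : O ∈ 𝓝 z₀) :
    ∀ᶠ y : ℝ × (Fin m → ℂ) in 𝓝 (0, z₀), y.2 ∈ M → y.1 ≠ 0 →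
      (y.2 + y.1 • hyperNormal M y.2 ∉ M ∧ y.2 + y.1 • hyperNormal M y.2 ∈ O) ∧
      (y.2 - y.1 • hyperNormal M y.2 ∉ M ∧ y.2 - y.1 • hyperNormal M y.2 ∈ O) := by
  set n : (Fin m → ℂ) → Fin m → ℂ := fun x => unitNormal (fderiv ℝ ρ x) with hn
  set l := fderiv ℝ ρ z₀ with hl
  have hnc : ContinuousAt n z₀ := h.continuousAt_normal hz
  have hpos : 0 < l (n z₀) := apply_unitNormal_pos (h.fderiv_ne z₀ hz)
  obtain ⟨A, hA, hbound⟩ : ∃ A ∈ 𝓝 z₀, ∀ x ∈ A, ∀ y ∈ A,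
      ‖ρ x - ρ y - l (x - y)‖ ≤ l (n z₀) / 4 * ‖x - y‖ := by
    have h1 := (h.hasStrictFDerivAt hz).isLittleO.bound (show 0 < l (n z₀) / 4 by linarith)
    rw [nhds_prod_eq] at h1
    obtain ⟨A, hA, hAA⟩ := eventually_prod_self_iff'.1 h1
    exact ⟨A, hA, fun x hx y hy => hAA x hx y hy⟩
  have hmove : ContinuousAt (fun y : ℝ × (Fin m → ℂ) => y.2 + y.1 • n y.2) (0, z₀) := by
    have h1 : ContinuousAt (fun y : ℝ × (Fin m → ℂ) => n y.2) (0, z₀) :=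
      ContinuousAt.comp (g := n) hnc continuous_snd.continuousAt
    exact continuous_snd.continuousAt.add (continuous_fst.continuousAt.smul h1)
  have key : ∀ᶠ y : ℝ × (Fin m → ℂ) in 𝓝 (0, z₀), y.2 ∈ M → y.1 ≠ 0 →
      y.2 + y.1 • n y.2 ∉ M ∧ y.2 + y.1 • n y.2 ∈ O := by
    have hnear : ∀ S ∈ 𝓝 z₀, ∀ᶠ y : ℝ × (Fin m → ℂ) in 𝓝 (0, z₀), y.2 + y.1 • n y.2 ∈ S := by
      intro S hS
      refine hmove.eventually_mem ?_
      simpa using hS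
    have hsnd : ∀ S ∈ 𝓝 z₀, ∀ᶠ y : ℝ × (Fin m → ℂ) in 𝓝 (0, z₀), y.2 ∈ S := fun S hS =>
      continuous_snd.continuousAt.eventually_mem hS
    have hln : {x | l (n z₀) / 2 < l (n x)} ∈ 𝓝 z₀ :=
      (l.continuous.continuousAt.comp hnc).eventually_const_lt (by simpa using by linarith)
    filter_upwards [hnear O hO, hnear A hA, hnear U (h.isOpen.mem_nhds hz), hsnd A hA,
      hsnd U (h.isOpen.mem_nhds hz), hsnd _ hln] with y h1 h2 h3 h4 h5 h6 hyM hy0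
    refine ⟨fun hc => ?_, h1⟩
    have h7 := hbound _ h2 _ h4
    rw [(h.mem_iff _ h3).1 hc, (h.mem_iff _ h5).1 hyM, add_sub_cancel_left, norm_smul,
      norm_unitNormal (h.fderiv_ne _ h5), map_smul, sub_self, zero_sub, norm_neg, smul_eq_mul,
      norm_mul, mul_one, Real.norm_eq_abs (l _)] at h7
    have h8 : 0 < ‖y.1‖ := norm_pos_iff.2 hy0
    have h9 : |l (n y.2)| ≤ l (n z₀) / 4 := by
      refine le_of_mul_le_mul_left ?_ h8
      linarith
    have h10 := le_abs_self (l (n y.2))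
    have h11 : l (n z₀) / 2 < l (n y.2) := h6
    linarith
  have hneg : Tendsto (fun y : ℝ × (Fin m → ℂ) => (-y.1, y.2)) (𝓝 (0, z₀)) (𝓝 (0, z₀)) := by
    have : Continuous fun y : ℝ × (Fin m → ℂ) => (-y.1, y.2) := by fun_prop
    simpa using this.tendsto (0, z₀)
  have hU : ∀ᶠ y : ℝ × (Fin m → ℂ) in 𝓝 (0, z₀), y.2 ∈ U :=
    continuous_snd.continuousAt.eventually_mem (h.isOpen.mem_nhds hz)
  filter_upwards [key, hneg.eventually key, hU] with y h1 h2 h3 hyM hy0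
  have h4 := h1 hyM hy0
  have h5 := h2 hyM (neg_ne_zero.2 hy0)
  simp only [neg_smul, ← sub_eq_add_neg] at h5
  rcases h.hyperNormal_eq_or h3 hyM with h6 | h6 <;> rw [h6]
  · exact ⟨h4, h5⟩
  · rw [smul_neg, sub_neg_eq_add, ← sub_eq_add_neg]
    exact ⟨h5, h4⟩

end UnitNormal

section Final

open Filter Topology

variable {m : ℕ}

/-- A smooth cone contained in a real hypersurface cone does not exist in dimension at least
three: the normal of the hypersurface would trivialize the square of the normal bundle. -/
lemma SmoothCone.not_subset_hypersurface {L M : Set (Fin m → ℂ)} (h : SmoothCone L) (hLM : L ⊆ M)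
    (hcone : IsCone M) (hM : ∀ z ∈ M, ∃ U ρ, z ∈ U ∧ DefFn M U ρ) {b p a : Fin m → ℂ}
    (hb : b ∉ L) (hb0 : b ≠ 0) (hp : p ∈ L)
    (hind : ∀ x y t : ℂ, x • p + y • a + t • b = 0 → x = 0 ∧ y = 0) : False := by
  have hline : ∀ z ∈ L, ∀ t : ℂ, z + t • b ≠ 0 := by
    intro z hz t h0
    have ht : t ≠ 0 := by
      rintro rfl
      exact h.ne_zero z hz (by simpa using h0)
    have h1 : z = (-t) • b := by rw [neg_smul]; exact eq_neg_of_add_eq_zero_left h0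
    exact hb ((h.smul_mem_iff (neg_ne_zero.2 ht)).1 (h1 ▸ hz))
  set O : Set (Fin m → ℂ) := {z | (∀ t : ℂ, z + t • b ≠ 0) ∧ lineDivisor L b z ≠ 0} with hO
  have hLO : ∀ z ∈ L, O ∈ 𝓝 z := by
    intro z hz
    filter_upwards [(isOpen_forall_add_smul_ne_zero b).mem_nhds (hline z hz),
      (h.multisetContinuousAt hb hb0 (hline z hz)).eventually_card_eq] with y h1 h2
    refine ⟨h1, fun h0 => ?_⟩
    rw [h0, Multiset.card_zero, eq_comm, Multiset.card_eq_zero] at h2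
    have h3 : (0:ℂ) ∈ lineDivisor L b z :=
      (h.mem_lineDivisor hb hb0 (hline z hz) 0).2 (by simpa using hz)
    rw [h2] at h3
    exact Multiset.notMem_zero _ h3
  set S : Set (Fin m → ℂ) := L ∩ Metric.sphere 0 1 with hS
  have hSc : IsCompact S := by
    have e : S = closure L ∩ Metric.sphere 0 1 := by
      refine Set.ext fun z => ⟨fun hz => ⟨subset_closure hz.1, hz.2⟩, fun hz => ⟨?_, hz.2⟩⟩
      refine h.closed z (norm_ne_zero_iff.1 ?_) hz.1
      rw [mem_sphere_zero_iff_norm.1 hz.2]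
      exact one_ne_zero
    rw [e]
    exact (isCompact_sphere _ _).inter_left isClosed_closure
  have hdisp : ∀ᶠ s : ℝ in 𝓝 0, ∀ z ∈ S, z ∈ M → s ≠ 0 →
      (z + s • hyperNormal M z ∉ M ∧ z + s • hyperNormal M z ∈ O) ∧
      (z - s • hyperNormal M z ∉ M ∧ z - s • hyperNormal M z ∈ O) := by
    refine hSc.eventually_forall_of_forall_eventually fun z hz => ?_
    obtain ⟨U, ρ, hzU, hρ⟩ := hM z (hLM hz.1)
    exact hρ.eventually_notMem hzU (hLO z hz.1)
  obtain ⟨ε, hε0, hε⟩ : ∃ ε : ℝ, 0 < ε ∧ ∀ z ∈ S,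
      (z + ε • hyperNormal M z ∉ L ∧ z + ε • hyperNormal M z ∈ O) ∧
      (z - ε • hyperNormal M z ∉ L ∧ z - ε • hyperNormal M z ∈ O) := by
    obtain ⟨a, ha, hball⟩ := Metric.eventually_nhds_iff.1 hdisp
    refine ⟨a / 2, half_pos ha, fun z hz => ?_⟩
    have h1 := hball (y := a / 2) (by rw [Real.dist_0_eq_abs, abs_of_pos] <;> linarith) z hz
      (hLM hz.1) (half_pos ha).ne'
    exact ⟨⟨fun hc => h1.1.1 (hLM hc), h1.1.2⟩, ⟨fun hc => h1.2.1 (hLM hc), h1.2.2⟩⟩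
  let G : (Fin m → ℂ) → ℂ := lineProd L b
  let Ψ : (Fin m → ℂ) → ℂ := fun z =>
    G (z + ε • hyperNormal M z) * G (z - ε • hyperNormal M z)
  let e : (Fin m → ℂ) → ℕ := fun z =>
    Multiset.card (lineDivisor L b (z + ε • hyperNormal M z)) +
      Multiset.card (lineDivisor L b (z - ε • hyperNormal M z))
  have hΨ0 : ∀ z ∈ S, Ψ z ≠ 0 := by
    intro z hz
    obtain ⟨⟨h1, h2⟩, h3, h4⟩ := hε z hz
    exact mul_ne_zero (fun h0 => h1 ((h.lineProd_eq_zero_iff hb hb0 h2.1).1 h0))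
      (fun h0 => h3 ((h.lineProd_eq_zero_iff hb hb0 h4.1).1 h0))
  have he0 : ∀ z ∈ S, e z ≠ 0 := by
    intro z hz h0
    exact (hε z hz).1.2.2 (Multiset.card_eq_zero.1 (Nat.add_eq_zero_iff.1 h0).1)
  have hΨs : ∀ z ∈ S, ∀ c : ℂ, ‖c‖ = 1 → Ψ (c • z) = c ^ e z * Ψ z := by
    intro z hz c hc
    have hc0 : c ≠ 0 := norm_ne_zero_iff.1 (by rw [hc]; exact one_ne_zero)
    obtain ⟨U, ρ, hzU, hρ⟩ := hM z (hLM hz.1)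
    have h1 : Ψ (c • z) = G (c • (z + ε • hyperNormal M z)) * G (c • (z - ε • hyperNormal M z)) := by
      simp only [Ψ]
      rw [smul_add, smul_sub, smul_comm c ε]
      rcases hρ.hyperNormal_smul hcone hzU (hLM hz.1) hc with h2 | h2 <;> rw [h2]
      rw [smul_neg, sub_neg_eq_add, ← sub_eq_add_neg, mul_comm]
    rw [h1]
    simp only [G, Ψ, e]
    rw [h.lineProd_smul hb hb0 (hε z hz).1.2.1 hc0, h.lineProd_smul hb hb0 (hε z hz).2.2.1 hc0,
      pow_add]
    ring
  have hΨc : ContinuousOn Ψ S := by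
    intro z hz
    obtain ⟨U, ρ, hzU, hρ⟩ := hM z (hLM hz.1)
    let n : (Fin m → ℂ) → Fin m → ℂ := fun x => unitNormal (fderiv ℝ ρ x)
    have hn : ContinuousAt n z := hρ.continuousAt_normal hzU
    have heq : ∀ y ∈ U, y ∈ M → Ψ y = G (y + ε • n y) * G (y - ε • n y) := by
      intro y hy hyM
      simp only [Ψ]
      rcases hρ.hyperNormal_eq_or hy hyM with h2 | h2 <;> rw [h2]
      rw [smul_neg, sub_neg_eq_add, ← sub_eq_add_neg, mul_comm]
    have hO' : z + ε • n z ∈ O ∧ z - ε • n z ∈ O := by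
      have h1 := hε z hz
      rcases hρ.hyperNormal_eq_or hzU (hLM hz.1) with h2 | h2 <;> rw [h2] at h1
      · exact ⟨h1.1.2, h1.2.2⟩
      · rw [smul_neg, sub_neg_eq_add, ← sub_eq_add_neg] at h1
        exact ⟨h1.2.2, h1.1.2⟩
    have h3 : ContinuousAt (fun y => G (y + ε • n y)) z :=
      ContinuousAt.comp (g := G) (f := fun y => y + ε • n y)
        (h.continuousAt_lineProd hb hb0 hO'.1.1) (continuousAt_id.add (hn.const_smul ε))
    have h4 : ContinuousAt (fun y => G (y - ε • n y)) z :=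
      ContinuousAt.comp (g := G) (f := fun y => y - ε • n y)
        (h.continuousAt_lineProd hb hb0 hO'.2.1) (continuousAt_id.sub (hn.const_smul ε))
    refine (h3.mul h4).continuousWithinAt.congr_of_eventuallyEq ?_ (heq z hzU (hLM hz.1))
    filter_upwards [mem_nhdsWithin_of_mem_nhds (hρ.isOpen.mem_nhds hzU), self_mem_nhdsWithin]
      with y hy hyS using heq y hy (hLM hyS.1)
  let π : (Fin m → ℂ) → Fin m → ℂ := fun z => ((‖z‖⁻¹ : ℝ) : ℂ) • z
  have hπS : ∀ z ∈ L, π z ∈ S := by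
    intro z hz
    have h1 : ‖z‖ ≠ 0 := norm_ne_zero_iff.2 (h.ne_zero z hz)
    refine ⟨h.smul_mem _ (by exact_mod_cast inv_ne_zero h1) z hz, ?_⟩
    rw [mem_sphere_zero_iff_norm, norm_smul, norm_real, norm_inv, norm_norm, inv_mul_cancel₀ h1]
  have hπc : ContinuousOn π L := by
    intro z hz
    have h1 : ‖z‖ ≠ 0 := norm_ne_zero_iff.2 (h.ne_zero z hz)
    refine ContinuousAt.continuousWithinAt ?_
    exact (continuous_ofReal.continuousAt.comp (continuous_norm.continuousAt.inv₀ h1)).smul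
      continuousAt_id
  refine h.no_homogeneous_section hb hb0 hp hind (Ψ := fun z => Ψ (π z)) (e := fun z => e (π z))
    (hΨc.comp hπc hπS) (fun z hz => hΨ0 _ (hπS z hz)) (fun z hz => he0 _ (hπS z hz)) ?_
  intro z hz c hc
  have h1 : π (c • z) = c • π z := by
    simp only [π]
    rw [norm_smul, hc, one_mul, smul_comm]
  simp only [h1]
  exact hΨs _ (hπS z hz) c hc

lemma SmoothCone.exists_notMem {V : Type*} [NormedAddCommGroup V] [NormedSpace ℂ V] {L : Set V}
    (h : SmoothCone L) {p : V} (hp : p ∈ L) : ∃ b, b ∉ L ∧ b ≠ 0 := by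
  by_contra! hc
  obtain ⟨W, f, hpW, hf⟩ := h.locEq p hp
  have h1 : f =ᶠ[𝓝 p] fun _ => 0 := by
    filter_upwards [hf.isOpen.mem_nhds hpW, isOpen_ne.mem_nhds (h.ne_zero p hp)] with z hz hz0
    refine (hf.mem_iff z hz).1 ?_
    by_contra hzL
    exact hz0 (hc z hzL)
  refine hf.fderiv_ne p hpW hp ?_
  rw [h1.fderiv_eq, fderiv_const_apply]

lemma exists_independent {V : Type*} [AddCommGroup V] [Module ℂ V]
    (hV : 3 ≤ Module.finrank ℂ V) {p b : V} (hpb : ∀ x t : ℂ, x • p + t • b = 0 → x = 0) :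
    ∃ a : V, ∀ x y t : ℂ, x • p + y • a + t • b = 0 → x = 0 ∧ y = 0 := by
  have hne : Submodule.span ℂ {p, b} ≠ ⊤ := by
    intro htop
    classical
    have h1 := finrank_span_finset_le_card (R := ℂ) (M := V) {p, b}
    rw [Finset.coe_insert, Finset.coe_singleton, Set.finrank, htop, finrank_top] at h1
    have h2 := Finset.card_le_two (a := p) (b := b)
    omega
  obtain ⟨a, -, ha⟩ := SetLike.exists_of_lt hne.lt_top
  refine ⟨a, fun x y t h0 => ?_⟩
  have hy : y = 0 := by
    by_contra hy
    refine ha (Submodule.mem_span_pair.2 ⟨-(y⁻¹ * x), -(y⁻¹ * t), ?_⟩)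
    have h1 : y • a = -(x • p + t • b) := by
      rw [eq_neg_iff_add_eq_zero, ← h0]; abel
    rw [← one_smul ℂ a, ← inv_mul_cancel₀ hy, mul_smul, h1]
    module
  rw [hy, zero_smul, add_zero] at h0
  exact ⟨hpb x t h0, hy⟩

end Final

/-- No leaf of the Levi foliation of a closed smooth Levi-flat hypersurface in `ℂℙⁿ`,
`n ≥ 2`, is compact. -/
theorem no_compact_leaf_of_leviFlat_in_CPn (n : ℕ) (hn : 2 ≤ n)
    (M : Set (Fin (n + 1) → ℂ)) (hM : IsProjectiveClosedSet M)
    (hLF : IsSmoothLeviFlatHypersurface M) :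
    ∀ p ∈ M, ∃ z : Fin (n + 1) → ℂ,
      z ≠ 0 ∧ z ∈ closure (leviLeaf M p) ∧ z ∉ leviLeaf M p := by
  intro p hp
  by_contra! hcl
  obtain ⟨-, hM0, hcone, -⟩ := hM
  have hLM := leviLeaf_subset hLF hp
  have hpL : p ∈ leviLeaf M p := Relation.ReflTransGen.refl
  have hL : SmoothCone (leviLeaf M p) := by
    refine ⟨isCone_leviLeaf hLF hcone hp, fun z hz => hM0 z (hLM hz), hcl, fun q hq => ?_⟩
    obtain ⟨W, hW, hqW, f, hf, hf', hiff⟩ :=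
      exists_local_equation hLF (fun h0 => hM0 0 h0 rfl) hp hcl hq
    exact ⟨W, f, hqW, hW, hf, fun z hz _ => hf' z hz, hiff⟩
  obtain ⟨b, hb, hb0⟩ := hL.exists_notMem hpL
  have hpb : ∀ x t : ℂ, x • p + t • b = 0 → x = 0 := by
    intro x t h0
    by_contra hx
    have hxp := hL.smul_mem x hx p hpL
    have ht : t ≠ 0 := by
      rintro rfl
      exact hL.ne_zero _ hxp (by simpa using h0)
    rw [eq_neg_of_add_eq_zero_left h0, ← neg_smul, hL.smul_mem_iff (neg_ne_zero.2 ht)] at hxp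
    exact hb hxp
  obtain ⟨a, ha⟩ := exists_independent (by rw [Module.finrank_fin_fun]; omega) hpb
  refine hL.not_subset_hypersurface hLM hcone (fun z hz => ?_) hb hb0 hpL ha
  obtain ⟨U, hU, hzU, ρ, hρ, hρ', hiff, -⟩ := hLF z hz
  exact ⟨U, ρ, hzU, hU, by simpa using hρ 1, hρ', hiff⟩
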